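/- Let G be a 2-connected claw-o-heavy graph of order n. If for every induced path v1v2v3v4v5v6 on 6 vertices in G we have max{d(v1), d(v6)} ≥ n/2, then G is hamiltonian. -/

import Mathlib

/-- A graph is 2-connected if it has at least 3 vertices and deleting any
single vertex leaves a connected graph. -/
def TwoConnected {V : Type*} [Fintype V] (G : SimpleGraph V) : Prop :=
  3 ≤ Fintype.card V ∧ ∀ v : V, (G.induce ({v}ᶜ : Set V)).Connected

/-- A graph `G` of order `n` is claw-o-heavy if every induced copy of the claw `K_{1,3}`
(with center `a` and leaves `b₁, b₂, b₃`) contains two nonadjacent vertices whose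
degree sum in `G` is at least `n`. -/
def ClawOHeavy {V : Type*} [Fintype V] (G : SimpleGraph V) [DecidableRel G.Adj] : Prop :=
  ∀ a b₁ b₂ b₃ : V, b₁ ≠ b₂ → b₁ ≠ b₃ → b₂ ≠ b₃ →
    G.Adj a b₁ → G.Adj a b₂ → G.Adj a b₃ →
    ¬ G.Adj b₁ b₂ → ¬ G.Adj b₁ b₃ → ¬ G.Adj b₂ b₃ →
    ∃ u v : V, u ∈ ({a, b₁, b₂, b₃} : Set V) ∧ v ∈ ({a, b₁, b₂, b₃} : Set V) ∧
      u ≠ v ∧ ¬ G.Adj u v ∧ Fintype.card V ≤ G.degree u + G.degree v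

/-- `v 0, v 1, …, v 5` is an induced path on 6 vertices in `G`. -/
def IsInducedP6 {V : Type*} (G : SimpleGraph V) (v : Fin 6 → V) : Prop :=
  Function.Injective v ∧
    ∀ i j : Fin 6, G.Adj (v i) (v j) ↔ (i.val + 1 = j.val ∨ j.val + 1 = i.val)

namespace ClawHeavy

open SimpleGraph List

section Segments

variable {V : Type*} {G H : SimpleGraph V}

/-- `l` lists the vertices of a walk in `G` from `a` to `b`. -/
def Seg (G : SimpleGraph V) (a : V) (l : List V) (b : V) : Prop :=
  l.IsChain G.Adj ∧ l.head? = some a ∧ l.getLast? = some b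

lemma Seg.singleton (G : SimpleGraph V) (a : V) : Seg G a [a] a := by
  simp [Seg]

lemma Seg.ne_nil {a b : V} {l : List V} (h : Seg G a l b) : l ≠ [] := by
  rintro rfl
  simp [Seg] at h

lemma Seg.append {a b c d : V} {l m : List V} (hl : Seg G a l b) (hbc : G.Adj b c)
    (hm : Seg G c m d) : Seg G a (l ++ m) d := by
  obtain ⟨h1, h2, h3⟩ := hl
  obtain ⟨h4, h5, h6⟩ := hm
  refine ⟨List.isChain_append.2 ⟨h1, h4, ?_⟩, ?_, ?_⟩
  · intro x hx y hy
    rw [h3] at hx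
    rw [h5] at hy
    simp at hx hy
    subst hx hy
    exact hbc
  · simp [List.head?_append, h2]
  · simp [List.getLast?_append, h6]

lemma Seg.reverse {a b : V} {l : List V} (hl : Seg G a l b) : Seg G b l.reverse a := by
  obtain ⟨h1, h2, h3⟩ := hl
  refine ⟨?_, by simpa using h3, by simpa using h2⟩
  rw [List.isChain_reverse]
  exact h1.imp fun _ _ h => h.symm

lemma Seg.mono {a b : V} {l : List V} (hl : Seg G a l b) (h : G ≤ H) : Seg H a l b :=
  ⟨hl.1.imp fun _ _ h' => h h', hl.2⟩

lemma Seg.split {a b : V} {l m : List V} (h : Seg G a (l ++ m) b) (hl : l ≠ []) (hm : m ≠ []) :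
    ∃ c d, Seg G a l c ∧ G.Adj c d ∧ Seg G d m b := by
  obtain ⟨h1, h2, h3⟩ := h
  obtain ⟨h4, h5, h6⟩ := List.isChain_append.1 h1
  have hc := List.getLast?_eq_some_getLast hl
  have hd := List.head?_eq_some_head hm
  refine ⟨l.getLast hl, m.head hm, ⟨h4, ?_, hc⟩, h6 _ hc _ hd, h5, hd, ?_⟩
  · rwa [List.head?_append_of_ne_nil _ hl] at h2
  · rwa [List.getLast?_append_of_ne_nil _ hm] at h3

lemma Seg.eq_of_singleton {a b c : V} (h : Seg G a [c] b) : a = c ∧ b = c := by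
  obtain ⟨-, h1, h2⟩ := h
  simp at h1 h2
  exact ⟨h1.symm, h2.symm⟩

lemma Seg.head_mem {a b : V} {l : List V} (h : Seg G a l b) : a ∈ l :=
  List.mem_of_head? h.2.1

lemma Seg.last_mem {a b : V} {l : List V} (h : Seg G a l b) : b ∈ l :=
  List.mem_of_getLast? h.2.2

/-- There is a Hamilton cycle, given by its list of vertices. -/
def HamL (G : SimpleGraph V) : Prop :=
  ∃ a l b, Seg G a l b ∧ G.Adj b a ∧ l.Nodup ∧ (∀ v, v ∈ l) ∧ 3 ≤ l.length

/-- There is a Hamilton path from `a` to `b`. -/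
def HamPath (G : SimpleGraph V) (a b : V) : Prop :=
  ∃ l, Seg G a l b ∧ l.Nodup ∧ (∀ v, v ∈ l)

lemma HamPath.symm {a b : V} (h : HamPath G a b) : HamPath G b a := by
  obtain ⟨l, h1, h2, h3⟩ := h
  exact ⟨l.reverse, h1.reverse, by simpa using h2, by simpa using h3⟩

lemma HamL.mono (h : HamL G) (hGH : G ≤ H) : HamL H := by
  obtain ⟨a, l, b, h1, h2, h3⟩ := h
  exact ⟨a, l, b, h1.mono hGH, hGH h2, h3⟩

lemma HamL.of_perm {a b : V} {l m : List V} (hs : Seg G a l b) (hab : G.Adj b a)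
    (hp : l.Perm m) (hm : m.Nodup) (hm' : ∀ v, v ∈ m) (h3 : 3 ≤ m.length) : HamL G :=
  ⟨a, l, b, hs, hab, hp.nodup_iff.2 hm, fun v => hp.mem_iff.2 (hm' v), hp.length_eq ▸ h3⟩

lemma Seg.of_edge {p q : V} {l : List V} (h : Seg (G ⊔ edge p q) p l q) (hn : l.Nodup)
    (h3 : 3 ≤ l.length) : Seg G p l q := by
  obtain ⟨h1, h2, h4⟩ := h
  refine ⟨?_, h2, h4⟩
  rw [List.isChain_iff_getElem] at h1 ⊢
  intro i hi
  have h5 : p = l[0] := by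
    rw [List.head?_eq_getElem?, List.getElem?_eq_getElem (by omega)] at h2
    simpa using h2.symm
  have h6 : q = l[l.length - 1] := by
    rw [List.getLast?_eq_getElem?, List.getElem?_eq_getElem (by omega)] at h4
    simpa using h4.symm
  have h7 := h1 i hi
  rw [sup_adj, edge_adj] at h7
  rcases h7 with h7 | ⟨⟨h8, h9⟩ | ⟨h8, h9⟩, -⟩
  · exact h7
  · rw [h5] at h8
    rw [h6] at h9
    rw [hn.getElem_inj_iff] at h8 h9
    omega
  · rw [h6] at h8
    rw [hn.getElem_inj_iff] at h8
    omega

lemma hamPath_of_edge {p q : V} (h : HamL (G ⊔ edge p q)) (hG : ¬ HamL G) : HamPath G p q := by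
  obtain ⟨a, l, b, h1, h2, h3, h4, h5⟩ := h
  suffices h : ∃ l', Seg (G ⊔ edge p q) p l' q ∧ l'.Nodup ∧ (∀ v, v ∈ l') ∧ 3 ≤ l'.length by
    obtain ⟨l', h1, h2, h3, h4⟩ := h
    exact ⟨l', h1.of_edge h2 h4, h2, h3⟩
  have key : ∀ u v m, Seg (G ⊔ edge p q) v m u → (G ⊔ edge p q).Adj u v → ¬ G.Adj u v →
      m.Perm l → ∃ l', Seg (G ⊔ edge p q) p l' q ∧ l'.Nodup ∧ (∀ v, v ∈ l') ∧ 3 ≤ l'.length := by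
    intro u v m hs ha hna hp
    rw [sup_adj, edge_adj] at ha
    rcases ha with ha | ⟨⟨rfl, rfl⟩ | ⟨rfl, rfl⟩, -⟩
    · exact absurd ha hna
    · exact ⟨m.reverse, hs.reverse, by simpa using hp.nodup_iff.2 h3,
        fun v => by simpa using hp.mem_iff.2 (h4 v), by simpa using hp.length_eq ▸ h5⟩
    · exact ⟨m, hs, hp.nodup_iff.2 h3, fun v => hp.mem_iff.2 (h4 v), hp.length_eq ▸ h5⟩
  by_cases hch : l.IsChain G.Adj
  · by_cases hba : G.Adj b a
    · exact absurd ⟨a, l, b, ⟨hch, h1.2⟩, hba, h3, h4, h5⟩ hG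
    · exact key b a l h1 h2 hba (List.Perm.refl _)
  · rw [List.isChain_iff_getElem] at hch
    push Not at hch
    obtain ⟨i, hi, hni⟩ := hch
    have hl : l = l.take (i + 1) ++ l.drop (i + 1) := (List.take_append_drop _ _).symm
    have h1' := h1
    rw [hl] at h1'
    obtain ⟨c, d, hc, hcd, hd⟩ := h1'.split (by simp; rintro rfl; simp at h5)
      (by simp; omega)
    have e1 : c = l[i] := by
      have := hc.2.2
      rw [List.getLast?_take, List.getElem?_eq_getElem (by omega)] at this
      simpa using this.symm
    have e2 : d = l[i + 1] := by
      have := hd.2.1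
      rw [List.head?_drop, List.getElem?_eq_getElem (by omega)] at this
      simpa using this.symm
    refine key c d (l.drop (i + 1) ++ l.take (i + 1)) (hd.append h2 hc) hcd (by rwa [e1, e2]) ?_
    conv_rhs => rw [hl]
    exact List.perm_append_comm

/-- Number of neighbours. -/
noncomputable def dg (G : SimpleGraph V) (v : V) : ℕ := {w | G.Adj v w}.ncard

lemma dg_mono [Finite V] (h : G ≤ H) (v : V) : dg G v ≤ dg H v :=
  Set.ncard_le_ncard (fun _ hw => h hw)

lemma HamPath.dg_add_lt [Finite V] {p q : V} (h : HamPath G p q) (hG : ¬ HamL G)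
    (h3 : 3 ≤ Nat.card V) : dg G p + dg G q < Nat.card V := by
  classical
  have := Fintype.ofFinite V
  obtain ⟨l, h1, h2, h4⟩ := h
  have hlen : l.length = Nat.card V := by
    rw [Nat.card_eq_fintype_card, ← List.toFinset_card_of_nodup h2]
    congr 1
    ext v
    simp [h4]
  obtain ⟨-, hp, hq⟩ := id h1
  have h5 : l[0]? = some p := by rw [← List.head?_eq_getElem?, hp]
  have h6 : l[l.length - 1]? = some q := by rw [← List.getLast?_eq_getElem?, hq]
  let A : Finset ℕ := (Finset.range (l.length - 1)).filter fun i =>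
    ∃ v, l[i + 1]? = some v ∧ G.Adj p v
  let B : Finset ℕ := (Finset.range (l.length - 1)).filter fun i => ∃ v, l[i]? = some v ∧ G.Adj q v
  have hA : dg G p ≤ A.card := by
    have : {w | G.Adj p w} ⊆ ((A.image fun i => l[i + 1]?.getD p : Finset V) : Set V) := by
      intro w hw
      obtain ⟨i, hi, rfl⟩ := List.getElem_of_mem (h4 w)
      have hi0 : i ≠ 0 := by
        rintro rfl
        rw [List.getElem?_eq_getElem hi] at h5
        simp at h5
        exact hw.ne h5.symm
      simp only [Finset.coe_image, Set.mem_image, Finset.mem_coe]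
      refine ⟨i - 1, ?_, ?_⟩
      · simp only [A, Finset.mem_filter, Finset.mem_range]
        refine ⟨by omega, l[i], ?_, hw⟩
        rw [Nat.sub_add_cancel (by omega), List.getElem?_eq_getElem hi]
      · rw [Nat.sub_add_cancel (by omega), List.getElem?_eq_getElem hi]
        rfl
    calc dg G p ≤ _ := Set.ncard_le_ncard this
      _ ≤ _ := by rw [Set.ncard_coe_finset]; exact Finset.card_image_le
  have hB : dg G q ≤ B.card := by
    have : {w | G.Adj q w} ⊆ ((B.image fun i => l[i]?.getD p : Finset V) : Set V) := by
      intro w hw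
      obtain ⟨i, hi, rfl⟩ := List.getElem_of_mem (h4 w)
      have hi0 : i ≠ l.length - 1 := by
        rintro rfl
        rw [List.getElem?_eq_getElem hi] at h6
        simp at h6
        exact hw.ne h6.symm
      simp only [Finset.coe_image, Set.mem_image, Finset.mem_coe]
      refine ⟨i, ?_, ?_⟩
      · simp only [B, Finset.mem_filter, Finset.mem_range]
        refine ⟨by omega, l[i], ?_, hw⟩
        rw [List.getElem?_eq_getElem hi]
      · rw [List.getElem?_eq_getElem hi]
        rfl
    calc dg G q ≤ _ := Set.ncard_le_ncard this
      _ ≤ _ := by rw [Set.ncard_coe_finset]; exact Finset.card_image_le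
  have hdis : Disjoint A B := by
    rw [Finset.disjoint_left]
    intro i hiA hiB
    simp only [A, B, Finset.mem_filter, Finset.mem_range] at hiA hiB
    obtain ⟨hi, v, hv, hpv⟩ := hiA
    obtain ⟨-, w, hw, hqw⟩ := hiB
    have hl : l = l.take (i + 1) ++ l.drop (i + 1) := (List.take_append_drop _ _).symm
    have h1' := h1
    rw [hl] at h1'
    obtain ⟨c, d, hc, hcd, hd⟩ := h1'.split (by simp; rintro rfl; simp at hi)
      (by simp; omega)
    have e1 : c = w := by
      have := hc.2.2
      rw [List.getLast?_take] at this
      simp [hw] at this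
      exact this.symm
    have e2 : d = v := by
      have := hd.2.1
      rw [List.head?_drop, hv] at this
      simpa using this.symm
    subst e1 e2
    refine hG (HamL.of_perm (hc.append hqw.symm hd.reverse) hpv.symm ?_ h2 h4 (hlen ▸ h3))
    conv_rhs => rw [hl]
    exact List.Perm.append_left _ (List.reverse_perm _)
  have := Finset.card_union_of_disjoint hdis
  have h7 : (A ∪ B).card ≤ (Finset.range (l.length - 1)).card :=
    Finset.card_le_card (Finset.union_subset (Finset.filter_subset _ _) (Finset.filter_subset _ _))
  rw [Finset.card_range] at h7
  omega

/-- `M` is an edge-maximal non-hamiltonian graph below `B`. -/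
lemma exists_maximal_nonham [Finite V] (hG : ¬ HamL G) {B : SimpleGraph V} (hGB : G ≤ B) :
    ∃ M, G ≤ M ∧ M ≤ B ∧ ¬ HamL M ∧
      ∀ p q, p ≠ q → ¬ M.Adj p q → B.Adj p q → HamPath M p q := by
  obtain ⟨M, hGM, hM⟩ := (Set.toFinite {M : SimpleGraph V | M ≤ B ∧ ¬ HamL M}).exists_le_maximal
    (show G ∈ _ from ⟨hGB, hG⟩)
  refine ⟨M, hGM, hM.prop.1, hM.prop.2, fun p q hpq hn hb => hamPath_of_edge ?_ hM.prop.2⟩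
  by_contra hc
  have h1 : M ⊔ edge p q ≤ M := hM.2 (show _ ∈ {M : SimpleGraph V | M ≤ B ∧ ¬ HamL M} from
    ⟨sup_le hM.prop.1 (by rw [edge_le_iff]; exact Or.inr hb), hc⟩) le_sup_left
  exact hn (h1 (by rw [sup_adj, edge_adj]; exact Or.inr ⟨Or.inl ⟨rfl, rfl⟩, hpq⟩))

end Segments

section Completion

variable {V : Type*} {G M N : SimpleGraph V} {x : V}

/-- The segments of a Hamilton path of `M` from `p` to `q` cut at `x` and at a later vertex `w`,
when no Hamilton cycle of `N` arises from it. -/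
lemma cut_path {p q w : V} {A B C : List V} (hMN : M ≤ N) (hN : ¬ HamL N)
    (hR : ∀ a b₁ b₂ b₃, G.Adj a b₁ → G.Adj a b₂ → G.Adj a b₃ →
      (b₁ = b₂ ∨ N.Adj b₁ b₂) ∨ (b₁ = b₃ ∨ N.Adj b₁ b₃) ∨ (b₂ = b₃ ∨ N.Adj b₂ b₃))
    (hMG : ∀ u v, M.Adj u v → G.Adj u v ∨ (G.Adj x u ∧ G.Adj x v)) (hGN : G ≤ N)
    (hs : Seg M p (A ++ [x] ++ B ++ [w] ++ C) q) (hn : (A ++ [x] ++ B ++ [w] ++ C).Nodup)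
    (hm : ∀ v, v ∈ A ++ [x] ++ B ++ [w] ++ C) (hpq : p ≠ q) (hpqN : ¬ N.Adj p q)
    (hp : G.Adj x p) (hq : G.Adj x q) (hwp : N.Adj w p) (hwq : w ≠ q) :
    ∃ x₀ x₁ w₀ w₁, Seg N p A x₀ ∧ N.Adj x₀ x ∧ N.Adj x x₁ ∧ Seg N x₁ B w₀ ∧ M.Adj w₀ w ∧
      M.Adj w w₁ ∧ Seg N w₁ C q ∧ N.Adj q x₁ ∧ w₀ ≠ x ∧ w₁ ≠ x ∧ w₀ ≠ w₁ ∧ p ≠ w₀ ∧ p ≠ w₁ ∧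
        3 ≤ (A ++ [x] ++ B ++ [w] ++ C).length := by
  classical
  have hA : A ≠ [] := by
    rintro rfl
    have := hs.2.1
    simp at this
    exact hp.ne this
  have hC : C ≠ [] := by
    rintro rfl
    have := hs.2.2
    rw [List.append_nil, List.getLast?_append_of_ne_nil _ (by simp)] at this
    simp at this
    exact hwq this
  have h3 : 3 ≤ (A ++ [x] ++ B ++ [w] ++ C).length := by
    have := List.length_pos_iff.2 hA
    simp
    omega
  obtain ⟨w₂, w₁, hs₁, hw₁, hsC⟩ := hs.split (by simp) hC
  obtain ⟨w₀, w₃, hs₂, hw₀, hsw⟩ := hs₁.split (by simp) (by simp)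
  obtain ⟨e₁, e₂⟩ := hsw.eq_of_singleton
  rw [e₁] at hw₀
  rw [e₂] at hw₁
  have hB : B ≠ [] := by
    rintro rfl
    rw [List.append_nil] at hs₂
    obtain ⟨x₀, x', hsA, hx₀, hsx⟩ := hs₂.split hA (by simp)
    obtain ⟨e₁, e₂⟩ := hsx.eq_of_singleton
    rw [e₁] at hx₀
    refine hN (HamL.of_perm ((((hsA.mono hMN).reverse.append hwp.symm
      (Seg.singleton N w)).append (hMN hw₁) (hsC.mono hMN)).append (hGN hq.symm)
        (Seg.singleton N x)) (hMN hx₀.symm) ?_ hn hm h3)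
    simp only [List.perm_iff_count, List.count_append, List.count_reverse, List.count_nil]
    intro; omega
  obtain ⟨x', x₁, hs₃, hx₁, hsB⟩ := hs₂.split (by simp) hB
  obtain ⟨x₀, x₂, hsA, hx₀, hsx⟩ := hs₃.split hA (by simp)
  obtain ⟨e₁, e₂⟩ := hsx.eq_of_singleton
  rw [e₁] at hx₀
  rw [e₂] at hx₁
  have f1 : ¬ N.Adj p x₁ := by
    intro h
    refine hN (HamL.of_perm ((((((hsA.mono hMN).reverse.append h (hsB.mono hMN)).append
      (hMN hw₀) (Seg.singleton N w)).append (hMN hw₁) (hsC.mono hMN)).append (hGN hq.symm)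
        (Seg.singleton N x))) (hMN hx₀.symm) ?_ hn hm h3)
    simp only [List.perm_iff_count, List.count_append, List.count_reverse]
    intro; omega
  have hx₁G : G.Adj x x₁ := (hMG _ _ hx₁).resolve_right fun h => h.1.ne rfl
  have m1 := hsA.head_mem
  have m2 := hsB.head_mem
  have m3 := hsB.last_mem
  have m4 := hsC.head_mem
  have m5 := hsC.last_mem
  simp only [List.nodup_append, List.mem_append, List.mem_singleton] at hn
  obtain ⟨⟨⟨⟨-, -, n1⟩, -, n2⟩, -, n3⟩, -, n4⟩ := hn
  have hqx : N.Adj q x₁ := by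
    rcases hR x p q x₁ hp hq hx₁G with h | h | h
    · exact absurd h (not_or.2 ⟨hpq, hpqN⟩)
    · exact absurd h (not_or.2 ⟨n2 _ (Or.inl m1) _ m2, f1⟩)
    · exact h.resolve_left (n4 _ (Or.inl (Or.inr m2)) _ m5).symm
  exact ⟨x₀, x₁, w₀, w₁, hsA.mono hMN, hMN hx₀, hMN hx₁, hsB.mono hMN, hw₀, hw₁, hsC.mono hMN,
    hqx, (n2 _ (Or.inr rfl) _ m3).symm, (n4 _ (Or.inl (Or.inl (Or.inr rfl))) _ m4).symm,
    n4 _ (Or.inl (Or.inr m3)) _ m4, n2 _ (Or.inl m1) _ m3,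
    n4 _ (Or.inl (Or.inl (Or.inl m1))) _ m4, h3⟩

/-- Any two vertices of a Hamilton path separate it, up to reversal. -/
lemma HamPath.cut {p q w : V} (h : HamPath M p q) (hxw : x ≠ w) :
    ∃ A B C p' q', ((p' = p ∧ q' = q) ∨ (p' = q ∧ q' = p)) ∧
      Seg M p' (A ++ [x] ++ B ++ [w] ++ C) q' ∧ (A ++ [x] ++ B ++ [w] ++ C).Nodup ∧
      ∀ v, v ∈ A ++ [x] ++ B ++ [w] ++ C := by
  obtain ⟨l, h1, h2, h3⟩ := h
  obtain ⟨A, T, rfl⟩ := List.append_of_mem (h3 x)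
  have h4 := h3 w
  simp only [List.mem_append, List.mem_cons] at h4
  rcases h4 with h4 | h4 | h4
  · obtain ⟨B, C, rfl⟩ := List.append_of_mem h4
    refine ⟨T.reverse, C.reverse, B.reverse, q, p, Or.inr ⟨rfl, rfl⟩, ?_⟩
    have : T.reverse ++ [x] ++ C.reverse ++ [w] ++ B.reverse = (B ++ w :: C ++ x :: T).reverse := by
      simp
    rw [this]
    exact ⟨h1.reverse, List.nodup_reverse.2 h2, fun v => List.mem_reverse.2 (h3 v)⟩
  · exact absurd h4.symm hxw
  · obtain ⟨B, C, rfl⟩ := List.append_of_mem h4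
    refine ⟨A, B, C, p, q, Or.inl ⟨rfl, rfl⟩, ?_⟩
    have : A ++ [x] ++ B ++ [w] ++ C = A ++ x :: (B ++ w :: C) := by simp
    rw [this]
    exact ⟨h1, h2, h3⟩

lemma no_middle_neighbor {p q w : V} (hMN : M ≤ N) (hN : ¬ HamL N)
    (hR : ∀ a b₁ b₂ b₃, G.Adj a b₁ → G.Adj a b₂ → G.Adj a b₃ →
      (b₁ = b₂ ∨ N.Adj b₁ b₂) ∨ (b₁ = b₃ ∨ N.Adj b₁ b₃) ∨ (b₂ = b₃ ∨ N.Adj b₂ b₃))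
    (hMG : ∀ u v, M.Adj u v → G.Adj u v ∨ (G.Adj x u ∧ G.Adj x v)) (hGN : G ≤ N)
    (h : HamPath M p q) (hpq : p ≠ q) (hpqN : ¬ N.Adj p q)
    (hp : G.Adj x p) (hq : G.Adj x q) (hw : G.Adj x w) (hwp : N.Adj w p) (hwq : N.Adj w q) :
    False := by
  classical
  obtain ⟨A, B, C, p', q', hpq', hs, hn, hm⟩ := h.cut hw.ne
  wlog hp' : p' = p ∧ q' = q generalizing p q
  · refine this h.symm hpq.symm (fun h => hpqN h.symm) hq hp hwq hwp hpq'.symm ?_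
    exact hpq'.resolve_left hp'
  obtain ⟨rfl, rfl⟩ := hp'
  obtain ⟨x₀, x₁, w₀, w₁, hA, hx₀, hx₁, hB, hw₀, hw₁, hC, hqx, e1, e2, e3, -, -, h3⟩ :=
    cut_path hMN hN hR hMG hGN hs hn hm hpq hpqN hp hq hwp hwq.ne
  have c1 : ¬ N.Adj w₀ x := by
    intro h
    refine hN (HamL.of_perm ((((hA.append hx₀ (Seg.singleton N x)).append h.symm
      hB.reverse).append hqx.symm hC.reverse).append (hMN hw₁).symm (Seg.singleton N w)) hwp
      ?_ hn hm h3)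
    simp only [List.perm_iff_count, List.count_append, List.count_reverse]
    intro; omega
  have c2 : ¬ N.Adj w₀ w₁ := by
    intro h
    refine hN (HamL.of_perm ((((hA.append hx₀ (Seg.singleton N x)).append hx₁
      hB).append h hC).append hwq.symm (Seg.singleton N w)) hwp ?_ hn hm h3)
    simp only [List.perm_iff_count, List.count_append]
    intro; omega
  have c3 : ¬ N.Adj w₁ x := by
    intro h
    refine hN (HamL.of_perm ((((hA.append hx₀ (Seg.singleton N x)).append h.symm
      hC).append hqx hB).append (hMN hw₀) (Seg.singleton N w)) hwp ?_ hn hm h3)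
    simp only [List.perm_iff_count, List.count_append]
    intro; omega
  have g0 : G.Adj w w₀ := (hMG _ _ hw₀.symm).resolve_right fun h => c1 (hGN h.2.symm)
  have g1 : G.Adj w w₁ := (hMG _ _ hw₁).resolve_right fun h => c3 (hGN h.2.symm)
  rcases hR w w₀ w₁ x g0 g1 hw.symm with h | h | h
  · exact h.elim e3 c2
  · exact h.elim e1 c1
  · exact h.elim e2 c3

lemma no_far_common_neighbor {p q y : V} (hMN : M ≤ N) (hN : ¬ HamL N)
    (hR : ∀ a b₁ b₂ b₃, G.Adj a b₁ → G.Adj a b₂ → G.Adj a b₃ →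
      (b₁ = b₂ ∨ N.Adj b₁ b₂) ∨ (b₁ = b₃ ∨ N.Adj b₁ b₃) ∨ (b₂ = b₃ ∨ N.Adj b₂ b₃))
    (hMG : ∀ u v, M.Adj u v → G.Adj u v ∨ (G.Adj x u ∧ G.Adj x v)) (hGN : G ≤ N)
    (h : HamPath M p q) (hpq : p ≠ q) (hpqN : ¬ N.Adj p q)
    (hp : G.Adj x p) (hq : G.Adj x q) (hxy : N.Adj x y) (hxyG : ¬ G.Adj x y)
    (hyp : G.Adj y p) (hyq : G.Adj y q) : False := by
  classical
  obtain ⟨A, B, C, p', q', hpq', hs, hn, hm⟩ := h.cut hxy.ne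
  wlog hp' : p' = p ∧ q' = q generalizing p q
  · refine this h.symm hpq.symm (fun h => hpqN h.symm) hq hp hyq hyp hpq'.symm ?_
    exact hpq'.resolve_left hp'
  obtain ⟨rfl, rfl⟩ := hp'
  obtain ⟨x₀, x₁, y₀, y₁, hA, hx₀, hx₁, hB, hy₀, hy₁, hC, hqx, e1, e2, e3, e4, e5, h3⟩ :=
    cut_path hMN hN hR hMG hGN hs hn hm hpq hpqN hp hq (hGN hyp) hyq.ne
  have c1 : ¬ N.Adj y₀ p' := by
    intro h
    refine hN (HamL.of_perm ((((hA.reverse.append h.symm hB.reverse).append hqx.symm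
      hC.reverse).append (hMN hy₁).symm (Seg.singleton N y)).append hxy.symm (Seg.singleton N x))
      hx₀.symm ?_ hn hm h3)
    simp only [List.perm_iff_count, List.count_append, List.count_reverse]
    intro; omega
  have c2 : ¬ N.Adj y₀ y₁ := by
    intro h
    refine hN (HamL.of_perm ((((hA.append hx₀ (Seg.singleton N x)).append hx₁
      hB).append h hC).append (hGN hyq.symm) (Seg.singleton N y)) (hGN hyp) ?_ hn hm h3)
    simp only [List.perm_iff_count, List.count_append]
    intro; omega
  have c3 : ¬ N.Adj y₁ p' := by
    intro h
    refine hN (HamL.of_perm ((((hA.reverse.append h.symm hC).append hqx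
      hB).append (hMN hy₀) (Seg.singleton N y)).append hxy.symm (Seg.singleton N x))
      hx₀.symm ?_ hn hm h3)
    simp only [List.perm_iff_count, List.count_append, List.count_reverse]
    intro; omega
  have g0 : G.Adj y y₀ := (hMG _ _ hy₀.symm).resolve_right fun h => hxyG h.1
  have g1 : G.Adj y y₁ := (hMG _ _ hy₁).resolve_right fun h => hxyG h.1
  rcases hR y y₀ y₁ p' g0 g1 hyp with h | h | h
  · exact h.elim e3 c2
  · exact h.elim (fun h => e4 h.symm) c1
  · exact h.elim (fun h => e5 h.symm) c3

/-- The local completion of `G` at `x`: the neighbourhood of `x` becomes a clique. -/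
def comp (G : SimpleGraph V) (x : V) : SimpleGraph V where
  Adj u v := G.Adj u v ∨ (u ≠ v ∧ G.Adj x u ∧ G.Adj x v)
  symm := ⟨fun _ _ h => Or.imp (fun h => G.symm.symm _ _ h) (fun h => ⟨h.1.symm, h.2.2, h.2.1⟩) h⟩
  loopless := ⟨fun v h => Or.elim h (fun h => G.loopless.irrefl v h) fun h => h.1 rfl⟩

lemma comp_adj {u v : V} :
    (comp G x).Adj u v ↔ G.Adj u v ∨ (u ≠ v ∧ G.Adj x u ∧ G.Adj x v) := Iff.rfl

/-- Equal, adjacent, or with degree sum at least the order. -/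
def hrel (G : SimpleGraph V) (u v : V) : Prop :=
  u = v ∨ G.Adj u v ∨ Nat.card V ≤ dg G u + dg G v

/-- Among any three neighbours of a vertex, two are related. -/
def CO (G : SimpleGraph V) : Prop :=
  ∀ a b₁ b₂ b₃, G.Adj a b₁ → G.Adj a b₂ → G.Adj a b₃ →
    hrel G b₁ b₂ ∨ hrel G b₁ b₃ ∨ hrel G b₂ b₃

/-- A vertex at which local completion preserves non-hamiltonicity. -/
def Eligible (G : SimpleGraph V) (x : V) : Prop :=
  (∃ p w q, G.Adj x p ∧ G.Adj x w ∧ G.Adj x q ∧ hrel G p w ∧ hrel G w q ∧ ¬ hrel G p q) ∨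
  ((∀ p q, G.Adj x p → G.Adj x q → hrel G p q) ∧
    ∃ p q, G.Adj x p ∧ G.Adj x q ∧ p ≠ q ∧ ¬ G.Adj p q) ∨
  ∃ y, y ≠ x ∧ ¬ G.Adj x y ∧ Nat.card V ≤ dg G x + dg G y ∧
    ∃ c₁ c₂, G.Adj x c₁ ∧ G.Adj y c₁ ∧ G.Adj x c₂ ∧ G.Adj y c₂ ∧ ¬ hrel G c₁ c₂

lemma le_comp (G : SimpleGraph V) (x : V) : G ≤ comp G x := fun _ _ h => comp_adj.2 (Or.inl h)

lemma hrel.symm {u v : V} (h : hrel G u v) : hrel G v u := by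
  rcases h with h | h | h
  · exact Or.inl h.symm
  · exact Or.inr (Or.inl h.symm)
  · exact Or.inr (Or.inr (by omega))

lemma hrel.mono [Finite V] {u v : V} (h : hrel G u v) (hGM : G ≤ M) : hrel M u v := by
  rcases h with h | h | h
  · exact Or.inl h
  · exact Or.inr (Or.inl (hGM h))
  · have h1 := dg_mono hGM u
    have h2 := dg_mono hGM v
    exact Or.inr (Or.inr (by omega))

lemma dg_le_comp [Finite V] {a : V} (h : G.Adj x a) : dg G x ≤ dg (comp G x) a := by
  have h1 : x ∉ {w | G.Adj x w} := fun h => G.loopless.irrefl x h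
  rw [dg, ← Set.ncard_exchange h1 (show a ∈ {w | G.Adj x w} from h)]
  refine Set.ncard_le_ncard ?_
  rintro w (rfl | ⟨hw, hwa⟩)
  · exact comp_adj.2 (Or.inl h.symm)
  · exact comp_adj.2 <| Or.inr ⟨fun h => hwa h.symm, h, hw⟩

lemma CO.comp [Finite V] (h : CO G) (x : V) : CO (comp G x) := by
  have key : ∀ a b₁ b₂ b₃, (ClawHeavy.comp G x).Adj a b₁ → (ClawHeavy.comp G x).Adj a b₂ →
      (ClawHeavy.comp G x).Adj a b₃ → ¬ G.Adj a b₁ → hrel (ClawHeavy.comp G x) b₁ b₂ ∨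
        hrel (ClawHeavy.comp G x) b₁ b₃ ∨ hrel (ClawHeavy.comp G x) b₂ b₃ := by
    intro a b₁ b₂ b₃ h1 h2 h3 hn
    obtain ⟨-, ha, hb⟩ := (comp_adj.1 h1).resolve_left hn
    have near : ∀ b, (b = x ∨ G.Adj x b) → hrel (ClawHeavy.comp G x) b₁ b := by
      rintro b (rfl | hb')
      · exact Or.inr (Or.inl (comp_adj.2 (Or.inl hb.symm)))
      · by_cases e : b₁ = b
        · exact Or.inl e
        · exact Or.inr (Or.inl (comp_adj.2 (Or.inr ⟨e, hb, hb'⟩)))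
    have far : ∀ b, ¬ (b = x ∨ G.Adj x b) → hrel G x b → hrel (ClawHeavy.comp G x) b₁ b := by
      rintro b hb' (h | h | h)
      · exact absurd (Or.inl h.symm) hb'
      · exact absurd (Or.inr h) hb'
      · have h1 := dg_le_comp hb
        have h2 := dg_mono (le_comp G x) b
        exact Or.inr (Or.inr (by omega))
    by_cases n2 : b₂ = x ∨ G.Adj x b₂
    · exact Or.inl (near _ n2)
    by_cases n3 : b₃ = x ∨ G.Adj x b₃
    · exact Or.inr (Or.inl (near _ n3))
    have g2 : G.Adj a b₂ := (comp_adj.1 h2).resolve_right fun h => n2 (Or.inr h.2.2)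
    have g3 : G.Adj a b₃ := (comp_adj.1 h3).resolve_right fun h => n3 (Or.inr h.2.2)
    rcases h a x b₂ b₃ ha.symm g2 g3 with h | h | h
    · exact Or.inl (far _ n2 h)
    · exact Or.inr (Or.inl (far _ n3 h))
    · exact Or.inr (Or.inr (h.mono (le_comp G x)))
  intro a b₁ b₂ b₃ h1 h2 h3
  by_cases n1 : G.Adj a b₁
  · by_cases n2 : G.Adj a b₂
    · by_cases n3 : G.Adj a b₃
      · rcases h a b₁ b₂ b₃ n1 n2 n3 with h | h | h
        · exact Or.inl (h.mono (le_comp G x))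
        · exact Or.inr (Or.inl (h.mono (le_comp G x)))
        · exact Or.inr (Or.inr (h.mono (le_comp G x)))
      · rcases key a b₃ b₁ b₂ h3 h1 h2 n3 with h | h | h
        · exact Or.inr (Or.inl h.symm)
        · exact Or.inr (Or.inr h.symm)
        · exact Or.inl h
    · rcases key a b₂ b₁ b₃ h2 h1 h3 n2 with h | h | h
      · exact Or.inl h.symm
      · exact Or.inr (Or.inr h)
      · exact Or.inr (Or.inl h)
  · exact key a b₁ b₂ b₃ h1 h2 h3 n1

theorem Eligible.not_hamL_comp [Finite V] (h3 : 3 ≤ Nat.card V) (hCO : CO G) (hG : ¬ HamL G)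
    (hx : Eligible G x) : ¬ HamL (ClawHeavy.comp G x) := by
  intro hcomp
  obtain ⟨M, hGM, hMc, hM, hMmax⟩ := exists_maximal_nonham hG (le_comp G x)
  obtain ⟨N, hMN, -, hN, hNmax⟩ := exists_maximal_nonham hM (le_top : M ≤ ⊤)
  have hGN := hGM.trans hMN
  have hh : ∀ u v, hrel G u v → u = v ∨ N.Adj u v := by
    rintro u v (h | h | h)
    · exact Or.inl h
    · exact Or.inr (hGN h)
    · by_contra! hc
      have h1 := (hNmax u v hc.1 hc.2 hc.1).dg_add_lt hN h3
      have h2 := dg_mono hGN u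
      have h4 := dg_mono hGN v
      omega
  have hR : ∀ a b₁ b₂ b₃, G.Adj a b₁ → G.Adj a b₂ → G.Adj a b₃ →
      (b₁ = b₂ ∨ N.Adj b₁ b₂) ∨ (b₁ = b₃ ∨ N.Adj b₁ b₃) ∨ (b₂ = b₃ ∨ N.Adj b₂ b₃) :=
    fun a b₁ b₂ b₃ h1 h2 h4 => (hCO a b₁ b₂ b₃ h1 h2 h4).imp (hh _ _) (Or.imp (hh _ _) (hh _ _))
  have hMG : ∀ u v, M.Adj u v → G.Adj u v ∨ (G.Adj x u ∧ G.Adj x v) :=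
    fun u v h => (comp_adj.1 (hMc h)).imp_right fun h => h.2
  have hpath : ∀ p q, G.Adj x p → G.Adj x q → p ≠ q → ¬ N.Adj p q → HamPath M p q :=
    fun p q hp hq hpq hn => hMmax p q hpq (fun h => hn (hMN h)) (comp_adj.2 (Or.inr ⟨hpq, hp, hq⟩))
  have htrans : ∀ p w q, G.Adj x p → G.Adj x w → G.Adj x q → (p = w ∨ N.Adj p w) →
      (w = q ∨ N.Adj w q) → (p = q ∨ N.Adj p q) := by
    rintro p w q hp hw hq (rfl | h1) (rfl | h2)
    · exact Or.inl rfl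
    · exact Or.inr h2
    · exact Or.inr h1
    · by_contra! hc
      exact no_middle_neighbor hMN hN hR hMG hGN (hpath p q hp hq hc.1 hc.2) hc.1 hc.2 hp hq hw
        h1.symm h2
  have hsymm : ∀ p q, (p = q ∨ N.Adj p q) → (q = p ∨ N.Adj q p) :=
    fun p q h => h.imp Eq.symm fun h => h.symm
  have hnot : ∃ p q, G.Adj x p ∧ G.Adj x q ∧ ¬ (p = q ∨ N.Adj p q) := by
    by_contra! hc
    refine hN (hcomp.mono ?_)
    intro u v h
    rcases comp_adj.1 h with h | ⟨h1, h2, h4⟩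
    · exact hGN h
    · exact (hc u v h2 h4).resolve_left h1
  obtain ⟨p₀, q₀, hp₀, hq₀, hpq₀⟩ := hnot
  rcases hx with ⟨p, w, q, hp, hw, hq, h1, h2, h4⟩ | ⟨h1, -⟩ | ⟨y, hyx, hxy, hsum, c₁, c₂, k1, k2,
    k4, k5, hc⟩
  · have hpq := htrans p w q hp hw hq (hh _ _ h1) (hh _ _ h2)
    have all : ∀ v, G.Adj x v → (p = v ∨ N.Adj p v) := by
      intro v hv
      rcases hR x p q v hp hq hv with h | h | h
      · rcases hCO x p q v hp hq hv with h | h | h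
        · exact absurd h h4
        · exact hh _ _ h
        · exact htrans p q v hp hq hv hpq (hh _ _ h)
      · exact h
      · exact htrans p q v hp hq hv hpq h
    exact hpq₀ (htrans p₀ p q₀ hp₀ hp hq₀ (hsymm _ _ (all _ hp₀)) (all _ hq₀))
  · exact hpq₀ (hh _ _ (h1 p₀ q₀ hp₀ hq₀))
  · have hxyN : N.Adj x y := (hh x y (Or.inr (Or.inr hsum))).resolve_left hyx.symm
    by_cases hcc : c₁ = c₂ ∨ N.Adj c₁ c₂
    · have all : ∀ v, G.Adj x v → (c₁ = v ∨ N.Adj c₁ v) := by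
        intro v hv
        rcases hCO x c₁ c₂ v k1 k4 hv with h | h | h
        · exact absurd h hc
        · exact hh _ _ h
        · exact htrans c₁ c₂ v k1 k4 hv hcc (hh _ _ h)
      exact hpq₀ (htrans p₀ c₁ q₀ hp₀ k1 hq₀ (hsymm _ _ (all _ hp₀)) (all _ hq₀))
    · rw [not_or] at hcc
      exact no_far_common_neighbor hMN hN hR hMG hGN (hpath _ _ k1 k4 hcc.1 hcc.2) hcc.1 hcc.2
        k1 k4 hxyN hxy k2 k5

end Completion

section Closure

variable {V : Type*} {G H : SimpleGraph V}

/-- Among any three neighbours of a vertex, two are equal or adjacent. -/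
def ClawFree (G : SimpleGraph V) : Prop :=
  ∀ a b₁ b₂ b₃, G.Adj a b₁ → G.Adj a b₂ → G.Adj a b₃ →
    (b₁ = b₂ ∨ G.Adj b₁ b₂) ∨ (b₁ = b₃ ∨ G.Adj b₁ b₃) ∨ (b₂ = b₃ ∨ G.Adj b₂ b₃)

/-- Adjacency is transitive inside each neighbourhood. -/
def DiamondFree (G : SimpleGraph V) : Prop :=
  ∀ x p w q, G.Adj x p → G.Adj x w → G.Adj x q → G.Adj p w → G.Adj w q → p = q ∨ G.Adj p q

/-- One local completion at an eligible vertex. -/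
def Step (G H : SimpleGraph V) : Prop := ∃ x, Eligible G x ∧ H = comp G x

lemma Eligible.not_comp_le {x : V} (h : Eligible G x) : ¬ comp G x ≤ G := by
  intro hc
  have key : ∀ p q, G.Adj x p → G.Adj x q → p = q ∨ G.Adj p q := by
    intro p q hp hq
    by_cases hpq : p = q
    · exact Or.inl hpq
    · exact Or.inr (hc (comp_adj.2 (Or.inr ⟨hpq, hp, hq⟩)))
  rcases h with ⟨p, w, q, hp, hw, hq, h1, h2, h4⟩ | ⟨h1, p, q, hp, hq, hpq, hn⟩ | ⟨y, hyx, hxy,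
    hsum, c₁, c₂, k1, k2, k4, k5, hn⟩
  · exact h4 ((key p q hp hq).imp_right Or.inl)
  · exact (key p q hp hq).elim hpq hn
  · exact hn ((key _ _ k1 k4).imp_right Or.inl)

theorem exists_closure [Finite V] (h3 : 3 ≤ Nat.card V) (hCO : CO G) (hG : ¬ HamL G) :
    ∃ H, Relation.ReflTransGen Step G H ∧ G ≤ H ∧ CO H ∧ ¬ HamL H ∧ ∀ x, ¬ Eligible H x := by
  obtain ⟨H, -, hH⟩ := (Set.toFinite
    {H : SimpleGraph V | Relation.ReflTransGen Step G H}).exists_le_maximal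
    (show G ∈ _ from Relation.ReflTransGen.refl)
  have hprop : G ≤ H ∧ CO H ∧ ¬ HamL H := by
    have h1 : Relation.ReflTransGen Step G H := hH.prop
    clear hH
    induction h1 with
    | refl => exact ⟨le_rfl, hCO, hG⟩
    | tail _ hs ih =>
      obtain ⟨x, hx, rfl⟩ := hs
      exact ⟨ih.1.trans (le_comp _ x), ih.2.1.comp x, hx.not_hamL_comp h3 ih.2.1 ih.2.2⟩
  refine ⟨H, hH.prop, hprop.1, hprop.2.1, hprop.2.2, fun x hx => hx.not_comp_le ?_⟩
  exact hH.2 (Relation.ReflTransGen.tail hH.prop ⟨x, hx, rfl⟩) (le_comp _ x)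

lemma common_neighbors_card [Finite V] {x y : V} (hxy : x ≠ y) (hn : ¬ G.Adj x y)
    (hsum : Nat.card V ≤ dg G x + dg G y) :
    {v | v ≠ x ∧ v ≠ y ∧ ¬ G.Adj x v ∧ ¬ G.Adj y v}.ncard + 2 ≤
      {v | G.Adj x v ∧ G.Adj y v}.ncard := by
  set O := {v | v ≠ x ∧ v ≠ y ∧ ¬ G.Adj x v ∧ ¬ G.Adj y v}
  have h1 := Set.ncard_union_add_ncard_inter {v | G.Adj x v} {v | G.Adj y v}
  have h2 : ({v | G.Adj x v} ∪ {v | G.Adj y v})ᶜ = O ∪ {x, y} := by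
    ext v
    simp only [O, Set.mem_compl_iff, Set.mem_union, Set.mem_ofPred_eq, Set.mem_insert_iff,
      Set.mem_singleton_iff]
    constructor
    · tauto
    · rintro (h | rfl | rfl)
      · tauto
      · exact fun h => h.elim (G.loopless.irrefl _) fun h => hn h.symm
      · exact fun h => h.elim hn (G.loopless.irrefl _)
  have h4 := Set.ncard_add_ncard_compl ({v | G.Adj x v} ∪ {v | G.Adj y v})
  have h5 : (O ∪ {x, y}).ncard = O.ncard + 2 := by
    rw [Set.ncard_union_eq, Set.ncard_pair hxy]
    rw [Set.disjoint_right]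
    rintro v (rfl | rfl) hv
    · exact hv.1 rfl
    · exact hv.2.1 rfl
  rw [h2, h5] at h4
  have h6 : {v | G.Adj x v} ∩ {v | G.Adj y v} = {v | G.Adj x v ∧ G.Adj y v} := rfl
  rw [h6] at h1
  unfold dg at hsum
  omega

lemma adj_of_heavy_pair [Finite V] (hcl : ∀ x, ¬ Eligible G x) {x y : V} (hxy : x ≠ y)
    (hsum : Nat.card V ≤ dg G x + dg G y) : G.Adj x y := by
  by_contra hn
  have hcard := common_neighbors_card hxy hn hsum
  have htr : ∀ c p w q, G.Adj c p → G.Adj c w → G.Adj c q → hrel G p w → hrel G w q →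
      hrel G p q := by
    intro c p w q h1 h2 h4 h5 h6
    by_contra h7
    exact hcl c (Or.inl ⟨p, w, q, h1, h2, h4, h5, h6, h7⟩)
  have hxyh : hrel G x y := Or.inr (Or.inr hsum)
  have hex : ∀ q, G.Adj x q ∧ G.Adj y q → ∃ o, G.Adj q o ∧ ¬ hrel G x o ∧ ¬ hrel G y o := by
    rintro q ⟨hx, hy⟩
    have h1 : ∃ o, G.Adj q o ∧ ¬ hrel G x o := by
      by_contra! hc
      refine hcl q (Or.inr (Or.inl ⟨fun u v hu hv => ?_, x, y, hx.symm, hy.symm, hxy, hn⟩))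
      exact htr q u x v hu hx.symm hv (hc u hu).symm (hc v hv)
    obtain ⟨o, ho, hxo⟩ := h1
    exact ⟨o, ho, hxo, fun h => hxo (htr q x y o hx.symm hy.symm ho hxyh h)⟩
  choose! f hf using hex
  obtain ⟨q, hq, q', hq', hqq, hfq⟩ := Set.exists_ne_map_eq_of_ncard_lt_of_maps_to
    (s := {v | G.Adj x v ∧ G.Adj y v})
    (t := {v | v ≠ x ∧ v ≠ y ∧ ¬ G.Adj x v ∧ ¬ G.Adj y v}) (f := f) (by omega) (by
      intro q hq
      obtain ⟨h1, h2, h4⟩ := hf q hq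
      exact ⟨fun h => h2 (Or.inl h.symm), fun h => h4 (Or.inl h.symm),
        fun h => h2 (Or.inr (Or.inl h)), fun h => h4 (Or.inr (Or.inl h))⟩)
  obtain ⟨h1, h2, -⟩ := hf q hq
  have h1' := (hf q' hq').1
  rw [← hfq] at h1'
  have hh : hrel G q q' := by
    by_contra hc
    exact hcl x (Or.inr (Or.inr ⟨y, hxy.symm, hn, hsum, q, q', hq.1, hq.2, hq'.1, hq'.2, hc⟩))
  by_cases ha : G.Adj q q'
  · exact h2 (htr q x q' (f q) hq.1.symm ha h1 (Or.inr (Or.inl hq'.1)) (Or.inr (Or.inl h1')))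
  · rcases hh with hh | hh | hh
    · exact hqq hh
    · exact ha hh
    · exact hcl q (Or.inr (Or.inr ⟨q', hqq.symm, ha, hh, x, f q, hq.1.symm, hq'.1.symm, h1, h1',
        h2⟩))

lemma closed_hrel [Finite V] (hcl : ∀ x, ¬ Eligible G x) {u v : V} :
    hrel G u v ↔ u = v ∨ G.Adj u v := by
  constructor
  · rintro (h | h | h)
    · exact Or.inl h
    · exact Or.inr h
    · by_cases huv : u = v
      · exact Or.inl huv
      · exact Or.inr (adj_of_heavy_pair hcl huv h)
  · exact fun h => h.imp_right Or.inl

lemma closed_clawFree [Finite V] (hcl : ∀ x, ¬ Eligible G x) (hCO : CO G) : ClawFree G := by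
  intro a b₁ b₂ b₃ h1 h2 h4
  simpa only [closed_hrel hcl] using hCO a b₁ b₂ b₃ h1 h2 h4

lemma closed_diamondFree [Finite V] (hcl : ∀ x, ¬ Eligible G x) : DiamondFree G := by
  intro x p w q hp hw hq hpw hwq
  by_contra hc
  rw [← closed_hrel hcl] at hc
  exact hcl x (Or.inl ⟨p, w, q, hp, hw, hq, Or.inr (Or.inl hpw), Or.inr (Or.inl hwq), hc⟩)

end Closure

section InducedPaths

variable {V : Type*} {G : SimpleGraph V}

/-- `l` lists the vertices of an induced path of `G`. -/
def IndPath (G : SimpleGraph V) : List V → Prop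
  | [] => True
  | a :: l => (∀ v ∈ l, v ≠ a ∧ (G.Adj a v ↔ l.head? = some v)) ∧ IndPath G l

lemma indPath_nil : IndPath G [] := trivial

lemma indPath_cons {a : V} {l : List V} : IndPath G (a :: l) ↔
    (∀ v ∈ l, v ≠ a ∧ (G.Adj a v ↔ l.head? = some v)) ∧ IndPath G l := Iff.rfl

lemma indPath_singleton (a : V) : IndPath G [a] := by simp [IndPath]

lemma indPath_pair {a b : V} (h : G.Adj a b) : IndPath G [a, b] := by
  simp [IndPath, h, h.ne']

lemma indPath_append {l m : List V} : IndPath G (l ++ m) ↔ IndPath G l ∧ IndPath G m ∧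
    ∀ u ∈ l, ∀ v ∈ m, u ≠ v ∧ (G.Adj u v ↔ l.getLast? = some u ∧ m.head? = some v) := by
  induction l with
  | nil => simp [indPath_nil]
  | cons a l ih =>
    rw [List.cons_append, indPath_cons, indPath_cons, ih]
    cases l with
    | nil =>
      simp only [List.nil_append, List.not_mem_nil, false_implies, implies_true, true_and,
        List.mem_singleton, forall_eq, List.getLast?_singleton, indPath_nil, and_true]
      constructor
      · rintro ⟨h1, h2⟩
        exact ⟨h2, fun v hv => ⟨(h1 v hv).1.symm, (h1 v hv).2⟩⟩
      · rintro ⟨h1, h2⟩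
        exact ⟨fun v hv => ⟨(h2 v hv).1.symm, (h2 v hv).2⟩, h1⟩
    | cons b l =>
      simp only [List.getLast?_cons_cons, List.cons_append, List.head?_cons]
      constructor
      · rintro ⟨h1, h2, h3, h4⟩
        refine ⟨⟨fun v hv => h1 v (by simp at hv ⊢; tauto), h2⟩, h3, ?_⟩
        intro u hu v hv
        rcases List.mem_cons.1 hu with rfl | hu
        · obtain ⟨h5, h6⟩ := h1 v (by simp [hv])
          refine ⟨h5.symm, ?_⟩
          rw [h6]
          constructor
          · intro h7
            simp at h7
            exact absurd h7 (h4 b (by simp) v hv).1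
          · rintro ⟨h7, -⟩
            exact absurd rfl (h1 u (by
              have := List.mem_of_getLast? h7
              simp at this ⊢
              tauto)).1
        · exact h4 u hu v hv
      · rintro ⟨⟨h1, h2⟩, h3, h4⟩
        refine ⟨?_, h2, h3, fun u hu v hv => h4 u (List.mem_cons_of_mem _ hu) v hv⟩
        intro v hv
        by_cases hv' : v ∈ b :: l
        · exact h1 v hv'
        · have hvm : v ∈ m := by
            simp at hv hv'
            tauto
          obtain ⟨h5, h6⟩ := h4 a (by simp) v hvm
          refine ⟨h5.symm, ?_⟩
          rw [h6]
          constructor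
          · rintro ⟨h7, -⟩
            exact absurd rfl (h1 a (List.mem_of_getLast? h7)).1
          · intro h7
            simp at h7
            exact absurd (by simp [h7]) hv'

lemma IndPath.reverse {l : List V} (h : IndPath G l) : IndPath G l.reverse := by
  induction l with
  | nil => exact h
  | cons a l ih =>
    rw [List.reverse_cons, indPath_append]
    refine ⟨ih h.2, indPath_singleton a, ?_⟩
    intro u hu v hv
    simp at hu hv
    subst hv
    obtain ⟨h1, h2⟩ := h.1 u hu
    refine ⟨h1, ?_⟩
    rw [G.adj_comm, h2]
    simp

lemma IndPath.left {l m : List V} (h : IndPath G (l ++ m)) : IndPath G l := (indPath_append.1 h).1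

lemma IndPath.right {l m : List V} (h : IndPath G (l ++ m)) : IndPath G m :=
  (indPath_append.1 h).2.1

lemma IndPath.nodup {l : List V} (h : IndPath G l) : l.Nodup := by
  induction l with
  | nil => simp
  | cons a l ih => exact List.nodup_cons.2 ⟨fun ha => (h.1 a ha).1 rfl, ih h.2⟩

lemma IndPath.isChain {l : List V} (h : IndPath G l) : l.IsChain G.Adj := by
  induction l with
  | nil => simp
  | cons a l ih =>
    cases l with
    | nil => simp
    | cons b l =>
      rw [List.isChain_cons_cons]
      exact ⟨((h.1 b (by simp)).2).2 rfl, ih h.2⟩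

lemma IndPath.adj_getElem {l : List V} (h : IndPath G l) {i j : ℕ} (hi : i < l.length)
    (hj : j < l.length) : G.Adj l[i] l[j] ↔ i + 1 = j ∨ j + 1 = i := by
  induction l generalizing i j with
  | nil => simp at hi
  | cons a l ih =>
    have key : ∀ k (hk : k < l.length), G.Adj a l[k] ↔ k = 0 := by
      intro k hk
      rw [(h.1 _ (List.getElem_mem hk)).2, List.head?_eq_getElem?,
        List.getElem?_eq_getElem (by omega), Option.some_inj, h.2.nodup.getElem_inj_iff]
      exact eq_comm
    rcases i with _ | i <;> rcases j with _ | j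
    · simp
    · simp only [List.getElem_cons_zero, List.getElem_cons_succ]
      rw [key]
      omega
    · simp only [List.getElem_cons_zero, List.getElem_cons_succ]
      rw [G.adj_comm, key]
      omega
    · simp only [List.getElem_cons_succ]
      rw [ih h.2]
      omega

/-- A vertex with a neighbour on an induced path extends some final part of it. -/
lemma IndPath.exists_suffix {l : List V} {a : V} (h : IndPath G l) (ha : a ∉ l)
    (hn : ∃ u ∈ l, G.Adj a u) :
    ∃ pre suf, l = pre ++ suf ∧ suf ≠ [] ∧ IndPath G (a :: suf) := by
  induction l with
  | nil => simp at hn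
  | cons b l ih =>
    by_cases hl : ∃ u ∈ l, G.Adj a u
    · obtain ⟨pre, suf, h1, h2⟩ := ih h.2 (fun h => ha (List.mem_cons_of_mem _ h)) hl
      exact ⟨b :: pre, suf, by simp [h1], h2⟩
    · refine ⟨[], b :: l, rfl, by simp, ?_, h⟩
      have hb : G.Adj a b := by
        obtain ⟨u, hu, hau⟩ := hn
        rcases List.mem_cons.1 hu with rfl | hu
        · exact hau
        · exact absurd ⟨u, hu, hau⟩ hl
      intro v hv
      refine ⟨fun e => ha (e ▸ hv), ?_⟩
      rw [List.head?_cons, Option.some_inj]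
      constructor
      · intro hav
        rcases List.mem_cons.1 hv with rfl | hv
        · rfl
        · exact absurd ⟨v, hv, hav⟩ hl
      · rintro rfl
        exact hb

/-- `l` lists the vertices of an induced path from `a` to `b`. -/
def ISeg (G : SimpleGraph V) (a : V) (l : List V) (b : V) : Prop :=
  IndPath G l ∧ l.head? = some a ∧ l.getLast? = some b

lemma ISeg.seg {a b : V} {l : List V} (h : ISeg G a l b) : Seg G a l b :=
  ⟨h.1.isChain, h.2⟩

lemma ISeg.reverse {a b : V} {l : List V} (h : ISeg G a l b) : ISeg G b l.reverse a :=
  ⟨h.1.reverse, by simpa using h.2.2, by simpa using h.2.1⟩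

lemma ISeg.append {a b c d : V} {l m : List V} (hl : ISeg G a l b) (hm : ISeg G c m d)
    (h : ∀ u ∈ l, ∀ v ∈ m, u ≠ v ∧ (G.Adj u v ↔ u = b ∧ v = c)) : ISeg G a (l ++ m) d := by
  refine ⟨indPath_append.2 ⟨hl.1, hm.1, ?_⟩, ?_, ?_⟩
  · intro u hu v hv
    rw [(h u hu v hv).2, hl.2.2, hm.2.1, Option.some_inj, Option.some_inj, @eq_comm _ b,
      @eq_comm _ c]
    exact ⟨(h u hu v hv).1, Iff.rfl⟩
  · rw [List.head?_append_of_ne_nil _ hl.seg.ne_nil, hl.2.1]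
  · rw [List.getLast?_append_of_ne_nil _ hm.seg.ne_nil, hm.2.2]

lemma ISeg.singleton (a : V) : ISeg G a [a] a := ⟨indPath_singleton a, rfl, rfl⟩

lemma ISeg.pair {a b : V} (h : G.Adj a b) : ISeg G a [a, b] b := ⟨indPath_pair h, rfl, rfl⟩

/-- Every walk contains an induced path between its ends. -/
lemma Seg.exists_iSeg {a b : V} {l : List V} (h : Seg G a l b) :
    ∃ m, ISeg G a m b ∧ m ⊆ l := by
  induction l generalizing a with
  | nil => exact absurd rfl h.ne_nil
  | cons c l ih =>
    obtain rfl : a = c := by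
      have := h.2.1
      simp at this
      exact this.symm
    by_cases hl : l = []
    · subst hl
      obtain ⟨-, rfl⟩ := h.eq_of_singleton
      exact ⟨[b], ISeg.singleton b, by simp⟩
    · obtain ⟨a', d, h1, h2, h3⟩ := Seg.split (l := [a]) (m := l) h (by simp) hl
      obtain ⟨-, rfl⟩ := h1.eq_of_singleton
      obtain ⟨m, hm, hml⟩ := ih h3
      by_cases ha : a' ∈ m
      · obtain ⟨s, t, rfl⟩ := List.append_of_mem ha
        refine ⟨a' :: t, ⟨hm.1.right, rfl, ?_⟩, ?_⟩
        · have := hm.2.2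
          rwa [List.getLast?_append_of_ne_nil _ (by simp)] at this
        · intro v hv
          rcases List.mem_cons.1 hv with rfl | hv
          · simp
          · exact List.mem_cons_of_mem _ (hml (by simp [hv]))
      · obtain ⟨pre, suf, rfl, h4, h5⟩ := hm.1.exists_suffix ha ⟨d, hm.seg.head_mem, h2⟩
        refine ⟨a' :: suf, ⟨h5, rfl, ?_⟩, ?_⟩
        · have := hm.2.2
          rw [List.getLast?_append_of_ne_nil _ h4] at this
          rwa [← List.singleton_append, List.getLast?_append_of_ne_nil _ h4]
        · intro v hv
          rcases List.mem_cons.1 hv with rfl | hv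
          · simp
          · exact List.mem_cons_of_mem _ (hml (by simp [hv]))

end InducedPaths

section Structure

variable {V : Type*} {G : SimpleGraph V}

/-- At least three vertices, and connected after the removal of any vertex. -/
def TwoConn (G : SimpleGraph V) : Prop :=
  3 ≤ Nat.card V ∧ ∀ v u w, u ≠ v → w ≠ v →
    Relation.ReflTransGen (fun a b => G.Adj a b ∧ a ≠ v ∧ b ≠ v) u w

lemma exists_seg_of_reflTransGen {r : V → V → Prop} (hr : ∀ a b, r a b → G.Adj a b) {a b : V}
    (h : Relation.ReflTransGen r a b) :
    ∃ l, Seg G a l b ∧ ∀ v ∈ l, v = b ∨ ∃ u, r v u := by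
  induction h using Relation.ReflTransGen.head_induction_on with
  | refl => exact ⟨[b], Seg.singleton G b, by simp⟩
  | head h _ ih =>
    obtain ⟨l, h1, h2⟩ := ih
    refine ⟨_ :: l, (Seg.singleton G _).append (hr _ _ h) h1, ?_⟩
    intro v hv
    rcases List.mem_cons.1 hv with rfl | hv
    · exact Or.inr ⟨_, h⟩
    · exact h2 v hv

lemma exists_exit {r : V → V → Prop} {S : Set V} {a b : V} (h : Relation.ReflTransGen r a b)
    (ha : a ∈ S) (hb : b ∉ S) : ∃ u v, u ∈ S ∧ v ∉ S ∧ r u v := by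
  induction h with
  | refl => exact absurd ha hb
  | @tail c d _ h ih =>
    by_cases hc : c ∈ S
    · exact ⟨c, d, hc, hb, h⟩
    · exact ih hc

lemma TwoConn.connected (h : TwoConn G) (u w : V) : Relation.ReflTransGen G.Adj u w := by
  obtain ⟨v, hv⟩ : ∃ v, v ∉ ({u, w} : Set V) := by
    by_contra! hc
    have h1 : ({u, w} : Set V) = Set.univ := Set.eq_univ_of_forall hc
    have h2 := Set.ncard_insert_le u {w}
    rw [h1, Set.ncard_univ, Set.ncard_singleton] at h2
    have := h.1
    omega
  simp only [Set.mem_insert_iff, Set.mem_singleton_iff, not_or] at hv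
  exact Relation.ReflTransGen.mono (fun _ _ h => h.1) _ _
    (h.2 v u w (Ne.symm hv.1) (Ne.symm hv.2))

/-- A cycle such that every other vertex is adjacent to two consecutive vertices of it extends to a
Hamilton cycle. -/
theorem hamL_of_dominating_cycle [Finite V] (hG : DiamondFree G) {d : ℕ → V} {k : ℕ} (hk : 3 ≤ k)
    (hinj : ∀ i < k, ∀ j < k, d i = d j → i = j) (hadj : ∀ i < k, G.Adj (d i) (d (i + 1)))
    (hclose : d k = d 0)
    (hdom : ∀ w, (∀ i < k, w ≠ d i) → ∃ i < k, G.Adj w (d i) ∧ G.Adj w (d (i + 1))) :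
    HamL G := by
  classical
  have := Fintype.ofFinite V
  choose! g hg using hdom
  let K : ℕ → Finset V := fun i => Finset.univ.filter fun w => (∀ i < k, w ≠ d i) ∧ g w = i
  let L : ℕ → List V := fun i => d i :: (K i).toList
  have hK : ∀ i w, w ∈ K i → G.Adj w (d i) ∧ G.Adj w (d (i + 1)) := by
    intro i w hw
    simp only [K, Finset.mem_filter, Finset.mem_univ, true_and] at hw
    obtain ⟨h1, rfl⟩ := hw
    exact (hg w h1).2
  have hLn : ∀ i < k, (L i).Nodup := by
    intro i hi
    refine List.nodup_cons.2 ⟨?_, Finset.nodup_toList _⟩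
    rw [Finset.mem_toList]
    intro h
    exact (hK _ _ h).1.ne rfl
  have hLadj : ∀ i < k, ∀ u ∈ L i, ∀ v ∈ L i, u ≠ v → G.Adj u v := by
    intro i hi u hu v hv huv
    simp only [L, List.mem_cons, Finset.mem_toList] at hu hv
    rcases hu with rfl | hu <;> rcases hv with rfl | hv
    · exact absurd rfl huv
    · exact (hK _ _ hv).1.symm
    · exact (hK _ _ hu).1
    · exact (hG (d i) u (d (i + 1)) v (hK _ _ hu).1.symm (hadj i hi) (hK _ _ hv).1.symm
        (hK _ _ hu).2 (hK _ _ hv).2.symm).resolve_left huv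
  have hLseg : ∀ i < k, ∃ e, Seg G (d i) (L i) e ∧ G.Adj e (d (i + 1)) := by
    intro i hi
    obtain ⟨e, he⟩ : ∃ e, (L i).getLast? = some e :=
      ⟨_, List.getLast?_eq_some_getLast (by simp [L])⟩
    refine ⟨e, ⟨?_, rfl, he⟩, ?_⟩
    · refine List.Pairwise.isChain ?_
      exact (hLn i hi).pairwise_of_forall_ne (hLadj i hi)
    · have h1 := List.mem_of_getLast? he
      simp only [L, List.mem_cons, Finset.mem_toList] at h1
      rcases h1 with rfl | h1
      · exact hadj i hi
      · exact (hK _ _ h1).2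
  have hmain : ∀ m < k, ∃ e, Seg G (d 0) ((List.range (m + 1)).flatMap L) e ∧
      G.Adj e (d (m + 1)) := by
    intro m
    induction m with
    | zero => intro h; simpa using hLseg 0 h
    | succ m ih =>
      intro h
      obtain ⟨e, h1, h2⟩ := ih (by omega)
      obtain ⟨f, h3, h4⟩ := hLseg (m + 1) h
      refine ⟨f, ?_, h4⟩
      rw [List.range_succ, List.flatMap_append]
      simpa using h1.append h2 h3
  obtain ⟨e, h1, h2⟩ := hmain (k - 1) (by omega)
  rw [Nat.sub_add_cancel (by omega)] at h1 h2
  rw [hclose] at h2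
  have hmem : ∀ i < k, ∀ v ∈ L i, v = d i ∨ ((∀ i < k, v ≠ d i) ∧ g v = i) := by
    intro i _ v hv
    simpa [L, K] using hv
  refine ⟨_, _, _, h1, h2, ?_, ?_, ?_⟩
  · rw [List.nodup_flatMap]
    refine ⟨fun i hi => hLn i (by simpa using hi), ?_⟩
    refine List.nodup_range.pairwise_of_forall_ne ?_
    intro i hi j hj hij
    simp only [List.mem_range] at hi hj
    intro v hvi hvj
    rcases hmem i hi v hvi with h3 | ⟨h3, h4⟩ <;> rcases hmem j hj v hvj with h5 | ⟨h5, h6⟩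
    · exact hij (hinj i hi j hj (h3.symm.trans h5))
    · exact h5 i hi h3
    · exact h3 j hj h5
    · exact hij (h4.symm.trans h6)
  · intro v
    rw [List.mem_flatMap]
    by_cases hv : ∀ i < k, v ≠ d i
    · exact ⟨g v, by simpa using (hg v hv).1, by simp [L, K]; exact Or.inr hv⟩
    · push Not at hv
      obtain ⟨i, hi, rfl⟩ := hv
      exact ⟨i, by simpa using hi, by simp [L]⟩
  · rw [List.length_flatMap]
    have h3 : ((List.range k).map fun _ => 1).sum ≤
        ((List.range k).map fun a => (L a).length).sum :=
      List.sum_le_sum fun i _ => by simp [L]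
    simp at h3
    omega

lemma hamL_of_complete [Finite V] (h3 : 3 ≤ Nat.card V) (h : ∀ u v, u ≠ v → G.Adj u v) :
    HamL G := by
  classical
  have := Fintype.ofFinite V
  obtain ⟨a, b, c, hab, hac, hbc⟩ := Fintype.two_lt_card_iff (α := V) |>.1
    (by rw [← Nat.card_eq_fintype_card]; exact h3)
  refine hamL_of_dominating_cycle
    (d := fun i => if i % 3 = 0 then a else if i % 3 = 1 then b else c)
    (k := 3) ?_ le_rfl ?_ ?_ rfl ?_
  · intro x p w q _ _ _ _ _
    by_cases hpq : p = q
    · exact Or.inl hpq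
    · exact Or.inr (h p q hpq)
  · intro i hi j hj hij
    interval_cases i <;> interval_cases j <;> simp_all
  · intro i hi
    apply h
    interval_cases i <;> simp_all [Ne.symm]
  · intro w hw
    have h0 := hw 0 (by omega)
    have h1 := hw 1 (by omega)
    simp at h0 h1
    exact ⟨0, by omega, by simpa using h w a h0, by simpa using h w b h1⟩

/-- Contracting one side of a clique cut to a single vertex of the clique. -/
lemma TwoConn.induce [Finite V] (hG : TwoConn G) {A K : Set V} {t t' : V} (ht : t ∉ A)
    (htK : t ∈ K) (ht' : t' ∈ A) (htK' : t' ∈ K) (hK : G.IsClique K)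
    (hcut : ∀ u ∈ A, ∀ v ∉ A, G.Adj u v → u ∈ K ∧ v ∈ K)
    (hcard : 3 ≤ Nat.card (insert t A : Set V)) : TwoConn (G.induce (insert t A)) := by
  classical
  refine ⟨hcard, ?_⟩
  have key : ∀ v z : V, z ∈ insert t A → z ≠ v → z ∈ K → (∀ u ∈ insert t A, u ∉ A → u ≠ v → z = u) →
      ∀ u w, u ∈ insert t A → w ∈ insert t A → u ≠ v → w ≠ v →
      Relation.ReflTransGen (fun a b => G.Adj a b ∧ (a ∈ insert t A ∧ b ∈ insert t A) ∧
        a ≠ v ∧ b ≠ v) u w := by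
    intro v z hz hzv hzK hztA u w hu hw huv hwv
    have h1 := hG.2 v u w huv hwv
    let f : V → V := fun a => if a ∈ A then a else z
    have hf : ∀ a ∈ insert t A, a ≠ v → f a = a := by
      intro a ha hav
      by_cases haA : a ∈ A
      · simp [f, haA]
      · simp only [f, if_neg haA]
        exact hztA a ha haA hav
    have hfm : ∀ a, f a ∈ insert t A := by
      intro a
      by_cases haA : a ∈ A
      · simp [f, haA]
      · simpa [f, haA] using hz
    have hfv : ∀ a, a ≠ v → f a ≠ v := by
      intro a ha
      by_cases haA : a ∈ A
      · simpa [f, haA]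
      · simpa [f, haA]
    have h2 : ∀ a b, G.Adj a b → f a = f b ∨ G.Adj (f a) (f b) := by
      intro a b hab
      by_cases ha : a ∈ A <;> by_cases hb : b ∈ A <;> simp only [f, ha, hb, if_true, if_false]
      · exact Or.inr hab
      · by_cases haz : a = z
        · exact Or.inl haz
        · exact Or.inr (hK (hcut a ha b hb hab).1 hzK haz)
      · by_cases hbz : z = b
        · exact Or.inl hbz
        · exact Or.inr (hK hzK (hcut b hb a ha hab.symm).1 hbz)
      · exact Or.inl trivial
    rw [← hf u hu huv, ← hf w hw hwv]
    clear hu hw hwv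
    induction h1 with
    | refl => exact Relation.ReflTransGen.refl
    | tail _ h ih =>
      rcases h2 _ _ h.1 with h3 | h3
      · rwa [← h3]
      · exact ih.tail ⟨h3, ⟨hfm _, hfm _⟩, hfv _ h.2.1, hfv _ h.2.2⟩
  have lift : ∀ v u w : (insert t A : Set V), Relation.ReflTransGen (fun a b : V => G.Adj a b ∧
      (a ∈ insert t A ∧ b ∈ insert t A) ∧ a ≠ v ∧ b ≠ v) u w →
      Relation.ReflTransGen (fun a b => (G.induce (insert t A)).Adj a b ∧ a ≠ v ∧ b ≠ v) u w := by
    intro v u w h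
    obtain ⟨w, hw⟩ := w
    simp only at h
    induction h with
    | refl => exact Relation.ReflTransGen.refl
    | tail _ h ih =>
      refine (ih h.2.1.1).tail ⟨h.1, ?_, ?_⟩
      · exact fun e => h.2.2.1 (congrArg Subtype.val e)
      · exact fun e => h.2.2.2 (congrArg Subtype.val e)
  intro v u w huv hwv
  apply lift
  have huv' : (u : V) ≠ v := fun e => huv (Subtype.ext e)
  have hwv' : (w : V) ≠ v := fun e => hwv (Subtype.ext e)
  by_cases hvt : (v : V) = t
  · refine key v t' (Or.inr ht') ?_ htK' ?_ u w u.2 w.2 huv' hwv'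
    · rw [hvt]
      rintro rfl
      exact ht ht'
    · rintro a (rfl | ha) ha' hav
      · exact absurd hvt.symm hav
      · exact absurd ha ha'
  · refine key v t (Or.inl rfl) (Ne.symm hvt) htK ?_ u w u.2 w.2 huv' hwv'
    rintro a (rfl | ha) ha' -
    · rfl
    · exact absurd ha ha'

lemma ClawFree.induce (hG : ClawFree G) (S : Set V) : ClawFree (G.induce S) := by
  intro a b₁ b₂ b₃ h1 h2 h3
  simpa only [Subtype.ext_iff, induce_adj] using hG a b₁ b₂ b₃ h1 h2 h3

lemma DiamondFree.induce (hG : DiamondFree G) (S : Set V) : DiamondFree (G.induce S) := by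
  intro x p w q h1 h2 h3 h4 h5
  simpa only [Subtype.ext_iff, induce_adj] using hG x p w q h1 h2 h3 h4 h5

lemma IndPath.of_induce {S : Set V} {l : List S} (h : IndPath (G.induce S) l) :
    IndPath G (l.map Subtype.val) := by
  induction l with
  | nil => exact h
  | cons a l ih =>
    refine ⟨?_, ih h.2⟩
    intro v hv
    obtain ⟨w, hw, rfl⟩ := List.mem_map.1 hv
    obtain ⟨h1, h2⟩ := h.1 w hw
    refine ⟨fun e => h1 (Subtype.ext e), ?_⟩
    rw [List.head?_map]
    change (G.induce S).Adj a w ↔ _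
    rw [h2]
    constructor
    · intro e
      rw [e]
      rfl
    · exact fun e => Option.map_injective Subtype.val_injective e

lemma Seg.of_induce {S : Set V} {a b : S} {l : List S} (h : Seg (G.induce S) a l b) :
    Seg G a (l.map Subtype.val) b := by
  refine ⟨?_, by rw [List.head?_map, h.2.1]; rfl, by rw [List.getLast?_map, h.2.2]; rfl⟩
  rw [List.isChain_map]
  exact h.1

/-- Removing one vertex from a Hamilton cycle. -/
lemma HamL.exists_path (h : HamL G) (t : V) :
    ∃ a l b, Seg G a l b ∧ G.Adj t a ∧ G.Adj b t ∧ l.Nodup ∧ (∀ v, v ∈ l ↔ v ≠ t) ∧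
      2 ≤ l.length := by
  obtain ⟨a, l, b, h1, h2, h3, h4, h5⟩ := h
  suffices h : ∃ m c, Seg G t (t :: m) c ∧ G.Adj c t ∧ (t :: m).Nodup ∧ (∀ v, v ∈ t :: m) ∧
      3 ≤ (t :: m).length by
    obtain ⟨m, c, h1, h2, h3, h4, h5⟩ := h
    obtain ⟨u, v, k1, k2, k3⟩ := Seg.split (l := [t]) (m := m) h1 (by simp)
      (by rintro rfl; simp at h5)
    obtain ⟨-, rfl⟩ := k1.eq_of_singleton
    have h6 := List.nodup_cons.1 h3
    refine ⟨v, m, c, k3, k2, h2, h6.2, fun v => ⟨?_, fun hv => ?_⟩, by simpa using h5⟩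
    · rintro hv rfl
      exact h6.1 hv
    · exact (List.mem_cons.1 (h4 v)).resolve_left hv
  obtain ⟨A, B, rfl⟩ := List.append_of_mem (h4 t)
  by_cases hA : A = []
  · subst hA
    obtain rfl : t = a := by
      have := h1.2.1
      simpa using this
    exact ⟨B, b, h1, h2, h3, h4, h5⟩
  · obtain ⟨u, v, k1, k2, k3⟩ := h1.split hA (by simp)
    obtain rfl : t = v := by
      have := k3.2.1
      simpa using this
    have hp : (A ++ t :: B).Perm (t :: (B ++ A)) := by
      rw [← List.cons_append]
      exact List.perm_append_comm
    exact ⟨B ++ A, u, k3.append h2 k1, k2, hp.nodup_iff.1 h3, fun v => hp.mem_iff.1 (h4 v),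
      hp.length_eq ▸ h5⟩

/-- Gluing Hamilton cycles of the two sides of a clique cut. -/
lemma hamL_of_cut {A K : Set V} {s t : V} (hs : s ∈ A) (ht : t ∉ A) (hK : G.IsClique K)
    (hcut : ∀ u ∈ A, ∀ v ∉ A, G.Adj u v → u ∈ K ∧ v ∈ K)
    (h1 : HamL (G.induce (insert t A))) (h2 : HamL (G.induce (insert s Aᶜ))) : HamL G := by
  have key : ∀ (B : Set V) (z : V), z ∉ B → HamL (G.induce (insert z B)) →
      ∃ a l b, Seg G a l b ∧ G.Adj z a ∧ G.Adj b z ∧ l.Nodup ∧ (∀ v, v ∈ l ↔ v ∈ B) ∧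
        2 ≤ l.length := by
    intro B z hz h
    obtain ⟨a, l, b, k1, k2, k3, k4, k5, k6⟩ := h.exists_path ⟨z, Or.inl rfl⟩
    refine ⟨a, l.map Subtype.val, b, k1.of_induce, k2, k3, k4.map Subtype.val_injective, ?_,
      by simpa using k6⟩
    intro v
    rw [List.mem_map]
    constructor
    · rintro ⟨w, hw, rfl⟩
      rw [k5] at hw
      exact w.2.resolve_left fun e => hw (Subtype.ext e)
    · intro hv
      refine ⟨⟨v, Or.inr hv⟩, ?_, rfl⟩
      rw [k5]
      intro e
      have e' : v = z := congrArg Subtype.val e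
      exact hz (e' ▸ hv)
  obtain ⟨a, l, b, k1, k2, k3, k4, k5, k6⟩ := key A t ht h1
  obtain ⟨c, m, d, j1, j2, j3, j4, j5, j6⟩ := key Aᶜ s (fun h => h hs) h2
  have ha := (k5 a).1 k1.head_mem
  have hb := (k5 b).1 k1.last_mem
  have hc := (j5 c).1 j1.head_mem
  have hd := (j5 d).1 j1.last_mem
  have haK := (hcut a ha t ht k2.symm).1
  have hbK := (hcut b hb t ht k3).1
  have hcK := (hcut s hs c hc j2).2
  have hdK := (hcut s hs d hd j3.symm).2
  refine ⟨a, l ++ m, d, k1.append (hK hbK hcK fun e => hc (e ▸ hb)) j1,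
    hK hdK haK fun e => hd (e ▸ ha), ?_, ?_, ?_⟩
  · rw [List.nodup_append]
    exact ⟨k4, j4, fun u hu v hv e => (j5 v).1 hv (e ▸ (k5 u).1 hu)⟩
  · intro v
    rw [List.mem_append, k5, j5]
    exact Classical.em _
  · rw [List.length_append]
    omega

end Structure

section InducedCycles

variable {V : Type*} {G : SimpleGraph V}

/-- The induced paths `l` from `a` to `b` and `m` from `c` to `d` form an induced cycle, closed by
the edges `bc` and `da`. -/
def TwoArcs (G : SimpleGraph V) (a : V) (l : List V) (b c : V) (m : List V) (d : V) : Prop :=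
  ISeg G a l b ∧ ISeg G c m d ∧
    ∀ u ∈ l, ∀ v ∈ m, u ≠ v ∧ (G.Adj u v ↔ (u = b ∧ v = c) ∨ (u = a ∧ v = d))

/-- `D` lists the vertices of an induced cycle of length at least four. -/
def IndCyc (G : SimpleGraph V) (D : List V) : Prop :=
  4 ≤ D.length ∧ ∃ a l c d, D = a :: l ∧ TwoArcs G a [a] a c l d

lemma TwoArcs.symm {a b c d : V} {l m : List V} (h : TwoArcs G a l b c m d) :
    TwoArcs G c m d a l b := by
  refine ⟨h.2.1, h.1, fun u hu v hv => ?_⟩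
  obtain ⟨h1, h2⟩ := h.2.2 v hv u hu
  refine ⟨h1.symm, ?_⟩
  rw [G.adj_comm, h2]
  tauto

lemma TwoArcs.reverse {a b c d : V} {l m : List V} (h : TwoArcs G a l b c m d) :
    TwoArcs G b l.reverse a d m.reverse c := by
  refine ⟨h.1.reverse, h.2.1.reverse, fun u hu v hv => ?_⟩
  obtain ⟨h1, h2⟩ := h.2.2 u (List.mem_reverse.1 hu) v (List.mem_reverse.1 hv)
  refine ⟨h1, ?_⟩
  rw [h2]
  tauto

lemma ISeg.ne_of_two_le {a b : V} {l : List V} (h : ISeg G a l b) (h2 : 2 ≤ l.length) : a ≠ b := by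
  obtain ⟨h1, h3, h4⟩ := h
  rw [List.head?_eq_getElem?, List.getElem?_eq_getElem (by omega), Option.some_inj] at h3
  rw [List.getLast?_eq_getElem?, List.getElem?_eq_getElem (by omega), Option.some_inj] at h4
  rw [← h3, ← h4, Ne, h1.nodup.getElem_inj_iff]
  omega

lemma ISeg.not_adj_of_three_le {a b : V} {l : List V} (h : ISeg G a l b) (h2 : 3 ≤ l.length) :
    ¬ G.Adj a b := by
  obtain ⟨h1, h3, h4⟩ := h
  rw [List.head?_eq_getElem?, List.getElem?_eq_getElem (by omega), Option.some_inj] at h3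
  rw [List.getLast?_eq_getElem?, List.getElem?_eq_getElem (by omega), Option.some_inj] at h4
  rw [← h3, ← h4, h1.adj_getElem]
  omega

lemma ISeg.head_mem {a b : V} {l : List V} (h : ISeg G a l b) : a ∈ l := h.seg.head_mem

lemma ISeg.last_mem {a b : V} {l : List V} (h : ISeg G a l b) : b ∈ l := h.seg.last_mem

lemma ISeg.split {a b : V} {l m : List V} (h : ISeg G a (l ++ m) b) (hl : l ≠ []) (hm : m ≠ []) :
    ∃ c d, ISeg G a l c ∧ ISeg G d m b ∧
      ∀ u ∈ l, ∀ v ∈ m, u ≠ v ∧ (G.Adj u v ↔ u = c ∧ v = d) := by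
  obtain ⟨c, d, h1, h2, h3⟩ := h.seg.split hl hm
  obtain ⟨h4, h5, h6⟩ := indPath_append.1 h.1
  refine ⟨c, d, ⟨h4, h1.2⟩, ⟨h5, h3.2⟩, fun u hu v hv => ?_⟩
  obtain ⟨h7, h8⟩ := h6 u hu v hv
  refine ⟨h7, ?_⟩
  rw [h8, h1.2.2, h3.2.1, Option.some_inj, Option.some_inj, @eq_comm _ c, @eq_comm _ d]

lemma ISeg.eq_singleton {a b : V} {l : List V} (h : ISeg G a l b) (hl : l.length = 1) :
    l = [a] ∧ b = a := by
  obtain ⟨x, rfl⟩ := List.length_eq_one_iff.1 hl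
  obtain ⟨h1, h2⟩ := h.seg.eq_of_singleton
  exact ⟨by rw [h1], by rw [h1, h2]⟩

lemma TwoArcs.indCyc {a b c d : V} {l m : List V} (h : TwoArcs G a l b c m d)
    (h4 : 4 ≤ l.length + m.length) : IndCyc G (l ++ m) := by
  refine ⟨by simpa using h4, ?_⟩
  obtain ⟨h1, h2, h3⟩ := h
  obtain _ | ⟨a', l⟩ := l
  · exact absurd rfl h1.seg.ne_nil
  obtain rfl : a = a' := by
    have := h1.2.1
    simpa using this.symm
  by_cases hl : l = []
  · subst hl
    obtain ⟨-, rfl⟩ := h1.eq_singleton rfl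
    exact ⟨_, m, c, d, rfl, ISeg.singleton b, h2, h3⟩
  · obtain ⟨a'', e, k1, k2, k3⟩ := ISeg.split (l := [a]) (m := l) h1 (by simp) hl
    obtain ⟨-, rfl⟩ := k1.eq_singleton rfl
    have hb : a'' ≠ b := by
      have := k2.seg.ne_nil
      refine h1.ne_of_two_le ?_
      have := List.length_pos_iff.2 this
      simp
      omega
    refine ⟨a'', l ++ m, e, d, rfl, ISeg.singleton a'', k2.append h2 ?_, ?_⟩
    · intro u hu v hv
      obtain ⟨j1, j2⟩ := h3 u (List.mem_cons_of_mem _ hu) v hv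
      refine ⟨j1, ?_⟩
      rw [j2]
      have := (k3 a'' (by simp) u hu).1
      constructor
      · rintro (h | h)
        · exact h
        · exact absurd h.1.symm this
      · exact Or.inl
    · intro u hu v hv
      rw [List.mem_singleton] at hu
      subst hu
      rcases List.mem_append.1 hv with hv | hv
      · obtain ⟨j1, j2⟩ := k3 u (by simp) v hv
        refine ⟨j1, ?_⟩
        rw [j2]
        have := (h3 v (List.mem_cons_of_mem _ hv) d h2.last_mem).1
        tauto
      · obtain ⟨j1, j2⟩ := h3 u (by simp) v hv
        refine ⟨j1, ?_⟩
        rw [j2]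
        have : v ≠ e := fun e' => (h3 v (e' ▸ List.mem_cons_of_mem _ k2.head_mem) v hv).1 rfl
        tauto

lemma IndPath.split_adj {l : List V} (h : IndPath G l) {u v : V} (hu : u ∈ l) (hv : v ∈ l)
    (huv : G.Adj u v) : ∃ A B, l = A ++ B ∧ ((A.getLast? = some u ∧ B.head? = some v) ∨
      (A.getLast? = some v ∧ B.head? = some u)) := by
  obtain ⟨A, B, rfl⟩ := List.append_of_mem hu
  rw [List.mem_append, List.mem_cons] at hv
  obtain ⟨h1, h2, h3⟩ := indPath_append.1 h
  rcases hv with hv | rfl | hv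
  · refine ⟨A, u :: B, rfl, Or.inr ?_⟩
    exact ((h3 v hv u (by simp)).2).1 huv.symm
  · exact absurd rfl huv.ne
  · refine ⟨A ++ [u], B, by simp, Or.inl ⟨by simp, ?_⟩⟩
    exact (h2.1 v hv).2.1 huv

lemma IndCyc.split_adj {D : List V} (h : IndCyc G D) {u v : V} (hu : u ∈ D) (hv : v ∈ D)
    (huv : G.Adj u v) : ∃ a l m d, TwoArcs G a l u v m d ∧ (l ++ m).Perm D := by
  obtain ⟨h4, a, l, c, d, rfl, h1, h2, h3⟩ := h
  have h3' : ∀ v ∈ l, a ≠ v ∧ (G.Adj a v ↔ v = c ∨ v = d) := by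
    simpa using h3
  have ends : ∀ v ∈ l, G.Adj a v → ∃ a' l' m d, TwoArcs G a' l' a v m d ∧
      (l' ++ m).Perm (a :: l) := by
    intro v hv hav
    rcases ((h3' v hv).2).1 hav with rfl | rfl
    · exact ⟨a, [a], l, d, ⟨h1, h2, h3⟩, List.Perm.refl _⟩
    · exact ⟨a, [a], l.reverse, c, TwoArcs.reverse ⟨h1, h2, h3⟩,
        List.Perm.cons _ (List.reverse_perm _)⟩
  have flip : ∀ {u v a' l' m d}, TwoArcs G a' l' v u m d → (l' ++ m).Perm (a :: l) →
      ∃ a' l' m d, TwoArcs G a' l' u v m d ∧ (l' ++ m).Perm (a :: l) := by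
    intro u v a' l' m d k1 k2
    refine ⟨_, _, _, _, k1.symm.reverse, List.Perm.trans ?_ k2⟩
    rw [← List.reverse_append]
    exact List.reverse_perm _
  rcases List.mem_cons.1 hu with rfl | hu'
  · exact ends v ((List.mem_cons.1 hv).resolve_left huv.ne') huv
  rcases List.mem_cons.1 hv with rfl | hv'
  · obtain ⟨a', l', m', d', k1, k2⟩ := ends u hu' huv.symm
    exact flip k1 k2
  have key : ∀ u v A B, l = A ++ B → A.getLast? = some u → B.head? = some v →
      ∃ a' l' m d, TwoArcs G a' l' u v m d ∧ (l' ++ m).Perm (a :: l) := by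
    rintro u v A B rfl hA hB
    have hA' : A ≠ [] := by rintro rfl; simp at hA
    have hB' : B ≠ [] := by rintro rfl; simp at hB
    obtain ⟨x, y, k1, k2, k3⟩ := h2.split hA' hB'
    obtain rfl : x = u := by
      have := k1.2.2
      rw [hA] at this
      simpa using this.symm
    obtain rfl : y = v := by
      have := k2.2.1
      rw [hB] at this
      simpa using this.symm
    have hcB : c ∉ B := fun h => (k3 c k1.head_mem c h).1 rfl
    have hdA : d ∉ A := fun h => (k3 d h d k2.last_mem).1 rfl
    have haA : a ∉ A := fun h => (h3' a (by simp [h])).1 rfl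
    refine ⟨a, a :: A, B, d, ⟨ISeg.append (l := [a]) h1 k1 ?_, k2, ?_⟩, List.Perm.refl _⟩
    · intro p hp q hq
      rw [List.mem_singleton] at hp
      subst hp
      obtain ⟨j1, j2⟩ := h3' q (by simp [hq])
      refine ⟨j1, ?_⟩
      have : q ≠ d := fun h => hdA (h ▸ hq)
      rw [j2]
      tauto
    · intro p hp q hq
      rcases List.mem_cons.1 hp with rfl | hp'
      · obtain ⟨j1, j2⟩ := h3' q (by simp [hq])
        refine ⟨j1, ?_⟩
        have h5 : q ≠ c := fun h => hcB (h ▸ hq)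
        have h6 : p ≠ x := fun h => haA (h ▸ k1.last_mem)
        rw [j2]
        tauto
      · obtain ⟨j1, j2⟩ := k3 p hp' q hq
        refine ⟨j1, ?_⟩
        have h6 : p ≠ a := fun h => haA (h ▸ hp')
        rw [j2]
        tauto
  obtain ⟨A, B, hl, ⟨hA, hB⟩ | ⟨hA, hB⟩⟩ := h2.1.split_adj hu' hv' huv
  · exact key u v A B hl hA hB
  · obtain ⟨a', l', m', d', k1, k2⟩ := key v u A B hl hA hB
    exact flip k1 k2

lemma IndCyc.nodup {D : List V} (h : IndCyc G D) : D.Nodup := by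
  obtain ⟨-, a, l, c, d, rfl, h1, h2, h3⟩ := h
  exact List.nodup_cons.2 ⟨fun h => (h3 a (by simp) a h).1 rfl, h2.1.nodup⟩

/-- Every vertex of an induced cycle has exactly two neighbours on it, which are not adjacent. -/
lemma IndCyc.exists_neighbors {D : List V} (h : IndCyc G D) {u : V} (hu : u ∈ D) :
    ∃ p q, p ∈ D ∧ q ∈ D ∧ p ≠ q ∧ ¬ G.Adj p q ∧ ∀ v ∈ D, G.Adj u v ↔ v = p ∨ v = q := by
  have key : ∀ u ∈ D, (∃ e ∈ D, G.Adj u e) → ∃ p q, p ∈ D ∧ q ∈ D ∧ p ≠ q ∧ ¬ G.Adj p q ∧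
      ∀ v ∈ D, G.Adj u v ↔ v = p ∨ v = q := by
    rintro u hu ⟨e, he, hue⟩
    obtain ⟨a, l, m, d, k1, k2⟩ := h.split_adj hu he hue
    by_cases hl : l.length = 1
    · obtain ⟨rfl, rfl⟩ := k1.1.eq_singleton hl
      have hm : 3 ≤ m.length := by
        have := k2.length_eq
        have := h.1
        simp at *
        omega
      refine ⟨e, d, he, k2.mem_iff.1 (by simp [k1.2.1.last_mem]), k1.2.1.ne_of_two_le (by omega),
        k1.2.1.not_adj_of_three_le hm, fun v hv => ?_⟩
      rcases List.mem_cons.1 (k2.mem_iff.2 hv) with rfl | hv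
      · have h1 := (k1.2.2 v (by simp) e k1.2.1.head_mem).1
        have h2 := (k1.2.2 v (by simp) d k1.2.1.last_mem).1
        have := G.loopless.irrefl v
        tauto
      · have := (k1.2.2 u (by simp) v hv).2
        tauto
    · obtain ⟨l', x, rfl⟩ := List.eq_nil_or_concat' l |>.resolve_left k1.1.seg.ne_nil
      have hl' : l' ≠ [] := by
        rintro rfl
        simp at hl
      obtain ⟨y, z, j1, j2, j3⟩ := k1.1.split hl' (by simp)
      obtain ⟨j4, j5⟩ := j2.eq_singleton rfl
      obtain rfl : x = u := by simpa [j5] using j4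
      have hxa : x ≠ a := fun e => (j3 a j1.head_mem x (by simp)).1 e.symm
      have hye := k1.2.2 y (by simp [j1.last_mem]) e k1.2.1.head_mem
      have hyx : y ≠ x := (j3 y j1.last_mem x (by simp)).1
      refine ⟨y, e, k2.mem_iff.1 (by simp [j1.last_mem]), he, hye.1, ?_, ?_⟩
      · rw [hye.2]
        rintro (h1 | ⟨rfl, rfl⟩)
        · exact hyx h1.1
        · have h1 : m.length = 1 := by
            by_contra hc
            have := List.length_pos_iff.2 k1.2.1.seg.ne_nil
            exact k1.2.1.ne_of_two_le (by omega) rfl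
          have h2 : l'.length = 1 := by
            by_contra hc
            have := List.length_pos_iff.2 j1.seg.ne_nil
            exact j1.ne_of_two_le (by omega) rfl
          have := k2.length_eq
          have := h.1
          simp at *
          omega
      · intro v hv
        have hv := k2.mem_iff.2 hv
        rw [List.mem_append, List.mem_append, List.mem_singleton] at hv
        rcases hv with (hv | rfl) | hv
        · have h1 := (j3 v hv x (by simp))
          have h2 := (k1.2.2 v (by simp [hv]) e k1.2.1.head_mem).1
          rw [G.adj_comm, h1.2]
          subst j5
          tauto
        · have h1 := (k1.2.2 v (by simp) e k1.2.1.head_mem).1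
          have := G.loopless.irrefl v
          tauto
        · have h1 := (k1.2.2 x (by simp) v hv).2
          have h2 := (k1.2.2 y (by simp [j1.last_mem]) v hv).1
          tauto
  refine key u hu ?_
  obtain ⟨h4, a, l, c, d, rfl, h1, h2, h3⟩ := h
  rcases List.mem_cons.1 hu with rfl | hu'
  · exact ⟨c, by simp [h2.head_mem], (h3 u (by simp) c h2.head_mem).2.2 (by simp)⟩
  · obtain ⟨i, hi, rfl⟩ := List.getElem_of_mem hu'
    have hl : 3 ≤ l.length := by simpa using h4
    by_cases hi0 : i = 0
    · exact ⟨l[1], by simp, (h2.1.adj_getElem _ _).2 (by omega)⟩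
    · exact ⟨l[i - 1], by simp, (h2.1.adj_getElem _ _).2 (by omega)⟩

lemma IndCyc.exists_second {D : List V} (h : IndCyc G D) (hG : ClawFree G) {w d : V} (hw : w ∉ D)
    (hd : d ∈ D) (hwd : G.Adj w d) : ∃ e ∈ D, G.Adj d e ∧ G.Adj w e := by
  obtain ⟨p, q, hp, hq, hpq, hn, hD⟩ := h.exists_neighbors hd
  have hdp := (hD p hp).2 (Or.inl rfl)
  have hdq := (hD q hq).2 (Or.inr rfl)
  rcases hG d w p q hwd.symm hdp hdq with (h1 | h1) | (h1 | h1) | (h1 | h1)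
  · exact absurd (h1 ▸ hp) hw
  · exact ⟨p, hp, hdp, h1⟩
  · exact absurd (h1 ▸ hq) hw
  · exact ⟨q, hq, hdq, h1⟩
  · exact absurd h1 hpq
  · exact absurd h1 hn

lemma IndCyc.exists_attachment {D : List V} (h : IndCyc G D) (hG : ClawFree G) {s r d : V}
    (hs : s ∉ D) (hr : r ∉ D) (hrD : ∀ v ∈ D, ¬ G.Adj r v) (hsr : G.Adj s r)
    (hd : d ∈ D) (hsd : G.Adj s d) :
    ∃ e ∈ D, G.Adj d e ∧ ∀ v ∈ D, G.Adj s v ↔ v = d ∨ v = e := by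
  obtain ⟨e, he, hde, hse⟩ := h.exists_second hG hs hd hsd
  refine ⟨e, he, hde, fun v hv => ⟨fun hsv => ?_, ?_⟩⟩
  · by_contra! hc
    have near : ∀ u ∈ D, G.Adj s u → v ≠ u → G.Adj u v := by
      intro u hu hsu hvu
      rcases hG s r u v hsr hsu hsv with (h1 | h1) | (h1 | h1) | (h1 | h1)
      · exact absurd (h1 ▸ hu) hr
      · exact absurd h1 (hrD u hu)
      · exact absurd (h1 ▸ hv) hr
      · exact absurd h1 (hrD v hv)
      · exact absurd h1.symm hvu
      · exact h1
    have h1 := near d hd hsd hc.1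
    have h2 := near e he hse hc.2
    obtain ⟨p, q, hp, hq, hpq, hn, hD⟩ := h.exists_neighbors hd
    rcases (hD v hv).1 h1 with rfl | rfl <;> rcases (hD e he).1 hde with rfl | rfl
    · exact hc.2 rfl
    · exact hn h2.symm
    · exact hn h2
    · exact hc.2 rfl
  · rintro (rfl | rfl)
    · exact hsd
    · exact hse

lemma IndCyc.hamL_of_dominating [Finite V] {D : List V} (h : IndCyc G D) (hG : ClawFree G)
    (hG' : DiamondFree G) (hdom : ∀ w, w ∉ D → ∃ d ∈ D, G.Adj w d) : HamL G := by
  have hD := h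
  have hn := h.nodup
  obtain ⟨h4, a, l, c, d, rfl, h1, h2, h3⟩ := h
  have h3' : ∀ v ∈ l, a ≠ v ∧ (G.Adj a v ↔ v = c ∨ v = d) := by
    simpa using h3
  have hl : 3 ≤ l.length := by simpa using h4
  have hc : c = l[0] := by
    have := h2.2.1
    rw [List.head?_eq_getElem?, List.getElem?_eq_getElem (by omega), Option.some_inj] at this
    exact this.symm
  have hd : d = l[l.length - 1] := by
    have := h2.2.2
    rw [List.getLast?_eq_getElem?, List.getElem?_eq_getElem (by omega), Option.some_inj] at this
    exact this.symm
  let f : ℕ → V := fun i => (a :: l)[i]?.getD a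
  have f0 : f 0 = a := rfl
  have fk : f (l.length + 1) = a := by simp [f]
  have fs : ∀ i (hi : i < l.length), f (i + 1) = l[i] := by
    intro i hi
    simp [f, hi]
  have hwf : ∀ w u v, u ∈ a :: l → v ∈ a :: l → G.Adj u v → G.Adj w u → G.Adj w v →
      ∃ i < l.length + 1, G.Adj w (f i) ∧ G.Adj w (f (i + 1)) := by
    intro w u v hu hv huv hwu hwv
    wlog hcase : u = a ∨ (u ∈ l ∧ v ∈ l) generalizing u v
    · refine this v u hv hu huv.symm hwv hwu (Or.inl ?_)
      simp only [List.mem_cons] at hu hv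
      tauto
    rcases hcase with rfl | ⟨hu, hv⟩
    · have hv := (List.mem_cons.1 hv).resolve_left huv.ne'
      rcases (h3' v hv).2.1 huv with rfl | rfl
      · exact ⟨0, by omega, by rwa [f0], by rw [fs 0 (by omega)]; rwa [← hc]⟩
      · refine ⟨l.length, by omega, ?_, by rwa [fk]⟩
        have := fs (l.length - 1) (by omega)
        rw [Nat.sub_add_cancel (by omega)] at this
        rwa [this, ← hd]
    · obtain ⟨i, hi, rfl⟩ := List.getElem_of_mem hu
      obtain ⟨j, hj, rfl⟩ := List.getElem_of_mem hv
      rcases (h2.1.adj_getElem hi hj).1 huv with rfl | rfl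
      · exact ⟨i + 1, by omega, by rwa [fs i hi], by rwa [fs (i + 1) hj]⟩
      · exact ⟨j + 1, by omega, by rwa [fs j hj], by rwa [fs (j + 1) hi]⟩
  refine hamL_of_dominating_cycle hG' (d := f) (k := l.length + 1) (by omega) ?_ ?_
    (by rw [fk, f0]) ?_
  · intro i hi j hj hij
    have e : ∀ i (hi : i < l.length + 1), f i = (a :: l)[i] := by
      intro i hi
      simp [f, hi]
    rw [e i hi, e j hj, hn.getElem_inj_iff] at hij
    exact hij
  · intro i hi
    rcases i with _ | i
    · rw [f0, fs 0 (by omega), ← hc]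
      exact (h3' c h2.head_mem).2.2 (Or.inl rfl)
    · by_cases hi' : i + 1 = l.length
      · have e : l[i] = d := by
          rw [hd]
          congr 1
          omega
        have := (h3' d h2.last_mem).2.2 (Or.inr rfl)
        rw [fs i (by omega), hi', fk, e]
        exact this.symm
      · rw [fs i (by omega), fs (i + 1) (by omega)]
        exact (h2.1.adj_getElem _ _).2 (by omega)
  · intro w hw
    have hwD : w ∉ a :: l := by
      intro hw'
      obtain ⟨i, hi, rfl⟩ := List.getElem_of_mem hw'
      refine hw i (by simpa using hi) ?_
      simp at hi
      simp [f, hi]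
    obtain ⟨d, hd, hwd⟩ := hdom w hwD
    obtain ⟨e, he, hde, hwe⟩ := hD.exists_second hG hwD hd hwd
    exact hwf w d e hd he hde hwd hwe

/-- A two-connected diamond-free graph without Hamilton cycle contains a long induced cycle. -/
lemma exists_indCyc [Finite V] (hG : TwoConn G) (hG' : DiamondFree G) (hH : ¬ HamL G) :
    ∃ D, IndCyc G D := by
  obtain ⟨u, v, huv, hnuv⟩ : ∃ u v, u ≠ v ∧ ¬ G.Adj u v := by
    by_contra! hc
    exact hH (hamL_of_complete hG.1 hc)
  obtain ⟨c, p, q, hp, hq, hpq, hnpq⟩ : ∃ c p q, G.Adj c p ∧ G.Adj c q ∧ p ≠ q ∧ ¬ G.Adj p q := by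
    obtain ⟨l, hl, -⟩ := exists_seg_of_reflTransGen (fun _ _ h => h) (hG.connected u v)
    obtain ⟨m, hm, -⟩ := hl.exists_iSeg
    have h3 : 3 ≤ m.length := by
      have h0 := List.length_pos_iff.2 hm.seg.ne_nil
      have h1 : m.length ≠ 1 := fun h => huv (hm.eq_singleton h).2.symm
      have h2 : m.length ≠ 2 := by
        intro h
        obtain ⟨x, y, rfl⟩ := List.length_eq_two.1 h
        have e1 := hm.2.1
        have e2 := hm.2.2
        have e3 := hm.1.isChain
        simp at e1 e2 e3
        exact hnuv (e1 ▸ e2 ▸ e3)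
      omega
    refine ⟨m[1], m[0], m[2], (hm.1.adj_getElem _ _).2 (by omega),
      (hm.1.adj_getElem _ _).2 (by omega), ?_, ?_⟩
    · rw [Ne, hm.1.nodup.getElem_inj_iff]
      omega
    · rw [hm.1.adj_getElem]
      omega
  let P : V → Prop := fun x => x = p ∨ G.Adj p x
  let good : List V → Prop := fun m => ∃ a b, ISeg G a m b ∧ c ∉ m ∧ G.Adj c a ∧ G.Adj c b ∧
    P a ∧ ¬ P b
  have hex : ∃ m, good m := by
    obtain ⟨l, hl, hlc⟩ := exists_seg_of_reflTransGen (fun _ _ h => h.1) (hG.2 c p q hp.ne' hq.ne')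
    obtain ⟨m, hm, hml⟩ := hl.exists_iSeg
    refine ⟨m, p, q, hm, fun hc => ?_, hp, hq, Or.inl rfl, fun h => h.elim hpq.symm hnpq⟩
    rcases hlc c (hml hc) with h | ⟨_, h⟩
    · exact hq.ne h
    · exact h.2.1 rfl
  obtain ⟨m, ⟨a, b, hm, hcm, hca, hcb, hPa, hPb⟩, hmin⟩ :=
    WellFounded.has_min (measure (List.length : List V → ℕ)).wf {m | good m} hex
  have hab : a ≠ b := fun e => hPb (e ▸ hPa)
  have hnab : ¬ G.Adj a b := by
    intro h
    rcases hPa with rfl | hPa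
    · exact hPb (Or.inr h)
    · exact hPb ((hG' c p a b hp hca hcb hPa h).imp_left Eq.symm)
  have hm3 : 3 ≤ m.length := by
    have h0 := List.length_pos_iff.2 hm.seg.ne_nil
    have h1 : m.length ≠ 1 := fun h => hab (hm.eq_singleton h).2.symm
    have h2 : m.length ≠ 2 := by
      intro h
      obtain ⟨x, y, rfl⟩ := List.length_eq_two.1 h
      have e1 := hm.2.1
      have e2 := hm.2.2
      have e3 := hm.1.isChain
      simp at e1 e2 e3
      exact hnab (e1 ▸ e2 ▸ e3)
    omega
  have hnbr : ∀ x ∈ m, G.Adj c x → x = a ∨ x = b := by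
    intro x hx hcx
    by_contra! hc
    obtain ⟨A, B, hAB⟩ := List.append_of_mem hx
    have hA : A ≠ [] := by
      rintro rfl
      have := hm.2.1
      rw [hAB] at this
      simp at this
      exact hc.1 this
    have hB : B ≠ [] := by
      rintro rfl
      have := hm.2.2
      rw [hAB] at this
      simp at this
      exact hc.2 this
    by_cases hPx : P x
    · rw [hAB] at hm
      obtain ⟨y, z, j1, j2, j3⟩ := hm.split hA (by simp)
      obtain rfl : x = z := by
        have := j2.2.1
        simpa using this
      refine hmin (x :: B) ⟨x, b, j2, fun h => hcm ?_, hcx, hcb, hPx, hPb⟩ ?_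
      · rw [hAB]
        exact List.mem_append_right _ h
      · have := List.length_pos_iff.2 hA
        change (x :: B).length < m.length
        rw [hAB]
        simp
        omega
    · have hAB' : m = (A ++ [x]) ++ B := by simp [hAB]
      rw [hAB'] at hm
      obtain ⟨y, z, j1, j2, j3⟩ := hm.split (by simp) hB
      obtain rfl : x = y := by
        have := j1.2.2
        simpa using this
      refine hmin (A ++ [x]) ⟨a, x, j1, fun h => hcm ?_, hca, hcx, hPa, hPx⟩ ?_
      · rw [hAB']
        exact List.mem_append_left _ h
      · have := List.length_pos_iff.2 hB
        change (A ++ [x]).length < m.length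
        rw [hAB']
        simp
        omega
  refine ⟨c :: m, by simpa using hm3, c, m, a, b, rfl, ISeg.singleton c, hm, ?_⟩
  intro u hu v hv
  rw [List.mem_singleton] at hu
  subst hu
  refine ⟨fun e => hcm (e ▸ hv), fun h => ?_, ?_⟩
  · have := hnbr v hv h
    tauto
  · rintro (⟨-, rfl⟩ | ⟨-, rfl⟩)
    · exact hca
    · exact hcb

end InducedCycles

section Routes

variable {V : Type*} {G : SimpleGraph V}

/-- The induced paths `l` from `p` to `q` and `l'` from `p'` to `q'` are disjoint, and the only
edges between them are `pp'` and `qq'`. -/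
def Par (G : SimpleGraph V) (p : V) (l : List V) (q p' : V) (l' : List V) (q' : V) : Prop :=
  ISeg G p l q ∧ ISeg G p' l' q' ∧
    ∀ u ∈ l, ∀ v ∈ l', u ≠ v ∧ (G.Adj u v ↔ (u = p ∧ v = p') ∨ (u = q ∧ v = q'))

lemma Par.symm {p q p' q' : V} {l l' : List V} (h : Par G p l q p' l' q') :
    Par G p' l' q' p l q := by
  refine ⟨h.2.1, h.1, fun u hu v hv => ?_⟩
  obtain ⟨h1, h2⟩ := h.2.2 v hv u hu
  refine ⟨h1.symm, ?_⟩
  rw [G.adj_comm, h2]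
  tauto

lemma Par.indCyc {p q p' q' : V} {l l' : List V} (h : Par G p l q p' l' q')
    (h4 : 4 ≤ l.length + l'.length) : IndCyc G (l ++ l'.reverse) := by
  refine TwoArcs.indCyc (a := p) (b := q) (c := q') (d := p') ⟨h.1, h.2.1.reverse, ?_⟩
    (by simpa using h4)
  intro u hu v hv
  obtain ⟨h1, h2⟩ := h.2.2 u hu v (List.mem_reverse.1 hv)
  refine ⟨h1, ?_⟩
  rw [h2]
  tauto

/-- Two distinct edges of an induced cycle cut it into two parallel paths. -/
lemma IndCyc.exists_par {D : List V} (h : IndCyc G D) {u v e f : V} (hu : u ∈ D) (hv : v ∈ D)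
    (he : e ∈ D) (hf : f ∈ D) (huv : G.Adj u v) (hef : G.Adj e f)
    (hne : ¬ ∀ w, (w = u ∨ w = v) ↔ (w = e ∨ w = f)) :
    ∃ p l q p' l' q', Par G p l q p' l' q' ∧ (∀ w, w ∈ D ↔ w ∈ l ∨ w ∈ l') ∧
      l.length + l'.length = D.length ∧ (∀ w, (w = p ∨ w = p') ↔ (w = u ∨ w = v)) ∧
      ∀ w, (w = q ∨ w = q') ↔ (w = e ∨ w = f) := by
  have key : ∀ {a l u v m d A B e f}, TwoArcs G a l u v m d → l = A ++ B → A.getLast? = some e →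
      B.head? = some f → Par G u B.reverse f v (m ++ A) e := by
    rintro a l u v m d A B e f ⟨h1, h2, h3⟩ rfl hA hB
    have hA' : A ≠ [] := by rintro rfl; simp at hA
    have hB' : B ≠ [] := by rintro rfl; simp at hB
    obtain ⟨x, y, k1, k2, k3⟩ := h1.split hA' hB'
    obtain rfl : x = e := by
      have := k1.2.2
      rw [hA] at this
      simpa using this.symm
    obtain rfl : y = f := by
      have := k2.2.1
      rw [hB] at this
      simpa using this.symm
    have huA : u ∉ A := fun h => (k3 u h u k2.last_mem).1 rfl
    have haB : a ∉ B := fun h => (k3 a k1.head_mem a h).1 rfl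
    refine ⟨k2.reverse, ISeg.append h2 k1 ?_, ?_⟩
    · intro w hw z hz
      obtain ⟨j1, j2⟩ := h3 z (by simp [hz]) w hw
      refine ⟨j1.symm, ?_⟩
      have : z ≠ u := fun h => huA (h ▸ hz)
      rw [G.adj_comm, j2]
      tauto
    · intro w hw z hz
      rw [List.mem_reverse] at hw
      rcases List.mem_append.1 hz with hz | hz
      · obtain ⟨j1, j2⟩ := h3 w (by simp [hw]) z hz
        refine ⟨j1, ?_⟩
        have h5 : w ≠ a := fun h => haB (h ▸ hw)
        have h6 : z ≠ x := fun h => (h3 x (by simp [k1.last_mem]) z hz).1 h.symm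
        rw [j2]
        tauto
      · obtain ⟨j1, j2⟩ := k3 z hz w hw
        refine ⟨j1.symm, ?_⟩
        have h6 : z ≠ v := fun h => (h3 z (by simp [hz]) v h2.head_mem).1 h
        rw [G.adj_comm, j2]
        tauto
  have key2 : ∀ {a l u v m d e f}, TwoArcs G a l u v m d → (l ++ m).Perm D → e ∈ l → f ∈ D →
      G.Adj e f → (¬ ∀ w, (w = u ∨ w = v) ↔ (w = e ∨ w = f)) →
      ∃ p l q p' l' q', Par G p l q p' l' q' ∧ (∀ w, w ∈ D ↔ w ∈ l ∨ w ∈ l') ∧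
      l.length + l'.length = D.length ∧ (∀ w, (w = p ∨ w = p') ↔ (w = u ∨ w = v)) ∧
      ∀ w, (w = q ∨ w = q') ↔ (w = e ∨ w = f) := by
    intro a l u v m d e f h1 hp he hf hef hne
    have hlen := hp.length_eq
    rw [List.length_append] at hlen
    rcases List.mem_append.1 (hp.mem_iff.2 hf) with hf | hf
    · obtain ⟨A, B, hl, ⟨hA, hB⟩ | ⟨hA, hB⟩⟩ := h1.1.1.split_adj he hf hef
      · refine ⟨_, _, _, _, _, _, key h1 hl hA hB, ?_, ?_, by tauto, by tauto⟩
        · intro w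
          rw [← hp.mem_iff, hl]
          simp only [List.mem_append, List.mem_reverse]
          tauto
        · rw [← hlen, hl]
          simp only [List.length_append, List.length_reverse]
          omega
      · refine ⟨_, _, _, _, _, _, key h1 hl hA hB, ?_, ?_, by tauto, by tauto⟩
        · intro w
          rw [← hp.mem_iff, hl]
          simp only [List.mem_append, List.mem_reverse]
          tauto
        · rw [← hlen, hl]
          simp only [List.length_append, List.length_reverse]
          omega
    · rcases (h1.2.2 e he f hf).2.1 hef with ⟨rfl, rfl⟩ | ⟨rfl, rfl⟩
      · exact absurd (by tauto) hne
      · refine ⟨u, l.reverse, e, v, m, f, ⟨h1.1.reverse, h1.2.1, ?_⟩, ?_, by simpa using hlen,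
          by tauto, by tauto⟩
        · intro w hw z hz
          exact h1.2.2 w (List.mem_reverse.1 hw) z hz
        · intro w
          rw [← hp.mem_iff]
          simp
  obtain ⟨a, l, m, d, k1, k2⟩ := h.split_adj hu hv huv
  rcases List.mem_append.1 (k2.mem_iff.2 he) with he' | he'
  · exact key2 k1 k2 he' hf hef hne
  · obtain ⟨p, l1, q, p', l2, q', j1, j2, j3, j4, j5⟩ := key2 k1.symm.reverse (f := f)
      (by rw [← List.reverse_append]; exact (List.reverse_perm _).trans k2)
      (List.mem_reverse.2 he') hf hef (fun h => hne fun w => by rw [← h w]; tauto)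
    exact ⟨p, l1, q, p', l2, q', j1, j2, j3, fun w => by rw [j4 w]; tauto, j5⟩

/-- An induced path `l` from `p` to `q` together with a vertex `c` and induced paths from `c` to
`p` avoiding `q` and from `q` to `c` avoiding `p`. -/
def Route (G : SimpleGraph V) (p : V) (l : List V) (q c : V) : Prop :=
  ISeg G p l q ∧ 2 ≤ l.length ∧ ∃ α β, ISeg G c α p ∧ ISeg G q β c ∧ 2 ≤ α.length ∧
    2 ≤ β.length ∧ α ⊆ c :: l ∧ β ⊆ c :: l ∧ q ∉ α ∧ p ∉ β

lemma Route.of_three {p q : V} {l : List V} (h : ISeg G p l q) (h3 : 3 ≤ l.length) :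
    ∃ c ∈ l, c ≠ p ∧ c ≠ q ∧ Route G p l q c := by
  obtain _ | ⟨a, _ | ⟨c, _ | ⟨b, l⟩⟩⟩ := l
  · simp at h3
  · simp at h3
  · simp at h3
  have hn := h.1.nodup
  obtain rfl : a = p := by simpa using h.2.1
  obtain ⟨x, y, h1, h2, h4⟩ := ISeg.split (l := [a]) (m := c :: b :: l) h (by simp) (by simp)
  obtain rfl : c = y := by simpa using h2.2.1
  obtain ⟨x', y', k1, k2, k3⟩ := ISeg.split (l := [c]) (m := b :: l) h2 (by simp) (by simp)
  have hcq : c ≠ q := (k3 c (by simp) q k2.last_mem).1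
  have haq : a ≠ q := (h4 a (by simp) q h2.last_mem).1
  have hac : G.Adj a c := by
    have := h.1.isChain
    simp only [List.isChain_cons_cons] at this
    exact this.1
  refine ⟨c, by simp, hac.ne', hcq, h, by simp, [c, a], (c :: b :: l).reverse, ISeg.pair hac.symm,
    h2.reverse, by simp, by simp, by simp, ?_, ?_, ?_⟩
  · intro w hw
    have := List.mem_reverse.1 hw
    simp only [List.mem_cons] at this ⊢
    tauto
  · simp [hcq.symm, haq.symm]
  · rw [List.mem_reverse]
    exact (List.nodup_cons.1 hn).1

lemma Route.of_two {p q c : V} {l : List V} (h : ISeg G p l q) (h2 : l.length = 2)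
    (hp : G.Adj c p) (hq : G.Adj c q) : Route G p l q c := by
  have hpq := h.ne_of_two_le h2.ge
  obtain ⟨a, b, rfl⟩ := List.length_eq_two.1 h2
  obtain rfl : a = p := by simpa using h.2.1
  obtain rfl : b = q := by simpa using h.2.2
  exact ⟨h, h2.ge, [c, a], [b, c], ISeg.pair hp, ISeg.pair hq.symm, by simp, by simp, by simp,
    by simp, by simp [hq.ne', hpq.symm], by simp [hp.ne', hpq]⟩

lemma exists_iSeg_of_routes {p₁ q₁ c₁ p₂ q₂ c₂ p₃ q₃ c₃ : V} {l₁ l₂ l₃ : List V}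
    (h₁ : Route G p₁ l₁ q₁ c₁) (h₂ : Route G p₂ l₂ q₂ c₂) (h₃ : Route G p₃ l₃ q₃ c₃)
    (h₁₂ : Par G p₁ l₁ q₁ p₂ l₂ q₂) (h₁₃ : Par G p₁ l₁ q₁ p₃ l₃ q₃)
    (h₂₃ : Par G p₂ l₂ q₂ p₃ l₃ q₃)
    (hc₁ : ∀ v ∈ l₂ ++ l₃, c₁ ≠ v ∧ ¬ G.Adj c₁ v) (hc₃ : ∀ v ∈ l₁ ++ l₂, c₃ ≠ v ∧ ¬ G.Adj c₃ v)
    (hc : c₁ ≠ c₃) (hc' : ¬ G.Adj c₁ c₃) : ∃ l, ISeg G c₁ l c₃ ∧ 6 ≤ l.length := by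
  obtain ⟨-, -, α, -, hα, -, hα2, -, hα3, -, hα4, -⟩ := h₁
  obtain ⟨-, -, -, β, -, hβ, -, hβ2, -, hβ3, -, hβ4⟩ := h₃
  refine ⟨α ++ (l₂ ++ β), ?_, ?_⟩
  · have hp1 : c₁ ≠ p₁ := hα.ne_of_two_le hα2
    have hq3 : q₃ ≠ c₃ := hβ.ne_of_two_le hβ2
    refine ISeg.append hα (ISeg.append h₁₂.2.1 hβ ?_) ?_
    · intro u hu v hv
      rcases List.mem_cons.1 (hβ3 hv) with rfl | hv'
      · obtain ⟨k1, k2⟩ := hc₃ u (by simp [hu])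
        refine ⟨k1.symm, ?_⟩
        rw [G.adj_comm]
        tauto
      · obtain ⟨k1, k2⟩ := h₂₃.2.2 u hu v hv'
        refine ⟨k1, ?_⟩
        have : v ≠ p₃ := fun h => hβ4 (h ▸ hv)
        rw [k2]
        tauto
    · intro u hu v hv
      have huq : u ≠ q₁ := fun h => hα4 (h ▸ hu)
      have hc₂₃ : ∀ v ∈ β, p₂ ≠ v := by
        intro v hv
        rcases List.mem_cons.1 (hβ3 hv) with rfl | hv'
        · exact (hc₃ p₂ (by simp [h₁₂.2.1.head_mem])).1.symm
        · exact (h₂₃.2.2 p₂ h₁₂.2.1.head_mem v hv').1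
      rcases List.mem_append.1 hv with hv | hv
      · rcases List.mem_cons.1 (hα3 hu) with rfl | hu'
        · obtain ⟨k1, k2⟩ := hc₁ v (by simp [hv])
          exact ⟨k1, by tauto⟩
        · obtain ⟨k1, k2⟩ := h₁₂.2.2 u hu' v hv
          refine ⟨k1, ?_⟩
          rw [k2]
          tauto
      · have hvp := (hc₂₃ v hv).symm
        have hv3 : v ≠ p₃ := fun h => hβ4 (h ▸ hv)
        rcases List.mem_cons.1 (hα3 hu) with rfl | hu' <;>
          rcases List.mem_cons.1 (hβ3 hv) with rfl | hv'
        · exact ⟨hc, by tauto⟩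
        · obtain ⟨k1, k2⟩ := hc₁ v (by simp [hv'])
          exact ⟨k1, by tauto⟩
        · obtain ⟨k1, k2⟩ := hc₃ u (by simp [hu'])
          rw [G.adj_comm] at k2
          exact ⟨k1.symm, by tauto⟩
        · obtain ⟨k1, k2⟩ := h₁₃.2.2 u hu' v hv'
          refine ⟨k1, ?_⟩
          rw [k2]
          tauto
  · simp only [List.length_append]
    have := h₂.2.1
    omega

/-- Three pairwise parallel routes contain a long induced path with ends outside a given clique. -/
lemma exists_iSeg_avoiding_of_routes {W : Set V} (hW : G.IsClique W)
    {p₁ q₁ c₁ p₂ q₂ c₂ p₃ q₃ c₃ : V} {l₁ l₂ l₃ : List V}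
    (h₁ : Route G p₁ l₁ q₁ c₁) (h₂ : Route G p₂ l₂ q₂ c₂) (h₃ : Route G p₃ l₃ q₃ c₃)
    (h₁₂ : Par G p₁ l₁ q₁ p₂ l₂ q₂) (h₁₃ : Par G p₁ l₁ q₁ p₃ l₃ q₃)
    (h₂₃ : Par G p₂ l₂ q₂ p₃ l₃ q₃)
    (hc₁ : ∀ v ∈ l₂ ++ l₃, c₁ ≠ v ∧ ¬ G.Adj c₁ v) (hc₂ : ∀ v ∈ l₁ ++ l₃, c₂ ≠ v ∧ ¬ G.Adj c₂ v)
    (hc₃ : ∀ v ∈ l₁ ++ l₂, c₃ ≠ v ∧ ¬ G.Adj c₃ v)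
    (hc₁₂ : c₁ ≠ c₂ ∧ ¬ G.Adj c₁ c₂) (hc₁₃ : c₁ ≠ c₃ ∧ ¬ G.Adj c₁ c₃)
    (hc₂₃ : c₂ ≠ c₃ ∧ ¬ G.Adj c₂ c₃) :
    ∃ a l b, ISeg G a l b ∧ a ∉ W ∧ b ∉ W ∧ 6 ≤ l.length := by
  have e12 : c₁ ∉ W ∨ c₂ ∉ W := by
    by_contra! h
    exact hc₁₂.2 (hW h.1 h.2 hc₁₂.1)
  have e13 : c₁ ∉ W ∨ c₃ ∉ W := by
    by_contra! h
    exact hc₁₃.2 (hW h.1 h.2 hc₁₃.1)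
  have e23 : c₂ ∉ W ∨ c₃ ∉ W := by
    by_contra! h
    exact hc₂₃.2 (hW h.1 h.2 hc₂₃.1)
  by_cases w1 : c₁ ∈ W
  · obtain ⟨l, k1, k2⟩ := exists_iSeg_of_routes h₂ h₁ h₃ h₁₂.symm h₂₃ h₁₃ hc₂
      (fun v hv => hc₃ v (by simp only [List.mem_append] at hv ⊢; tauto)) hc₂₃.1 hc₂₃.2
    exact ⟨_, l, _, k1, by tauto, by tauto, k2⟩
  · by_cases w2 : c₂ ∈ W
    · obtain ⟨l, k1, k2⟩ := exists_iSeg_of_routes h₁ h₂ h₃ h₁₂ h₁₃ h₂₃ hc₁ hc₃ hc₁₃.1 hc₁₃.2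
      exact ⟨_, l, _, k1, by tauto, by tauto, k2⟩
    · obtain ⟨l, k1, k2⟩ := exists_iSeg_of_routes h₁ h₃ h₂ h₁₃ h₁₂ h₂₃.symm
        (fun v hv => hc₁ v (by simp only [List.mem_append] at hv ⊢; tauto)) hc₂ hc₁₂.1 hc₁₂.2
      exact ⟨_, l, _, k1, by tauto, by tauto, k2⟩

end Routes

section Theta

variable {V : Type*} {G : SimpleGraph V}

/-- The closed neighbourhood of a list of vertices. -/
def nbd (G : SimpleGraph V) (D : List V) : Set V := {v | v ∈ D ∨ ∃ d ∈ D, G.Adj v d}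

/-- The vertices of the closed neighbourhood of `D` with a neighbour in `R`. -/
def fringe (G : SimpleGraph V) (D : List V) (R : Set V) : Set V :=
  {s | s ∈ nbd G D ∧ ∃ r ∈ R, G.Adj s r}

/-- The set `R` is connected and avoids the closed neighbourhood of the induced cycle `D`, which is
maximal. -/
structure Remote (G : SimpleGraph V) (D : List V) (R : Set V) : Prop where
  indCyc : IndCyc G D
  maximal : ∀ D', IndCyc G D' → nbd G D ⊆ nbd G D' → nbd G D' ⊆ nbd G D
  notMem : ∀ r ∈ R, r ∉ nbd G D
  conn : ∀ r ∈ R, ∀ r' ∈ R, Relation.ReflTransGen (fun a b => G.Adj a b ∧ a ∈ R ∧ b ∈ R) r r'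

variable {D : List V} {R : Set V}

lemma Remote.fringe_notMem (h : Remote G D R) {s : V} (hs : s ∈ fringe G D R) : s ∉ D := by
  obtain ⟨-, r, hr, hsr⟩ := hs
  exact fun hsD => h.notMem r hr (Or.inr ⟨s, hsD, hsr.symm⟩)

lemma Remote.not_adj (h : Remote G D R) {r d : V} (hr : r ∈ R) (hd : d ∈ D) : ¬ G.Adj r d :=
  fun hrd => h.notMem r hr (Or.inr ⟨d, hd, hrd⟩)

lemma Remote.exists_attachment (h : Remote G D R) (hG : ClawFree G) {s : V}
    (hs : s ∈ fringe G D R) :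
    ∃ d ∈ D, ∃ e ∈ D, G.Adj d e ∧ ∀ v ∈ D, G.Adj s v ↔ v = d ∨ v = e := by
  have hsD := h.fringe_notMem hs
  obtain ⟨hs | ⟨d, hd, hsd⟩, r, hr, hsr⟩ := hs
  · exact absurd hs hsD
  · obtain ⟨e, he, k1, k2⟩ := h.indCyc.exists_attachment hG hsD
      (fun hrD => h.notMem r hr (Or.inl hrD)) (fun v hv => h.not_adj hr hv) hsr hd hsd
    exact ⟨d, hd, e, he, k1, k2⟩

lemma Remote.exists_connector (h : Remote G D R) {s s' : V} (hs : s ∈ fringe G D R)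
    (hs' : s' ∈ fringe G D R) :
    ∃ m, ISeg G s m s' ∧ ∀ v ∈ m, v = s ∨ v = s' ∨ v ∈ R := by
  obtain ⟨-, r, hr, hsr⟩ := hs
  obtain ⟨-, r', hr', hsr'⟩ := hs'
  obtain ⟨l, h1, h2⟩ := exists_seg_of_reflTransGen (fun a b h => h.1) (h.conn r hr r' hr')
  obtain ⟨m, h3, h4⟩ := (((Seg.singleton G s).append hsr h1).append hsr'.symm
    (Seg.singleton G s')).exists_iSeg
  refine ⟨m, h3, fun v hv => ?_⟩
  have := h4 hv
  simp only [List.mem_append, List.mem_singleton] at this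
  rcases this with (rfl | hv) | rfl
  · exact Or.inl rfl
  · rcases h2 v hv with rfl | ⟨u, hu⟩
    · exact Or.inr (Or.inr hr')
    · exact Or.inr (Or.inr hu.2.1)
  · exact Or.inr (Or.inl rfl)

/-- An induced cycle cut into two parallel paths, together with a third path through `R` parallel
to both. -/
structure Theta (G : SimpleGraph V) (D : List V) (R : Set V) (p : V) (l : List V) (q p' : V)
    (l' : List V) (q' s : V) (m : List V) (s' : V) : Prop where
  par : Par G p l q p' l' q'
  par_left : Par G p l q s m s'
  par_right : Par G p' l' q' s m s'
  mem : ∀ w, w ∈ D ↔ w ∈ l ∨ w ∈ l'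
  len : 4 ≤ l.length + l'.length
  start : s ∈ fringe G D R
  finish : s' ∈ fringe G D R
  ne : s ≠ s'
  inner : ∀ v ∈ m, v = s ∨ v = s' ∨ v ∈ R

variable {p q p' q' s s' : V} {l l' m : List V}

lemma Theta.symm (h : Theta G D R p l q p' l' q' s m s') :
    Theta G D R p' l' q' p l q s m s' :=
  ⟨h.par.symm, h.par_right, h.par_left, fun w => by rw [h.mem, or_comm],
    by have := h.len; omega, h.start, h.finish, h.ne, h.inner⟩

lemma Theta.adj_start (h : Theta G D R p l q p' l' q' s m s') : G.Adj p s :=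
  (h.par_left.2.2 p h.par_left.1.head_mem s h.par_left.2.1.head_mem).2.2 (Or.inl ⟨rfl, rfl⟩)

lemma Theta.adj_finish (h : Theta G D R p l q p' l' q' s m s') : G.Adj q s' :=
  (h.par_left.2.2 q h.par_left.1.last_mem s' h.par_left.2.1.last_mem).2.2 (Or.inr ⟨rfl, rfl⟩)

lemma Theta.two_le_connector (h : Theta G D R p l q p' l' q' s m s') : 2 ≤ m.length := by
  by_contra hc
  have h1 : m.length = 1 := by
    have := List.length_pos_of_mem h.par_left.2.1.head_mem
    omega
  exact h.ne (h.par_left.2.1.eq_singleton h1).2.symm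

/-- An induced cycle through the start of the third path does not dominate the cycle `D`. -/
lemma Theta.exists_undominated (h : Theta G D R p l q p' l' q' s m s') (hR : Remote G D R)
    {D' : List V} (hD' : IndCyc G D') (hs : s ∈ D') : ∃ c ∈ nbd G D, c ∉ nbd G D' := by
  by_contra! hc
  obtain ⟨-, r, hr, hsr⟩ := h.start
  exact hR.notMem r hr (hR.maximal D' hD' hc (Or.inr ⟨s, hs, hsr.symm⟩))

lemma Theta.two_le (h : Theta G D R p l q p' l' q' s m s') (hG : ClawFree G)
    (hR : Remote G D R) : 2 ≤ l.length := by
  by_contra hc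
  have h1 : l.length = 1 := by
    have := List.length_pos_of_mem h.par.1.head_mem
    omega
  obtain ⟨rfl, rfl⟩ := h.par.1.eq_singleton h1
  have hlen := h.len
  have hm := h.two_le_connector
  obtain ⟨c, hc1, hc2⟩ := h.exists_undominated hR (h.par_right.indCyc (by omega))
    (by simp [h.par_left.2.1.head_mem])
  simp only [nbd, Set.mem_ofPred_eq, not_or, not_exists, not_and, List.mem_append,
    List.mem_reverse] at hc2
  obtain ⟨⟨hcl, hcm⟩, hn⟩ := hc2
  have hcq : c ≠ q := by
    rintro rfl
    exact hn s (Or.inr h.par_left.2.1.head_mem) h.adj_start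
  have hcD : c ∉ D := by
    rw [h.mem]
    simp [hcl, hcq]
  obtain hc1 | ⟨d, hd, hcd⟩ := hc1
  · exact hcD hc1
  · obtain ⟨e, he, hde, hce⟩ := hR.indCyc.exists_second hG hcD hd hcd
    have k1 : d = q := by
      have := (h.mem d).1 hd
      rw [List.mem_singleton] at this
      exact this.resolve_right fun hd' => hn d (Or.inl hd') hcd
    have k2 : e = q := by
      have := (h.mem e).1 he
      rw [List.mem_singleton] at this
      exact this.resolve_right fun hd' => hn e (Or.inl hd') hce
    rw [k1, k2] at hde
    exact hde.ne rfl

lemma Remote.exists_theta (h : Remote G D R) (hG : ClawFree G) (hs : s ∈ fringe G D R)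
    (hs' : s' ∈ fringe G D R) (hne : ¬ ∀ v ∈ D, G.Adj s v ↔ G.Adj s' v) :
    ∃ p l q p' l' q' m, Theta G D R p l q p' l' q' s m s' := by
  obtain ⟨u, hu, v, hv, huv, h1⟩ := h.exists_attachment hG hs
  obtain ⟨e, he, f, hf, hef, h2⟩ := h.exists_attachment hG hs'
  obtain ⟨p, l, q, p', l', q', k1, k2, k3, k4, k5⟩ := h.indCyc.exists_par hu hv he hf huv hef
    (fun hc => hne fun w hw => by rw [h1 w hw, h2 w hw, hc])
  obtain ⟨m, j1, j2⟩ := h.exists_connector hs hs'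
  have hss : s ≠ s' := by
    rintro rfl
    exact hne fun _ _ => Iff.rfl
  have h4 := h.indCyc.1
  have hsD := h.fringe_notMem hs
  have hsD' := h.fringe_notMem hs'
  have key : ∀ {p l q p' l' q'}, Par G p l q p' l' q' → (∀ w, w ∈ D ↔ w ∈ l ∨ w ∈ l') →
      (∀ w, (w = p ∨ w = p') ↔ (w = u ∨ w = v)) →
      (∀ w, (w = q ∨ w = q') ↔ (w = e ∨ w = f)) → Par G p l q s m s' := by
    intro p l q p' l' q' k1 k2 k4 k5
    refine ⟨k1.1, j1, fun x hx y hy => ?_⟩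
    have hxD : x ∈ D := (k2 x).2 (Or.inl hx)
    have hxp : x ≠ p' := fun h => (k1.2.2 x hx p' k1.2.1.head_mem).1 h
    have hxq : x ≠ q' := fun h => (k1.2.2 x hx q' k1.2.1.last_mem).1 h
    rcases j2 y hy with rfl | rfl | hyR
    · refine ⟨fun h => hsD (h ▸ hxD), ?_⟩
      rw [G.adj_comm, h1 x hxD, ← k4 x]
      tauto
    · refine ⟨fun h => hsD' (h ▸ hxD), ?_⟩
      rw [G.adj_comm, h2 x hxD, ← k5 x]
      have := hss.symm
      tauto
    · refine ⟨fun hxy => h.notMem y hyR (Or.inl (hxy ▸ hxD)), ?_⟩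
      have n1 : ¬ G.Adj x y := fun hxy => h.not_adj hyR hxD hxy.symm
      have n2 : y ≠ s := fun hys => h.notMem y hyR (hys ▸ hs.1)
      have n3 : y ≠ s' := fun hys => h.notMem y hyR (hys ▸ hs'.1)
      tauto
  refine ⟨p, l, q, p', l', q', m, k1, key k1 k2 k4 k5, key k1.symm (fun w => by rw [k2, or_comm])
    (fun w => by rw [or_comm, k4]) (fun w => by rw [or_comm, k5]), k2, by omega, hs, hs', hss, j2⟩

/-- Two fringe vertices with a common neighbour on the cycle have the same neighbours on it. -/
lemma Remote.adj_iff_of_adj (h : Remote G D R) (hG : ClawFree G) (hs : s ∈ fringe G D R)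
    (hs' : s' ∈ fringe G D R) {x : V} (hx : x ∈ D) (hsx : G.Adj s x) (hsx' : G.Adj s' x) :
    ∀ v ∈ D, G.Adj s v ↔ G.Adj s' v := by
  by_contra hc
  obtain ⟨p, l, q, p', l', q', m, ht⟩ := h.exists_theta hG hs hs' hc
  have key : ∀ {p l q p' l' q'}, Theta G D R p l q p' l' q' s m s' → x ∉ l := by
    intro p l q p' l' q' ht hxl
    have hpq := ht.par.1.ne_of_two_le (ht.two_le hG h)
    have h1 := (ht.par_left.2.2 x hxl s ht.par_left.2.1.head_mem).2.1 hsx.symm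
    have h2 := (ht.par_left.2.2 x hxl s' ht.par_left.2.1.last_mem).2.1 hsx'.symm
    have h3 := ht.ne
    have h4 := ht.ne.symm
    rcases h1 with ⟨rfl, -⟩ | ⟨-, h1⟩
    · rcases h2 with ⟨-, h2⟩ | ⟨h2, -⟩
      · exact h4 h2
      · exact hpq h2
    · exact h3 h1
  rcases (ht.mem x).1 hx with hx | hx
  · exact key ht hx
  · exact key ht.symm hx

lemma Theta.exists_route (h : Theta G D R p l q p' l' q' s m s') (hG : ClawFree G)
    (hR : Remote G D R) : ∃ c, Route G p l q c ∧ (∀ v ∈ l' ++ m, c ≠ v ∧ ¬ G.Adj c v) ∧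
      (c ∈ l ∨ (l.length = 2 ∧ c ∉ D ∧ G.Adj c p ∧ G.Adj c q)) := by
  have h2 := h.two_le hG hR
  have h2' := h.symm.two_le hG hR
  have hm := h.two_le_connector
  obtain h3 | h3 : 3 ≤ l.length ∨ l.length = 2 := by omega
  · obtain ⟨c, k1, k2, k3, k4⟩ := Route.of_three h.par.1 h3
    refine ⟨c, k4, fun v hv => ?_, Or.inl k1⟩
    rcases List.mem_append.1 hv with hv | hv
    · obtain ⟨j1, j2⟩ := h.par.2.2 c k1 v hv
      exact ⟨j1, by tauto⟩
    · obtain ⟨j1, j2⟩ := h.par_left.2.2 c k1 v hv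
      exact ⟨j1, by tauto⟩
  · obtain ⟨c, hc1, hc2⟩ := h.exists_undominated hR (h.par_right.indCyc (by omega))
      (by simp [h.par_left.2.1.head_mem])
    simp only [nbd, Set.mem_ofPred_eq, not_or, not_exists, not_and, List.mem_append,
      List.mem_reverse] at hc2
    obtain ⟨⟨hcl, hcm⟩, hn⟩ := hc2
    obtain ⟨a, b, rfl⟩ := List.length_eq_two.1 h3
    obtain rfl : a = p := by simpa using h.par.1.2.1
    obtain rfl : b = q := by simpa using h.par.1.2.2
    have hca : c ≠ a := by
      rintro rfl
      exact hn s (Or.inr h.par_left.2.1.head_mem) h.adj_start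
    have hcb : c ≠ b := by
      rintro rfl
      exact hn s' (Or.inr h.par_left.2.1.last_mem) h.adj_finish
    have hcD : c ∉ D := by
      rw [h.mem]
      simp [hcl, hca, hcb]
    have hab : G.Adj c a ∧ G.Adj c b := by
      obtain hc1 | ⟨d, hd, hcd⟩ := hc1
      · exact absurd hc1 hcD
      · obtain ⟨e, he, hde, hce⟩ := hR.indCyc.exists_second hG hcD hd hcd
        have k1 : d = a ∨ d = b := by
          have := (h.mem d).1 hd
          simp only [List.mem_cons, List.not_mem_nil, or_false] at this
          exact this.resolve_right fun hd' => hn d (Or.inl hd') hcd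
        have k2 : e = a ∨ e = b := by
          have := (h.mem e).1 he
          simp only [List.mem_cons, List.not_mem_nil, or_false] at this
          exact this.resolve_right fun hd' => hn e (Or.inl hd') hce
        have hde' := hde.ne
        rcases k1 with rfl | rfl <;> rcases k2 with rfl | rfl
        · exact absurd rfl hde'
        · exact ⟨hcd, hce⟩
        · exact ⟨hce, hcd⟩
        · exact absurd rfl hde'
    refine ⟨c, Route.of_two h.par.1 h3 hab.1 hab.2, fun v hv => ?_, Or.inr ⟨h3, hcD, hab⟩⟩
    rw [List.mem_append] at hv
    refine ⟨?_, hn v hv⟩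
    rintro rfl
    exact hv.elim hcl hcm

lemma Theta.exists_route_connector (h : Theta G D R p l q p' l' q' s m s') (hG : ClawFree G)
    (hR : Remote G D R) : ∃ c, Route G s m s' c ∧ (∀ v ∈ D, c ≠ v ∧ ¬ G.Adj c v) ∧
      (c ∈ m ∨ c ∈ R) := by
  have hm := h.two_le_connector
  obtain h3 | h3 : 3 ≤ m.length ∨ m.length = 2 := by omega
  · obtain ⟨c, k1, k2, k3, k4⟩ := Route.of_three h.par_left.2.1 h3
    refine ⟨c, k4, fun v hv => ?_, Or.inl k1⟩
    rcases (h.mem v).1 hv with hv | hv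
    · obtain ⟨j1, j2⟩ := h.par_left.2.2 v hv c k1
      rw [G.adj_comm] at j2
      exact ⟨j1.symm, by tauto⟩
    · obtain ⟨j1, j2⟩ := h.par_right.2.2 v hv c k1
      rw [G.adj_comm] at j2
      exact ⟨j1.symm, by tauto⟩
  · obtain ⟨-, r, hr, hsr⟩ := h.start
    have hpD : p ∈ D := (h.mem p).2 (Or.inl h.par.1.head_mem)
    have hpq := h.par.1.ne_of_two_le (h.two_le hG hR)
    have hss : G.Adj s s' := by
      obtain ⟨a, b, rfl⟩ := List.length_eq_two.1 h3
      obtain rfl : a = s := by simpa using h.par_left.2.1.2.1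
      obtain rfl : b = s' := by simpa using h.par_left.2.1.2.2
      have := h.par_left.2.1.1.isChain
      simpa using this
    have hps' : ¬ G.Adj p s' := by
      rw [(h.par_left.2.2 p h.par.1.head_mem s' h.par_left.2.1.last_mem).2]
      have := h.ne.symm
      tauto
    have hrs' : G.Adj r s' := by
      rcases hG s r s' p hsr hss h.adj_start.symm with (h1 | h1) | (h1 | h1) | (h1 | h1)
      · exact absurd (h1 ▸ h.finish.1) (hR.notMem r hr)
      · exact h1
      · exact absurd (Or.inl (h1 ▸ hpD)) (hR.notMem r hr)
      · exact absurd h1 (hR.not_adj hr hpD)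
      · exact absurd (h1 ▸ hpD) (hR.fringe_notMem h.finish)
      · exact absurd h1.symm hps'
    refine ⟨r, Route.of_two h.par_left.2.1 h3 hsr.symm hrs', fun v hv => ?_, Or.inr hr⟩
    exact ⟨fun hrv => hR.notMem r hr (Or.inl (hrv ▸ hv)), hR.not_adj hr hv⟩

/-- If both arcs of the cycle are single edges, then the centres of their triangles are not
adjacent. -/
lemma Theta.not_adj_of_two (h : Theta G D R p l q p' l' q' s m s') (hG : ClawFree G)
    (hR : Remote G D R) {c c' : V} (hl : l.length = 2) (hl' : l'.length = 2)
    (hcm : ∀ v ∈ l' ++ m, c ≠ v ∧ ¬ G.Adj c v) (hcm' : ∀ v ∈ l ++ m, c' ≠ v ∧ ¬ G.Adj c' v)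
    (hcq : G.Adj c q) (hcp' : G.Adj c' p') : ¬ G.Adj c c' := by
  intro hcc
  have hm := h.two_le_connector
  have hpq := h.par.1.ne_of_two_le hl.ge
  have hpq' := h.par.2.1.ne_of_two_le hl'.ge
  obtain ⟨a, b, rfl⟩ := List.length_eq_two.1 hl
  obtain rfl : a = p := by simpa using h.par.1.2.1
  obtain rfl : b = q := by simpa using h.par.1.2.2
  obtain ⟨a', b', rfl⟩ := List.length_eq_two.1 hl'
  obtain rfl : a' = p' := by simpa using h.par.2.1.2.1
  obtain rfl : b' = q' := by simpa using h.par.2.1.2.2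
  have hba' : b ≠ a' ∧ ¬ G.Adj b a' := by
    have := h.par.2.2 b (by simp) a' (by simp)
    exact ⟨this.1, by tauto⟩
  have hab' : ¬ G.Adj a b' := by
    have := (h.par.2.2 a (by simp) b' (by simp)).2
    have := hpq'.symm
    tauto
  have hca' := hcm a' (by simp)
  have hcb := hcm' b (by simp)
  have hX : ISeg G b [b, c, c', a'] a' := by
    refine ISeg.append (l := [b, c]) (m := [c', a']) (ISeg.pair hcq.symm) (ISeg.pair hcp') ?_
    intro u hu v hv
    simp only [List.mem_cons, List.not_mem_nil, or_false] at hu hv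
    rcases hu with rfl | rfl <;> rcases hv with rfl | rfl
    · refine ⟨hcb.1.symm, ?_⟩
      rw [G.adj_comm]
      have := hcq.ne'
      tauto
    · have := hba'
      have := hcq.ne'
      tauto
    · exact ⟨hcc.ne, by tauto⟩
    · have := hcp'.ne'
      tauto
  have hcyc : IndCyc G (m ++ [b, c, c', a']) := by
    refine TwoArcs.indCyc (a := s) (b := s') (c := b) (d := a') ⟨h.par_left.2.1, hX, ?_⟩
      (by simp)
    intro u hu v hv
    simp only [List.mem_cons, List.not_mem_nil, or_false] at hv
    rcases hv with rfl | rfl | rfl | rfl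
    · obtain ⟨k1, k2⟩ := h.par_left.2.2 v (by simp) u hu
      refine ⟨k1.symm, ?_⟩
      rw [G.adj_comm, k2]
      have := hba'.1
      have := hpq.symm
      tauto
    · obtain ⟨k1, k2⟩ := hcm u (by simp [hu])
      rw [G.adj_comm] at k2
      refine ⟨k1.symm, ?_⟩
      have := hcq.ne
      have := hca'.1
      tauto
    · obtain ⟨k1, k2⟩ := hcm' u (by simp [hu])
      rw [G.adj_comm] at k2
      refine ⟨k1.symm, ?_⟩
      have := hcp'.ne
      have := hcb.1
      tauto
    · obtain ⟨k1, k2⟩ := h.par_right.2.2 v (by simp) u hu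
      refine ⟨k1.symm, ?_⟩
      rw [G.adj_comm, k2]
      have := hba'.1.symm
      tauto
  obtain ⟨w, hw1, hw2⟩ := h.exists_undominated hR hcyc (by simp [h.par_left.2.1.head_mem])
  simp only [nbd, Set.mem_ofPred_eq, not_or, not_exists, not_and, List.mem_append, List.mem_cons,
    List.not_mem_nil, or_false] at hw2
  obtain ⟨⟨hwm, hwb, hwc, hwc', hwa'⟩, hn⟩ := hw2
  have hmem : ∀ x ∈ D, x = a ∨ x = b ∨ x = a' ∨ x = b' := by
    intro x hx
    have := (h.mem x).1 hx
    simp only [List.mem_cons, List.not_mem_nil, or_false] at this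
    tauto
  have hD : w ∉ D := by
    intro hw
    rcases hmem w hw with rfl | rfl | rfl | rfl
    · exact hn s (Or.inl h.par_left.2.1.head_mem) h.adj_start
    · exact hwb rfl
    · exact hwa' rfl
    · exact hn s' (Or.inl h.par_left.2.1.last_mem) h.symm.adj_finish
  rcases hw1 with hw1 | ⟨d, hd, hwd⟩
  · exact hD hw1
  · obtain ⟨e, he, hde, hwe⟩ := hR.indCyc.exists_second hG hD hd hwd
    have hnb := hn b (by tauto)
    have hna := hn a' (by tauto)
    have h1 : d = a ∨ d = b' := by
      rcases hmem d hd with rfl | rfl | rfl | rfl <;> tauto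
    have h2 : e = a ∨ e = b' := by
      rcases hmem e he with rfl | rfl | rfl | rfl <;> tauto
    rcases h1 with rfl | rfl <;> rcases h2 with rfl | rfl
    · exact hde.ne rfl
    · exact hab' hde
    · exact hab' hde.symm
    · exact hde.ne rfl

/-- Two fringe vertices attached differently to the cycle yield a long induced path. -/
theorem Remote.exists_iSeg (hR : Remote G D R) (hG : ClawFree G) (hs : s ∈ fringe G D R)
    (hs' : s' ∈ fringe G D R) (hne : ¬ ∀ v ∈ D, G.Adj s v ↔ G.Adj s' v) {W : Set V}
    (hW : G.IsClique W) : ∃ a l b, ISeg G a l b ∧ a ∉ W ∧ b ∉ W ∧ 6 ≤ l.length := by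
  obtain ⟨p, l, q, p', l', q', m, h⟩ := hR.exists_theta hG hs hs' hne
  obtain ⟨c₁, k1, k2, k3⟩ := h.exists_route hG hR
  obtain ⟨c₂, j1, j2, j3⟩ := h.symm.exists_route hG hR
  obtain ⟨c₃, i1, i2, i3⟩ := h.exists_route_connector hG hR
  have key : ∀ {p l q p' l' q' c}, Theta G D R p l q p' l' q' s m s' →
      (∀ v ∈ l' ++ m, c ≠ v ∧ ¬ G.Adj c v) →
      (c ∈ l ∨ (l.length = 2 ∧ c ∉ D ∧ G.Adj c p ∧ G.Adj c q)) → c ≠ c₃ ∧ ¬ G.Adj c c₃ := by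
    intro p l q p' l' q' c h k2 k3
    have hl : ∀ v ∈ l, v ∈ D := fun v hv => (h.mem v).2 (Or.inl hv)
    rcases k3 with k3 | ⟨-, k4, k5, k6⟩
    · have := i2 c (hl c k3)
      rw [G.adj_comm]
      exact ⟨this.1.symm, this.2⟩
    · rcases i3 with i3 | i3
      · exact k2 c₃ (by simp [i3])
      · have hcN : c ∈ nbd G D := Or.inr ⟨p, hl p h.par.1.head_mem, k5⟩
        refine ⟨?_, fun hc => ?_⟩
        · rintro rfl
          exact hR.notMem c i3 hcN
        · have hcS : c ∈ fringe G D R := ⟨hcN, c₃, i3, hc⟩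
          have hcs := hR.adj_iff_of_adj hG hcS hs (hl p h.par.1.head_mem) k5 h.adj_start.symm
            q (hl q h.par.1.last_mem)
          have hqs := ((h.par_left.2.2 q h.par.1.last_mem s h.par_left.2.1.head_mem).2.1
            (hcs.1 k6).symm)
          have hpq := h.par.1.ne_of_two_le (h.two_le hG hR)
          rcases hqs with ⟨hqp, -⟩ | ⟨-, hss⟩
          · exact hpq hqp.symm
          · exact h.ne hss
  have hc₁₂ : c₁ ≠ c₂ ∧ ¬ G.Adj c₁ c₂ := by
    rcases k3 with k3 | ⟨k3, -, k4, k5⟩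
    · obtain ⟨e1, e2⟩ := j2 c₁ (by simp [k3])
      rw [G.adj_comm]
      exact ⟨e1.symm, e2⟩
    · rcases j3 with j3 | ⟨j3, -, j4, j5⟩
      · exact k2 c₂ (by simp [j3])
      · refine ⟨?_, h.not_adj_of_two hG hR k3 j3 k2 j2 k5 j4⟩
        rintro rfl
        exact (j2 p (by simp [h.par.1.head_mem])).2 k4
  refine exists_iSeg_avoiding_of_routes hW k1 j1 i1 h.par h.par_left h.par_right k2 j2
    (fun v hv => i2 v ?_) hc₁₂ (key h k2 k3) (key h.symm j2 j3)
  rw [h.mem]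
  simpa using hv

end Theta

universe u

section LongPaths

lemma three_le_card {V : Type*} [Finite V] {S : Set V} {a b c : V} (ha : a ∈ S) (hb : b ∈ S)
    (hc : c ∈ S) (hab : a ≠ b) (hac : a ≠ c) (hbc : b ≠ c) : 3 ≤ Nat.card S := by
  rw [Nat.card_coe_set_eq]
  exact (Set.two_lt_ncard_iff (Set.toFinite S)).2 ⟨a, b, c, ha, hb, hc, hab, hac, hbc⟩

lemma ISeg.of_induce {V : Type*} {G : SimpleGraph V} {S : Set V} {a b : S} {l : List S}
    (h : ISeg (G.induce S) a l b) : ISeg G a (l.map Subtype.val) b :=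
  ⟨h.1.of_induce, h.seg.of_induce.2⟩

lemma exists_remote {V : Type*} [Finite V] {G : SimpleGraph V} (hG : ClawFree G)
    (hG' : DiamondFree G) (hG2 : TwoConn G) (hH : ¬ HamL G) :
    ∃ D R, Remote G D R ∧ R.Nonempty ∧ (fringe G D R).Nonempty ∧
      ∀ r ∈ R, ∀ v ∉ R, G.Adj r v → v ∈ fringe G D R := by
  obtain ⟨D₀, hD₀⟩ := exists_indCyc hG2 hG' hH
  obtain ⟨N, ⟨D, hD, rfl⟩, hmax⟩ := (Set.toFinite {N : Set V | ∃ D, IndCyc G D ∧ N = nbd G D})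
    |>.exists_maximal ⟨_, D₀, hD₀, rfl⟩
  obtain ⟨r₀, hr₀⟩ : ∃ r, r ∉ nbd G D := by
    by_contra! hc
    exact hH (hD.hamL_of_dominating hG hG' fun w hw => (hc w).resolve_left hw)
  let rel : V → V → Prop := fun a b => G.Adj a b ∧ a ∉ nbd G D ∧ b ∉ nbd G D
  let R : Set V := {v | Relation.ReflTransGen rel r₀ v}
  have hRN : ∀ r ∈ R, r ∉ nbd G D := by
    intro r hr
    rcases Relation.ReflTransGen.cases_tail hr with rfl | ⟨c, -, hc⟩
    · exact hr₀
    · exact hc.2.2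
  have hsym : Std.Symm (fun a b => G.Adj a b ∧ a ∈ R ∧ b ∈ R) :=
    ⟨fun a b h => ⟨h.1.symm, h.2.2, h.2.1⟩⟩
  have hconn : ∀ r ∈ R, Relation.ReflTransGen (fun a b => G.Adj a b ∧ a ∈ R ∧ b ∈ R) r₀ r := by
    intro r hr
    induction hr with
    | refl => exact Relation.ReflTransGen.refl
    | tail h1 h2 ih => exact ih.tail ⟨h2.1, h1, h1.tail h2⟩
  have hexit : ∀ r ∈ R, ∀ v ∉ R, G.Adj r v → v ∈ fringe G D R := by
    intro r hr v hv hrv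
    refine ⟨?_, r, hr, hrv.symm⟩
    by_contra hvN
    exact hv (Relation.ReflTransGen.tail hr ⟨hrv, hRN r hr, hvN⟩)
  have hr₀R : r₀ ∈ R := Relation.ReflTransGen.refl
  refine ⟨D, R, ⟨hD, fun D' hD' h => hmax ⟨D', hD', rfl⟩ h, hRN, fun r hr r' hr' => ?_⟩,
    ⟨r₀, hr₀R⟩, ?_, hexit⟩
  · exact (Std.Symm.symm _ _ (hconn r hr)).trans (hconn r' hr')
  · obtain ⟨d, hd⟩ := List.exists_mem_of_ne_nil D (by rintro rfl; simpa using hD.1)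
    obtain ⟨a, b, h1, h2, h3⟩ := exists_exit (hG2.connected r₀ d) hr₀R
      (fun hdR => hRN d hdR (Or.inl hd))
    exact ⟨b, hexit a h1 b h2 h3⟩

/-- A nonhamiltonian closed graph contains a long induced path with ends outside a given clique. -/
theorem exists_iSeg_of_not_hamL {V : Type u} [Finite V] {G : SimpleGraph V} (hG : ClawFree G)
    (hG' : DiamondFree G) (hG2 : TwoConn G) (hH : ¬ HamL G) {W : Set V} (hW : G.IsClique W) :
    ∃ a l b, ISeg G a l b ∧ a ∉ W ∧ b ∉ W ∧ 6 ≤ l.length := by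
  induction hN : Nat.card V using Nat.strong_induction_on generalizing V with
  | _ N ih =>
  subst hN
  have lift : ∀ (S : Set V) (x : V), x ∉ S → TwoConn (G.induce S) → ¬ HamL (G.induce S) →
      ∃ a l b, ISeg G a l b ∧ a ∉ W ∧ b ∉ W ∧ 6 ≤ l.length := by
    intro S x hx h1 h2
    obtain ⟨a, l, b, k1, k2, k3, k4⟩ := ih (Nat.card S) (Finite.card_subtype_lt hx)
      (hG.induce S) (hG'.induce S) h1 h2 (W := Subtype.val ⁻¹' W)
      (fun a ha b hb hab => hW ha hb fun h => hab (Subtype.ext h)) rfl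
    exact ⟨a, _, b, k1.of_induce, k2, k3, by simpa using k4⟩
  obtain ⟨D, R, hR, ⟨r₀, hr₀⟩, ⟨s₀, hs₀⟩, hexit⟩ := exists_remote hG hG' hG2 hH
  by_cases hsame : ∃ s ∈ fringe G D R, ¬ ∀ v ∈ D, G.Adj s₀ v ↔ G.Adj s v
  · obtain ⟨s, hs, hne⟩ := hsame
    exact hR.exists_iSeg hG hs₀ hs hne hW
  push Not at hsame
  obtain ⟨d, hd, e, he, hde, hatt⟩ := hR.exists_attachment hG hs₀
  have hSd : ∀ s ∈ fringe G D R, G.Adj s d := fun s hs =>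
    (hsame s hs d hd).1 ((hatt d hd).2 (Or.inl rfl))
  have hSe : ∀ s ∈ fringe G D R, G.Adj s e := fun s hs =>
    (hsame s hs e he).1 ((hatt e he).2 (Or.inr rfl))
  let A : Set V := R ∪ fringe G D R
  let B : Set V := {v | v ∉ A ∧ ∃ s ∈ fringe G D R, G.Adj s v}
  have hDA : ∀ v ∈ D, v ∉ A := by
    rintro v hv (h | h)
    · exact hR.notMem v h (Or.inl hv)
    · exact hR.fringe_notMem h hv
  have hBD : ∀ v ∈ B, ∀ w ∈ D, (∀ s ∈ fringe G D R, G.Adj s w) → v = w ∨ G.Adj v w := by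
    rintro v ⟨hvA, s, hs, hsv⟩ w hw hall
    obtain ⟨-, r, hr, hsr⟩ := id hs
    rcases hG s r v w hsr hsv (hall s hs) with (h1 | h1) | (h1 | h1) | h1
    · exact absurd (Or.inl (h1 ▸ hr)) hvA
    · refine absurd ?_ hvA
      by_cases hvR : v ∈ R
      · exact Or.inl hvR
      · exact Or.inr (hexit r hr v hvR h1)
    · exact absurd (Or.inl (h1 ▸ hw)) (hR.notMem r hr)
    · exact absurd h1 (hR.not_adj hr hw)
    · exact h1
  have hSB : ∀ s ∈ fringe G D R, ∀ v ∈ B, G.Adj s v := by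
    intro s hs v hv
    rcases hBD v hv d hd hSd with rfl | hvd
    · exact hSd s hs
    rcases hBD v hv e he hSe with rfl | hve
    · exact hSe s hs
    rcases hG' d s e v (hSd s hs).symm hde hvd.symm (hSe s hs) hve.symm with rfl | h
    · exact absurd (Or.inr hs) hv.1
    · exact h
  have hK : G.IsClique (fringe G D R ∪ B) := by
    rintro x (hx | hx) y (hy | hy) hxy
    · exact (hG' d x e y (hSd x hx).symm
        hde (hSd y hy).symm (hSe x hx) (hSe y hy).symm).resolve_left
        hxy
    · exact hSB x hx y hy
    · exact (hSB y hy x hx).symm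
    · rcases hBD x hx d hd hSd with rfl | hxd
      · exact ((hBD y hy x hd hSd).resolve_left hxy.symm).symm
      rcases hBD y hy d hd hSd with rfl | hyd
      · exact hxd
      exact (hG' s₀ x d y (hSB s₀ hs₀ x hx) (hSd s₀ hs₀) (hSB s₀ hs₀ y hy) hxd
        hyd.symm).resolve_left hxy
  have hcut : ∀ u ∈ A, ∀ v ∉ A, G.Adj u v → u ∈ fringe G D R ∪ B ∧ v ∈ fringe G D R ∪ B := by
    rintro u (hu | hu) v hv huv
    · exact absurd (Or.inr (hexit u hu v (fun h => hv (Or.inl h)) huv)) hv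
    · exact ⟨Or.inl hu, Or.inr ⟨hv, u, hu, huv⟩⟩
  have hs₀A : s₀ ∈ A := Or.inr hs₀
  have hdB : d ∈ B := ⟨hDA d hd, s₀, hs₀, hSd s₀ hs₀⟩
  have hrs : r₀ ≠ s₀ := fun h => hR.notMem r₀ hr₀ (h ▸ hs₀.1)
  have hrA : r₀ ∈ A := Or.inl hr₀
  have hed : e ∉ insert d A := by
    rintro (h | h)
    · exact hde.ne h.symm
    · exact hDA e he h
  have hrn : r₀ ∉ insert s₀ Aᶜ := by
    rintro (h | h)
    · exact hrs h
    · exact h hrA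
  have h1 : TwoConn (G.induce (insert d A)) :=
    hG2.induce (hDA d hd) (Or.inr hdB) hs₀A (Or.inl hs₀) hK hcut
      (three_le_card (Or.inr hrA) (Or.inr hs₀A) (Or.inl rfl) hrs
        (fun h => hDA d hd (h ▸ hrA)) (hSd s₀ hs₀).ne)
  have h2 : TwoConn (G.induce (insert s₀ Aᶜ)) :=
    hG2.induce (A := Aᶜ) (fun h => h hs₀A) (Or.inl hs₀) (hDA d hd) (Or.inr hdB) hK
      (fun u hu v hv huv => (hcut v (not_not.1 hv) u hu huv.symm).symm)
      (three_le_card (Or.inr (hDA d hd)) (Or.inr (hDA e he)) (Or.inl rfl) hde.ne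
        (hSd s₀ hs₀).ne' (hSe s₀ hs₀).ne')
  by_cases k1 : HamL (G.induce (insert d A))
  · by_cases k2 : HamL (G.induce (insert s₀ Aᶜ))
    · exact absurd (hamL_of_cut hs₀A (hDA d hd) hK hcut k1 k2) hH
    · exact lift _ r₀ hrn h2 k2
  · exact lift _ e hed h1 k1

end LongPaths

section PullBack

variable {V : Type*} {G H : SimpleGraph V}

lemma IndPath.congr {l : List V} (h : IndPath H l)
    (hl : ∀ u ∈ l, ∀ v ∈ l, G.Adj u v ↔ H.Adj u v) : IndPath G l := by
  induction l with
  | nil => exact indPath_nil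
  | cons a l ih =>
    refine indPath_cons.2 ⟨fun v hv => ?_, ih h.2 fun u hu v hv => hl u (by simp [hu]) v
      (by simp [hv])⟩
    rw [hl a (by simp) v (by simp [hv])]
    exact h.1 v hv

lemma IndPath.of_isChain {l : List V} (h : IndPath H l) (hGH : G ≤ H) (hl : l.IsChain G.Adj) :
    IndPath G l := by
  induction l with
  | nil => exact indPath_nil
  | cons a l ih =>
    refine indPath_cons.2 ⟨fun v hv => ⟨(h.1 v hv).1, fun hav => (h.1 v hv).2.1 (hGH hav), ?_⟩,
      ih h.2 hl.tail⟩
    intro hlv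
    obtain _ | ⟨b, l⟩ := l
    · simp at hv
    · obtain rfl : b = v := by simpa using hlv
      exact (List.isChain_cons_cons.1 hl).1

lemma IndPath.not_triangle {l : List V} (h : IndPath G l) {u v w : V} (hu : u ∈ l) (hv : v ∈ l)
    (hw : w ∈ l) (huv : G.Adj u v) (huw : G.Adj u w) (hvw : G.Adj v w) : False := by
  obtain ⟨i, hi, rfl⟩ := List.getElem_of_mem hu
  obtain ⟨j, hj, rfl⟩ := List.getElem_of_mem hv
  obtain ⟨k, hk, rfl⟩ := List.getElem_of_mem hw
  rw [h.adj_getElem] at huv huw hvw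
  omega

/-- An induced path of `comp G x` either is an induced path of `G` or becomes one by inserting
`x`. -/
lemma IndPath.of_comp {x : V} {l : List V} (h : IndPath (comp G x) l) :
    IndPath G l ∨ ∃ A B c d, l = A ++ B ∧ A.getLast? = some c ∧ B.head? = some d ∧ c ≠ d ∧
      (comp G x).Adj c d ∧ G.Adj x c ∧ G.Adj x d ∧ IndPath G (A ++ ([x] ++ B)) := by
  by_cases hl : l.IsChain G.Adj
  · exact Or.inl (h.of_isChain (le_comp G x) hl)
  right
  rw [List.isChain_iff_forall_rel_of_append_cons_cons] at hl
  push Not at hl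
  obtain ⟨c, d, A, B, rfl, hcd⟩ := hl
  rw [show A ++ c :: d :: B = (A ++ [c]) ++ (d :: B) by simp] at h ⊢
  have hcd' : (comp G x).Adj c d := by
    have := (indPath_append.1 h).2.2 c (by simp) d (by simp)
    exact this.2.2 (by simp)
  obtain ⟨hne, hxc, hxd⟩ := (comp_adj.1 hcd').resolve_left hcd
  have hc : c ∈ (A ++ [c]) ++ (d :: B) := by simp
  have hd : d ∈ (A ++ [c]) ++ (d :: B) := by simp
  have hx : x ∉ (A ++ [c]) ++ (d :: B) := fun hx =>
    h.not_triangle hx hc hd (le_comp G x hxc) (le_comp G x hxd) hcd'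
  have huniq : ∀ v ∈ (A ++ [c]) ++ (d :: B), G.Adj x v → v = c ∨ v = d := by
    intro v hv hxv
    by_contra! hn
    exact h.not_triangle hv hc hd (comp_adj.2 (Or.inr ⟨hn.1, hxv, hxc⟩))
      (comp_adj.2 (Or.inr ⟨hn.2, hxv, hxd⟩)) hcd'
  have hdis : ∀ u ∈ A ++ [c], u ∉ d :: B := fun u hu hu' =>
    ((indPath_append.1 h).2.2 u hu u hu').1 rfl
  have hdA : d ∉ A ++ [c] := fun hdA => hdis d hdA (by simp)
  have hcB : c ∉ d :: B := hdis c (by simp)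
  refine ⟨A ++ [c], d :: B, c, d, rfl, by simp, by simp, hne, hcd', hxc, hxd, ?_⟩
  have hA : IndPath G (A ++ [c]) := h.left.congr fun u hu v hv => by
    rw [comp_adj]
    refine ⟨Or.inl, ?_⟩
    rintro (h1 | ⟨h1, h2, h3⟩)
    · exact h1
    · obtain rfl := (huniq u (by simp only [List.mem_append] at hu ⊢; tauto) h2).resolve_right
        fun h => hdA (h ▸ hu)
      obtain rfl := (huniq v (by simp only [List.mem_append] at hv ⊢; tauto) h3).resolve_right
        fun h => hdA (h ▸ hv)
      exact absurd rfl h1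
  have hB : IndPath G (d :: B) := h.right.congr fun u hu v hv => by
    rw [comp_adj]
    refine ⟨Or.inl, ?_⟩
    rintro (h1 | ⟨h1, h2, h3⟩)
    · exact h1
    · obtain rfl := (huniq u (List.mem_append_right _ hu) h2).resolve_left
        fun h => hcB (h ▸ hu)
      obtain rfl := (huniq v (List.mem_append_right _ hv) h3).resolve_left
        fun h => hcB (h ▸ hv)
      exact absurd rfl h1
  refine indPath_append.2 ⟨hA, indPath_append.2 ⟨indPath_singleton x, hB, ?_⟩, ?_⟩
  · intro u hu v hv
    obtain rfl := List.mem_singleton.1 hu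
    refine ⟨fun h => hx (List.mem_append_right _ (h ▸ hv)), ?_⟩
    simp only [List.getLast?_singleton, List.head?_cons, Option.some_inj, true_and]
    refine ⟨fun h1 => ((huniq v (List.mem_append_right _ hv) h1).resolve_left
      fun h => hcB (h ▸ hv)).symm, ?_⟩
    rintro rfl
    exact hxd
  · intro u hu v hv
    have hu' : u ∈ A ++ [c] ++ d :: B := List.mem_append_left _ hu
    rcases List.mem_append.1 hv with hv | hv
    · obtain rfl := List.mem_singleton.1 hv
      refine ⟨fun h => hx (h ▸ hu'), ?_⟩
      rw [G.adj_comm]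
      simp only [List.getLast?_append, List.getLast?_singleton, List.head?_append, List.head?_cons,
        Option.some_or, Option.some_inj, and_true]
      refine ⟨fun h1 => ((huniq u hu' h1).resolve_right fun h => hdA (h ▸ hu)).symm, ?_⟩
      rintro rfl
      exact hxc
    · obtain ⟨h1, h2⟩ := (indPath_append.1 h).2.2 u hu v hv
      refine ⟨h1, ?_⟩
      have hvx : x ≠ v := fun h => hx (List.mem_append_right _ (h ▸ hv))
      simp only [List.getLast?_append, List.getLast?_singleton, List.head?_append, List.head?_cons,
        Option.some_or, Option.some_inj] at h2 ⊢
      refine ⟨fun h3 => ?_, fun h3 => absurd h3.2 hvx⟩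
      obtain ⟨rfl, rfl⟩ := h2.1 (le_comp G x h3)
      exact absurd h3 hcd

/-- A nonempty list with ends outside `K` and no two consecutive entries in `K`. -/
def Flank (K : Set V) (l : List V) : Prop :=
  l ≠ [] ∧ (∀ x ∈ l.head?, x ∉ K) ∧ (∀ x ∈ l.getLast?, x ∉ K) ∧
    l.IsChain fun u v => u ∉ K ∨ v ∉ K

lemma Flank.reverse {K : Set V} {l : List V} (h : Flank K l) : Flank K l.reverse := by
  refine ⟨by simpa using h.1, by simpa using h.2.2.1, by simpa using h.2.1, ?_⟩
  rw [List.isChain_reverse]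
  exact h.2.2.2.imp fun _ _ h => h.symm

lemma Flank.snoc {K : Set V} {l : List V} {x : V} (h : Flank K l) (hx : x ∉ K) :
    Flank K (l ++ [x]) := by
  refine ⟨by simp, ?_, by simpa using hx, ?_⟩
  · obtain _ | ⟨a, l⟩ := l
    · exact absurd rfl h.1
    · simpa using h.2.1
  · refine List.isChain_append.2 ⟨h.2.2.2, by simp, fun u _ v hv => Or.inr ?_⟩
    obtain rfl : x = v := by simpa using hv
    exact hx

lemma Flank.insert {K : Set V} {A B : List V} {x c d : V} (h : Flank K (A ++ B))
    (hA : A.getLast? = some c) (hB : B.head? = some d) (hx : x ∈ K → c ∉ K ∧ d ∉ K) :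
    Flank K (A ++ ([x] ++ B)) := by
  obtain ⟨h1, h2, h3, h4⟩ := h
  obtain ⟨k1, k2, -⟩ := List.isChain_append.1 h4
  have hA' : A ≠ [] := by rintro rfl; simp at hA
  have hB' : B ≠ [] := by rintro rfl; simp at hB
  refine ⟨by simp, ?_, ?_, ?_⟩
  · rwa [List.head?_append_of_ne_nil _ hA'] at h2 ⊢
  · rw [List.getLast?_append_of_ne_nil _ hB'] at h3
    rwa [List.getLast?_append_of_ne_nil _ (by simp), List.getLast?_append_of_ne_nil _ hB']
  · refine List.isChain_append.2 ⟨k1, List.isChain_append.2 ⟨by simp, k2, ?_⟩, ?_⟩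
    · intro u hu v hv
      obtain rfl : x = u := by simpa using hu
      rw [hB] at hv
      obtain rfl : d = v := by simpa using hv
      tauto
    · intro u hu v hv
      rw [hA] at hu
      obtain rfl : c = u := by simpa using hu
      obtain rfl : x = v := by simpa using hv
      tauto

/-- An induced path whose middle part lies in `K`, and whose outer parts consist of vertices of
degree less than half the order and are flanks. -/
def Framed (G : SimpleGraph V) (K : Set V) (L M R : List V) : Prop :=
  IndPath G (L ++ (M ++ R)) ∧ (∀ v ∈ M, v ∈ K) ∧ 2 ≤ M.length ∧ Flank K L ∧ Flank K R ∧
    4 ≤ L.length + R.length ∧ ∀ v, v ∈ L ∨ v ∈ R → 2 * dg G v < Nat.card V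

lemma Framed.of_comp [Finite V] {K : Set V} {x : V} {L M R : List V}
    (h : Framed (comp G x) K L M R) (hle : comp G x ≤ H)
    (hK : ∀ x c d, c ∈ K → d ∈ K → c ≠ d → H.Adj x c → H.Adj x d → x ∈ K) :
    ∃ L' M' R', Framed G K L' M' R' := by
  obtain ⟨h1, h2, h3, h4, h5, h6, h7⟩ := h
  have hM : M ≠ [] := by rintro rfl; simp at h3
  have h7' : ∀ v, v ∈ L ∨ v ∈ R → 2 * dg G v < Nat.card V := fun v hv =>
    lt_of_le_of_lt (Nat.mul_le_mul_left 2 (dg_mono (le_comp G x) v)) (h7 v hv)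
  obtain h8 | ⟨A, B, c, d, hl, hA, hB, hcd, hcd', hxc, hxd, hP⟩ := h1.of_comp
  · exact ⟨L, M, R, h8, h2, h3, h4, h5, h6, h7'⟩
  have hcA : c ∈ A := List.mem_of_getLast? hA
  have hdB : d ∈ B := List.mem_of_head? hB
  have hcH := hle (le_comp G x hxc)
  have hdH := hle (le_comp G x hxd)
  have hcdH := hle hcd'
  have hlc : c ∈ L ∨ c ∈ R → 2 * dg G x < Nat.card V := fun hc =>
    lt_of_le_of_lt (Nat.mul_le_mul_left 2 (dg_le_comp hxc)) (h7 c hc)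
  have hld : d ∈ L ∨ d ∈ R → 2 * dg G x < Nat.card V := fun hd =>
    lt_of_le_of_lt (Nat.mul_le_mul_left 2 (dg_le_comp hxd)) (h7 d hd)
  have hcK : x ∈ K → c ∈ K → d ∈ K := fun hx hc =>
    hK d x c hx hc hcH.ne hdH.symm hcdH.symm
  have hdK : x ∈ K → d ∈ K → c ∈ K := fun hx hd =>
    hK c x d hx hd hdH.ne hcH.symm hcdH
  have hxK : c ∈ K → d ∈ K → x ∈ K := fun hc hd => hK x c d hc hd hcd hcH hdH
  have mid : ∀ {l A' B' : List V}, Flank K l → l = A' ++ B' → A'.getLast? = some c →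
      B'.head? = some d → Flank K (A' ++ ([x] ++ B')) := by
    rintro l A' B' hl rfl hA' hB'
    refine hl.insert hA' hB' fun hx => ?_
    have := (List.isChain_append.1 hl.2.2.2).2.2 c (by simp [hA']) d (by simp [hB'])
    tauto
  have hlast : ∀ {l A' : List V}, l ≠ [] → (A' ++ l).getLast? = some c → l.getLast? = some c := by
    intro l A' hl h
    rwa [List.getLast?_append_of_ne_nil _ hl] at h
  have hhead : ∀ {l B' : List V}, l ≠ [] → (l ++ B').head? = some d → l.head? = some d := by
    intro l B' hl h
    rwa [List.head?_append_of_ne_nil _ hl] at h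
  rcases List.append_eq_append_iff.1 hl with ⟨A2, rfl, hB2⟩ | ⟨L2, rfl, rfl⟩
  · rcases List.append_eq_append_iff.1 hB2 with ⟨A3, rfl, rfl⟩ | ⟨M2, rfl, rfl⟩
    · obtain rfl | hA3 := eq_or_ne A3 []
      · have hc := h2 c (List.mem_of_getLast? (hlast hM (by simpa using hA)))
        have hd : d ∉ K := h5.2.1 d (by simpa using hB)
        have hxl := hld (Or.inr (by simpa using hdB))
        have hR : Flank K ([x] ++ B) := by
          have := (h5.reverse.snoc fun hx => hd (hcK hx hc)).reverse
          simpa using this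
        refine ⟨L, M, [x] ++ B, by simpa using hP, h2, h3, h4, hR, by simp at h6 ⊢; omega, ?_⟩
        intro v hv
        simp only [List.mem_append, List.mem_singleton] at hv
        rcases hv with hv | rfl | hv
        · exact h7' v (Or.inl hv)
        · exact hxl
        · exact h7' v (Or.inr (by simpa using hv))
      · have hA' := hlast hA3 (by simpa using hA : ((L ++ M) ++ A3).getLast? = some c)
        have hxl := hlc (Or.inr (by simp [List.mem_of_getLast? hA']))
        refine ⟨L, M, A3 ++ ([x] ++ B), by simpa using hP, h2, h3, h4, mid h5 rfl hA' hB,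
          by simp at h6 ⊢; omega, ?_⟩
        intro v hv
        simp only [List.mem_append, List.mem_singleton] at hv
        rcases hv with hv | hv | rfl | hv
        · exact h7' v (Or.inl hv)
        · exact h7' v (Or.inr (by simp [hv]))
        · exact hxl
        · exact h7' v (Or.inr (by simp [hv]))
    · obtain rfl | hA2 := eq_or_ne A2 []
      · have hc : c ∉ K := h4.2.2.1 c (by simpa using hA)
        have hxl := hlc (Or.inl (by simpa using hcA))
        obtain rfl | hM2 := eq_or_ne M2 []
        · exact absurd rfl hM
        have hd := h2 d (by simp [List.mem_of_head? (hhead hM2 hB)])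
        refine ⟨L ++ [x], M2, R, by simpa using hP, by simpa using h2, by simpa using h3,
          h4.snoc fun hx => hc (hdK hx hd), h5, by simp at h6 ⊢; omega, ?_⟩
        intro v hv
        simp only [List.mem_append, List.mem_singleton] at hv
        rcases hv with (hv | rfl) | hv
        · exact h7' v (Or.inl hv)
        · exact hxl
        · exact h7' v (Or.inr hv)
      · have hc := h2 c (by simp [List.mem_of_getLast? (hlast hA2 hA)])
        obtain rfl | hM2 := eq_or_ne M2 []
        · have hd : d ∉ K := h5.2.1 d (by simpa using hB)
          have hxl := hld (Or.inr (by simpa using hdB))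
          have hR : Flank K ([x] ++ R) := by
            have := (h5.reverse.snoc fun hx => hd (hcK hx hc)).reverse
            simpa using this
          refine ⟨L, A2, [x] ++ R, by simpa using hP, by simpa using h2, by simpa using h3, h4, hR,
            by simp at h6 ⊢; omega, ?_⟩
          intro v hv
          simp only [List.mem_append, List.mem_singleton] at hv
          rcases hv with hv | rfl | hv
          · exact h7' v (Or.inl hv)
          · exact hxl
          · exact h7' v (Or.inr hv)
        · have hd := h2 d (by simp [List.mem_of_head? (hhead hM2 hB)])
          refine ⟨L, A2 ++ ([x] ++ M2), R, by simpa using hP, ?_,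
            by simp at h3 ⊢; omega, h4, h5, h6, h7'⟩
          intro v hv
          simp only [List.mem_append, List.mem_singleton] at hv
          rcases hv with hv | rfl | hv
          · exact h2 v (by simp [hv])
          · exact hxK hc hd
          · exact h2 v (by simp [hv])
  · obtain rfl | hL2 := eq_or_ne L2 []
    · have hc : c ∉ K := h4.2.2.1 c (by simpa using hA)
      have hxl := hlc (Or.inl (by simpa using hcA))
      have hd := h2 d (List.mem_of_head? (hhead hM (by simpa using hB)))
      refine ⟨A ++ [x], M, R, by simpa using hP, h2, h3, ?_, h5, by simp at h6 ⊢; omega, ?_⟩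
      · have := h4.snoc fun hx => hc (hdK hx hd)
        simpa using this
      intro v hv
      simp only [List.mem_append, List.mem_singleton] at hv
      rcases hv with (hv | rfl) | hv
      · exact h7' v (Or.inl (by simp [hv]))
      · exact hxl
      · exact h7' v (Or.inr hv)
    · have hB' := hhead hL2 hB
      have hxl := hlc (Or.inl (by simp [hcA]))
      refine ⟨A ++ ([x] ++ L2), M, R, by simpa using hP, h2, h3, mid h4 rfl hA hB', h5,
        by simp at h6 ⊢; omega, ?_⟩
      intro v hv
      simp only [List.mem_append, List.mem_singleton] at hv
      rcases hv with (hv | rfl | hv) | hv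
      · exact h7' v (Or.inl (by simp [hv]))
      · exact hxl
      · exact h7' v (Or.inl (by simp [hv]))
      · exact h7' v (Or.inr hv)

lemma le_of_reflTransGen_step (h : Relation.ReflTransGen Step G H) : G ≤ H := by
  induction h with
  | refl => exact le_rfl
  | tail _ h ih =>
    obtain ⟨x, -, rfl⟩ := h
    exact ih.trans (le_comp _ x)

lemma Framed.of_step [Finite V] {K : Set V} {L M R : List V}
    (hGH : Relation.ReflTransGen Step G H) (h : Framed H K L M R)
    (hK : ∀ x c d, c ∈ K → d ∈ K → c ≠ d → H.Adj x c → H.Adj x d → x ∈ K) :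
    ∃ L' M' R', Framed G K L' M' R' := by
  induction hGH using Relation.ReflTransGen.head_induction_on with
  | refl => exact ⟨L, M, R, h⟩
  | head h1 h2 ih =>
    obtain ⟨x, -, rfl⟩ := h1
    obtain ⟨L', M', R', h'⟩ := ih
    exact h'.of_comp (le_of_reflTransGen_step h2) hK

end PullBack

section Hamiltonicity

variable {V : Type*} {G H : SimpleGraph V}

lemma Flank.of_disjoint {K : Set V} {l : List V} (hl : l ≠ []) (h : ∀ v ∈ l, v ∉ K) :
    Flank K l := by
  refine ⟨hl, fun x hx => h x (List.mem_of_head? hx), fun x hx => h x (List.mem_of_getLast? hx),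
    ?_⟩
  rw [List.isChain_iff_forall_rel_of_append_cons_cons]
  rintro a b l₁ l₂ rfl
  exact Or.inl (h a (by simp))

lemma DiamondFree.mem_of_adj_of_adj (hG : DiamondFree G) {a b : V} (hab : G.Adj a b) {K : Set V}
    (hK : K = {v | v = a ∨ v = b ∨ (G.Adj a v ∧ G.Adj b v)}) {x c d : V} (hc : c ∈ K)
    (hd : d ∈ K) (hcd : c ≠ d) (hxc : G.Adj x c) (hxd : G.Adj x d) : x ∈ K := by
  subst hK
  have hadj : G.Adj c d := by
    rcases hc with rfl | rfl | hc <;> rcases hd with rfl | rfl | hd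
    · exact absurd rfl hcd
    · exact hab
    · exact hd.1
    · exact hab.symm
    · exact absurd rfl hcd
    · exact hd.2
    · exact hc.1.symm
    · exact hc.2.symm
    · exact (hG a c b d hc.1 hab hd.1 hc.2.symm hd.2).resolve_left hcd
  have key : ∀ y, (c = y ∨ G.Adj c y) → (d = y ∨ G.Adj d y) → x = y ∨ G.Adj x y := by
    rintro y (rfl | hcy) (rfl | hdy)
    · exact Or.inr hxc
    · exact Or.inr hxc
    · exact Or.inr hxd
    · exact hG c x d y hxc.symm hadj hcy hxd hdy
  have ha : ∀ c, (c = a ∨ c = b ∨ (G.Adj a c ∧ G.Adj b c)) →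
      (c = a ∨ G.Adj c a) ∧ (c = b ∨ G.Adj c b) := by
    rintro c (rfl | rfl | ⟨h1, h2⟩)
    · exact ⟨Or.inl rfl, Or.inr hab⟩
    · exact ⟨Or.inr hab.symm, Or.inl rfl⟩
    · exact ⟨Or.inr h1.symm, Or.inr h2.symm⟩
  have h1 := key a (ha c hc).1 (ha d hd).1
  have h2 := key b (ha c hc).2 (ha d hd).2
  rcases h1 with h1 | h1
  · exact Or.inl h1
  · rcases h2 with h2 | h2
    · exact Or.inr (Or.inl h2)
    · exact Or.inr (Or.inr ⟨h1.symm, h2.symm⟩)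

/-- If the vertices of degree at least half the order form a clique, then a long induced path with
ends of small degree is framed by the clique through one of its edges. -/
lemma ISeg.exists_framed {a b : V} {l : List V} (h : ISeg G a l b) (h6 : 6 ≤ l.length)
    (hW : G.IsClique {v | Nat.card V ≤ 2 * dg G v}) (ha : 2 * dg G a < Nat.card V)
    (hb : 2 * dg G b < Nat.card V) :
    ∃ c d L R, G.Adj c d ∧
      Framed G {v | v = c ∨ v = d ∨ (G.Adj c v ∧ G.Adj d v)} L [c, d] R := by
  obtain ⟨h1, h2, h3⟩ := h
  rw [List.head?_eq_getElem?, List.getElem?_eq_getElem (by omega), Option.some_inj] at h2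
  rw [List.getLast?_eq_getElem?, List.getElem?_eq_getElem (by omega), Option.some_inj] at h3
  have hheavy : ∀ i j (hi : i < l.length) (hj : j < l.length), i ≠ j →
      Nat.card V ≤ 2 * dg G l[i] → Nat.card V ≤ 2 * dg G l[j] → i + 1 = j ∨ j + 1 = i := by
    intro i j hi hj hij hhi hhj
    rw [← h1.adj_getElem hi hj]
    exact hW hhi hhj (by rwa [Ne, h1.nodup.getElem_inj_iff])
  have h0 : ∀ j (hj : j < l.length), Nat.card V ≤ 2 * dg G l[j] → 1 ≤ j ∧ j + 2 ≤ l.length := by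
    intro j hj hhj
    have n1 : j ≠ 0 := by
      rintro rfl
      rw [h2] at hhj
      omega
    have n2 : j ≠ l.length - 1 := by
      rintro rfl
      rw [h3] at hhj
      omega
    omega
  obtain ⟨i, hi1, hi2, hi⟩ : ∃ i, 1 ≤ i ∧ i + 2 < l.length ∧ ∀ j (hj : j < l.length),
      Nat.card V ≤ 2 * dg G l[j] → j = i ∨ j = i + 1 := by
    by_cases hex : ∃ i, ∃ hi : i < l.length, Nat.card V ≤ 2 * dg G l[i]
    · obtain ⟨i, hi, hhi⟩ := hex
      have := h0 i hi hhi
      by_cases hprev : Nat.card V ≤ 2 * dg G l[i - 1] ∨ i + 2 = l.length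
      · refine ⟨i - 1, ?_, by omega, fun j hj hhj => ?_⟩
        · rcases hprev with hprev | hprev
          · exact (h0 _ _ hprev).1
          · omega
        · by_cases hij : j = i
          · omega
          have := hheavy i j hi hj (Ne.symm hij) hhi hhj
          have := h0 j hj hhj
          rcases hprev with hprev | hprev
          · by_cases hij' : j = i - 1
            · omega
            have := hheavy (i - 1) j (by omega) hj (Ne.symm hij') hprev hhj
            omega
          · omega
      · push Not at hprev
        refine ⟨i, by omega, by omega, fun j hj hhj => ?_⟩
        by_cases hij : j = i
        · exact Or.inl hij
        rcases hheavy i j hi hj (Ne.symm hij) hhi hhj with h | h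
        · exact Or.inr h.symm
        · subst h
          simp only [Nat.add_sub_cancel] at hprev
          omega
    · push Not at hex
      exact ⟨1, le_rfl, by omega, fun j hj hhj => absurd hhj (by have := hex j hj; omega)⟩
  have hsplit : l = l.take i ++ ([l[i], l[i + 1]] ++ l.drop (i + 2)) := by
    conv_lhs => rw [← List.take_append_drop i l, List.drop_eq_getElem_cons (by omega),
      List.drop_eq_getElem_cons (by omega)]
    rfl
  have hadj : G.Adj l[i] l[i + 1] := (h1.adj_getElem _ _).2 (Or.inl rfl)
  have hout : ∀ v, v ∈ l.take i ∨ v ∈ l.drop (i + 2) → v ≠ l[i] ∧ v ≠ l[i + 1] ∧ v ∈ l ∧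
      2 * dg G v < Nat.card V := by
    have key : ∀ j (hj : j < l.length), j ≠ i → j ≠ i + 1 → l[j] ≠ l[i] ∧ l[j] ≠ l[i + 1] ∧
        l[j] ∈ l ∧ 2 * dg G l[j] < Nat.card V := by
      intro j hj hji hji'
      rw [Ne, Ne, h1.nodup.getElem_inj_iff, h1.nodup.getElem_inj_iff]
      refine ⟨hji, hji', List.getElem_mem hj, ?_⟩
      by_contra! hc
      have := hi j hj hc
      tauto
    rintro v (hv | hv)
    · obtain ⟨j, hj, rfl⟩ := List.mem_take_iff_getElem.1 hv
      exact key j (by omega) (by omega) (by omega)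
    · obtain ⟨j, hj, rfl⟩ := List.mem_drop_iff_getElem.1 hv
      exact key (i + 2 + j) (by omega) (by omega) (by omega)
  have hK : ∀ v, v ∈ l.take i ∨ v ∈ l.drop (i + 2) →
      v ∉ {v | v = l[i] ∨ v = l[i + 1] ∨ (G.Adj l[i] v ∧ G.Adj l[i + 1] v)} := by
    intro v hv hvK
    obtain ⟨k1, k2, k3, -⟩ := hout v hv
    rcases hvK with hvK | hvK | ⟨k4, k5⟩
    · exact k1 hvK
    · exact k2 hvK
    · exact h1.not_triangle (List.getElem_mem _) (List.getElem_mem _) k3 hadj k4 k5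
  refine ⟨l[i], l[i + 1], l.take i, l.drop (i + 2), hadj, by rwa [← hsplit], ?_, by simp,
    Flank.of_disjoint ?_ fun v hv => hK v (Or.inl hv),
    Flank.of_disjoint ?_ fun v hv => hK v (Or.inr hv), ?_, fun v hv => (hout v hv).2.2.2⟩
  · simp
  · intro h
    have := congrArg List.length h
    simp only [List.length_take, List.length_nil] at this
    omega
  · intro h
    have := congrArg List.length h
    simp only [List.length_drop, List.length_nil] at this
    omega
  · simp only [List.length_take, List.length_drop]
    omega

lemma Flank.exists_neighbors {K : Set V} {l : List V} (h : Flank K l) (hl : IndPath G l) {x : V}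
    (hx : x ∈ l) (hxK : x ∈ K) : ∃ c ∈ l, ∃ d ∈ l, c ∉ K ∧ d ∉ K ∧ G.Adj x c ∧ G.Adj x d ∧
      c ≠ d ∧ ¬ G.Adj c d := by
  obtain ⟨A, B, rfl⟩ := List.append_of_mem hx
  obtain ⟨-, h2, h3, h4⟩ := h
  obtain rfl | ⟨A, c, rfl⟩ := List.eq_nil_or_concat' A
  · exact absurd hxK (h2 x (by simp))
  obtain _ | ⟨d, B⟩ := B
  · exact absurd hxK (h3 x (by simp))
  obtain ⟨k1, k2, k3⟩ := indPath_append.1 hl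
  have hcx := (k3 c (by simp) x (by simp)).2.2 (by simp)
  have hxd : G.Adj x d := (k2.1 d (by simp)).2.2 rfl
  obtain ⟨hcd, hcd'⟩ := k3 c (by simp) d (by simp)
  have hxd' := hxd.ne
  have hc := (List.isChain_append.1 h4).2.2 c (by simp) x (by simp)
  have hd := (List.isChain_cons_cons.1 (List.isChain_append.1 h4).2.1).1
  refine ⟨c, by simp, d, by simp, by tauto, by tauto, hcx.symm, hxd, hcd, ?_⟩
  rw [hcd']
  simpa using hxd'

lemma exists_first {p : V → Prop} {l : List V} (h : ∃ x ∈ l, p x) :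
    ∃ A x B, l = A ++ x :: B ∧ p x ∧ ∀ y ∈ A, ¬ p y := by
  classical
  induction l with
  | nil => simp at h
  | cons a l ih =>
    by_cases ha : p a
    · exact ⟨[], a, l, rfl, ha, by simp⟩
    · obtain ⟨A, x, B, rfl, h1, h2⟩ := ih (by simpa [ha] using h)
      exact ⟨a :: A, x, B, rfl, h1, by simpa [ha] using h2⟩

lemma exists_last {p : V → Prop} {l : List V} (h : ∃ x ∈ l, p x) :
    ∃ A x B, l = A ++ x :: B ∧ p x ∧ ∀ y ∈ B, ¬ p y := by
  obtain ⟨A, x, B, h1, h2, h3⟩ := exists_first (l := l.reverse) (by simpa using h)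
  refine ⟨B.reverse, x, A.reverse, ?_, h2, by simpa using h3⟩
  rw [← List.reverse_reverse l, h1]
  simp

/-- Every induced path on six vertices has an end of degree at least half the order. -/
def HeavyEnds (G : SimpleGraph V) : Prop :=
  ∀ l, IndPath G l → ∀ j (hj : j + 5 < l.length),
    Nat.card V ≤ 2 * dg G l[j] ∨ Nat.card V ≤ 2 * dg G l[j + 5]

lemma HeavyEnds.false_of_window (h : HeavyEnds G) {L T R : List V} (hl : IndPath G (L ++ (T ++ R)))
    (hT : T.length ≤ 3) (hL : L ≠ []) (hR : R ≠ []) (h6 : 6 ≤ L.length + T.length + R.length)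
    (hlight : ∀ v, v ∈ L ∨ v ∈ R → 2 * dg G v < Nat.card V) : False := by
  have hL' := List.length_pos_of_ne_nil hL
  have hR' := List.length_pos_of_ne_nil hR
  have hj : L.length + T.length - 5 + 5 < (L ++ (T ++ R)).length := by
    simp only [List.length_append]
    omega
  rcases h _ hl _ hj with h | h
  · rw [List.getElem_append_left (by omega)] at h
    exact absurd h (not_le.2 (hlight _ (Or.inl (List.getElem_mem _))))
  · rw [List.getElem_append_right (by omega), List.getElem_append_right (by omega)] at h
    exact absurd h (not_le.2 (hlight _ (Or.inr (List.getElem_mem _))))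

lemma IndPath.join {A B : List V} {q : V} (hA : IndPath G (q :: A)) (hB : IndPath G (q :: B))
    (h : ∀ u ∈ A, ∀ v ∈ B, u ≠ v ∧ ¬ G.Adj u v) : IndPath G (A.reverse ++ q :: B) := by
  have h1 := hA.reverse
  rw [List.reverse_cons] at h1
  rw [show A.reverse ++ q :: B = (A.reverse ++ [q]) ++ B by simp]
  refine indPath_append.2 ⟨h1, hB.2, fun u hu v hv => ?_⟩
  simp only [List.mem_append, List.mem_reverse, List.mem_singleton] at hu
  simp only [List.getLast?_append, List.getLast?_singleton, Option.some_or, Option.some_inj]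
  rcases hu with hu | rfl
  · obtain ⟨k1, k2⟩ := h u hu v hv
    have := (hA.1 u hu).1.symm
    exact ⟨k1, by tauto⟩
  · obtain ⟨k1, k2⟩ := hB.1 v hv
    exact ⟨k1.symm, by tauto⟩

lemma IndPath.exists_shortcut {h q : V} {C R : List V} (hP : IndPath G (h :: C ++ R))
    (hq : q ∉ h :: C ++ R) (hqh : G.Adj q h) (hqR : ∀ v ∈ R, ¬ G.Adj q v) :
    ∃ c C', C' ⊆ C ∧ c :: C' ⊆ h :: C ∧ IndPath G (q :: (c :: C' ++ R)) := by
  obtain ⟨pre, suf, h1, h2, h3⟩ := hP.exists_suffix hq ⟨h, by simp, hqh⟩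
  have hsuf : ∀ v, suf.head? = some v → G.Adj q v := fun v hv =>
    ((h3.1 v (List.mem_of_head? hv)).2).2 hv
  obtain ⟨c, suf, rfl⟩ := List.exists_cons_of_ne_nil h2
  have hqc := hsuf c rfl
  rcases List.append_eq_append_iff.1 h1 with ⟨as, rfl, hR⟩ | ⟨bs, hC, hR⟩
  · exact absurd hqc (hqR c (by simp [hR]))
  · obtain _ | ⟨c', C'⟩ := bs
    · exact absurd hqc (hqR c (by rw [List.nil_append] at hR; simp [← hR]))
    · obtain ⟨rfl, rfl⟩ := List.cons_eq_cons.1 hR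
      refine ⟨c, C', ?_, ?_, h3⟩
      · obtain _ | ⟨x, pre⟩ := pre
        · obtain ⟨-, rfl⟩ := List.cons_eq_cons.1 hC
          exact fun _ h => h
        · obtain ⟨-, rfl⟩ := List.cons_eq_cons.1 hC
          intro v hv
          simp [hv]
      · rw [hC]
        exact List.subset_append_right _ _

/-- Two nonadjacent vertices of large degree in the middle part of a framed path have a common
neighbour without neighbours in the outer parts. -/
lemma Framed.exists_common_neighbor [Finite V] {K : Set V} {L M R : List V}
    (h : Framed G K L M R) (hCO : CO G) (hGH : G ≤ H)
    (hH : ∀ x y, x ≠ y → Nat.card V ≤ dg H x + dg H y → H.Adj x y)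
    (hK : ∀ x c d, c ∈ K → d ∈ K → c ≠ d → H.Adj x c → H.Adj x d → x ∈ K) {h₁ h₂ : V}
    (h₁K : h₁ ∈ K) (h₂K : h₂ ∈ K) (hne : h₁ ≠ h₂) (hnadj : ¬ G.Adj h₁ h₂)
    (hh₁ : Nat.card V ≤ 2 * dg G h₁) (hh₂ : Nat.card V ≤ 2 * dg G h₂) :
    ∃ q, G.Adj h₁ q ∧ G.Adj h₂ q ∧ ∀ v, v ∈ L ∨ v ∈ R → ¬ G.Adj q v := by
  obtain ⟨hP, -, -, hL, hR, -, hlight⟩ := h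
  have hcard := common_neighbors_card hne hnadj (by omega)
  have hQK : ∀ q, G.Adj h₁ q → G.Adj h₂ q → q ∈ K := fun q k1 k2 =>
    hK q h₁ h₂ h₁K h₂K hne (hGH k1.symm) (hGH k2.symm)
  have hnK : ∀ v, v ∈ L ∨ v ∈ R → ∀ q ∈ K, G.Adj q v → v ∉ K := by
    intro v hv q hq hqv hvK
    obtain ⟨c, hc, d, hd, hcK, hdK, hvc, hvd, hcd, hcd'⟩ : ∃ c, (c ∈ L ∨ c ∈ R) ∧
        ∃ d, (d ∈ L ∨ d ∈ R) ∧ c ∉ K ∧ d ∉ K ∧ G.Adj v c ∧ G.Adj v d ∧ c ≠ d ∧ ¬ G.Adj c d := by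
      rcases hv with hv | hv
      · obtain ⟨c, hc, d, hd, k⟩ := hL.exists_neighbors hP.left hv hvK
        exact ⟨c, Or.inl hc, d, Or.inl hd, k⟩
      · obtain ⟨c, hc, d, hd, k⟩ := hR.exists_neighbors hP.right.right hv hvK
        exact ⟨c, Or.inr hc, d, Or.inr hd, k⟩
    have key : ∀ c, c ∉ K → G.Adj v c → ¬ hrel G c q := by
      intro c hcK hvc hr
      have hcq : c ≠ q := fun h => hcK (h ▸ hq)
      refine hcK (hK c v q hvK hq hqv.ne' (hGH hvc.symm) ?_)
      rcases hr with hr | hr | hr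
      · exact absurd hr hcq
      · exact hGH hr
      · exact hH c q hcq (hr.trans (Nat.add_le_add (dg_mono hGH c) (dg_mono hGH q)))
    rcases hCO v c d q hvc hvd hqv.symm with hr | hr | hr
    · rcases hr with hr | hr | hr
      · exact hcd hr
      · exact hcd' hr
      · have := hlight c hc
        have := hlight d hd
        omega
    · exact key c hcK hvc hr
    · exact key d hdK hvd hr
  by_contra! hcon
  have hch : ∀ q, ∃ v, q ∈ {v | G.Adj h₁ v ∧ G.Adj h₂ v} → (v ∈ L ∨ v ∈ R) ∧ G.Adj q v := by
    intro q
    by_cases hq : q ∈ {v | G.Adj h₁ v ∧ G.Adj h₂ v}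
    · obtain ⟨v, k1, k2⟩ := hcon q hq.1 hq.2
      exact ⟨v, fun _ => ⟨k1, k2⟩⟩
    · exact ⟨q, fun h => absurd h hq⟩
  choose f hf using hch
  have hle := Set.ncard_le_ncard_of_injOn (s := {v | G.Adj h₁ v ∧ G.Adj h₂ v})
    (t := {v | v ≠ h₁ ∧ v ≠ h₂ ∧ ¬ G.Adj h₁ v ∧ ¬ G.Adj h₂ v}) f ?_ ?_ (Set.toFinite _)
  · omega
  · intro q hq
    obtain ⟨k1, k2⟩ := hf q hq
    have hqK := hQK q hq.1 hq.2
    have hfK := hnK _ k1 q hqK k2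
    refine ⟨fun h => hfK (h ▸ h₁K), fun h => hfK (h ▸ h₂K), fun h => hfK ?_, fun h => hfK ?_⟩
    · exact hK _ h₁ q h₁K hqK hq.1.ne (hGH h.symm) (hGH k2.symm)
    · exact hK _ h₂ q h₂K hqK hq.2.ne (hGH h.symm) (hGH k2.symm)
  · intro q hq q' hq' hqq
    by_contra hne'
    obtain ⟨k1, k2⟩ := hf q hq
    obtain ⟨k3, k4⟩ := hf q' hq'
    have hqK := hQK q hq.1 hq.2
    refine hnK _ k1 q hqK k2 (hK _ q q' hqK (hQK q' hq'.1 hq'.2) hne' (hGH k2.symm) ?_)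
    rw [hqq]
    exact hGH k4.symm

lemma HeavyEnds.not_framed [Finite V] {K : Set V} {L M R : List V} (hends : HeavyEnds G)
    (hCO : CO G) (hGH : G ≤ H) (hH : ∀ x y, x ≠ y → Nat.card V ≤ dg H x + dg H y → H.Adj x y)
    (hK : ∀ x c d, c ∈ K → d ∈ K → c ≠ d → H.Adj x c → H.Adj x d → x ∈ K) :
    ¬ Framed G K L M R := by
  intro hF
  obtain ⟨hP, hM, hM2, hL, hR, h4, hlight⟩ := id hF
  have hR0 := hR.1
  by_cases h1 : ∃ x ∈ M, Nat.card V ≤ 2 * dg G x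
  swap
  · push Not at h1
    refine hends.false_of_window (L := L) (T := []) (R := M ++ R) (by simpa using hP) (by simp)
      hL.1 (by simp [hR0]) (by simp; omega) ?_
    rintro v (hv | hv)
    · exact hlight v (Or.inl hv)
    · rcases List.mem_append.1 hv with hv | hv
      · exact h1 v hv
      · exact hlight v (Or.inr hv)
  obtain ⟨A, x, M₁, rfl, hx, hA⟩ := exists_first h1
  have hlight₁ : ∀ v ∈ L ++ A, 2 * dg G v < Nat.card V := by
    intro v hv
    rcases List.mem_append.1 hv with hv | hv
    · exact hlight v (Or.inl hv)
    · exact not_le.1 (hA v hv)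
  simp only [List.length_append, List.length_cons] at hM2
  by_cases h2 : ∃ y ∈ M₁, Nat.card V ≤ 2 * dg G y
  swap
  · push Not at h2
    refine hends.false_of_window (L := L ++ A) (T := [x]) (R := M₁ ++ R) (by simpa using hP)
      (by simp) (by simp [hL.1]) (by simp [hR0]) (by simp; omega) ?_
    rintro v (hv | hv)
    · exact hlight₁ v hv
    · rcases List.mem_append.1 hv with hv | hv
      · exact h2 v hv
      · exact hlight v (Or.inr hv)
  obtain ⟨B, y, C, rfl, hy, hC⟩ := exists_last h2
  have hlight₂ : ∀ v ∈ C ++ R, 2 * dg G v < Nat.card V := by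
    intro v hv
    rcases List.mem_append.1 hv with hv | hv
    · exact not_le.1 (hC v hv)
    · exact hlight v (Or.inr hv)
  simp only [List.length_append, List.length_cons] at hM2
  obtain rfl | hB := eq_or_ne B []
  · refine hends.false_of_window (L := L ++ A) (T := [x, y]) (R := C ++ R) (by simpa using hP)
      (by simp) (by simp [hL.1]) (by simp [hR0]) (by simp; omega) ?_
    rintro v (hv | hv)
    · exact hlight₁ v hv
    · exact hlight₂ v hv
  have hP' : IndPath G ((L ++ A ++ [x]) ++ (B ++ (y :: C ++ R))) := by simpa using hP
  have hcross : ∀ u ∈ L ++ A ++ [x], ∀ v ∈ y :: C ++ R, u ≠ v ∧ ¬ G.Adj u v := by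
    intro u hu v hv
    obtain ⟨k1, k2⟩ := (indPath_append.1 hP').2.2 u hu v (List.mem_append_right _ hv)
    refine ⟨k1, fun h => ?_⟩
    have h5 := (k2.1 h).2
    rw [List.head?_append_of_ne_nil _ hB] at h5
    exact ((indPath_append.1 hP'.right).2.2 v (List.mem_of_head? h5) v hv).1 rfl
  obtain ⟨hxy, hnxy⟩ := hcross x (by simp) y (by simp)
  obtain ⟨q, hxq, hyq, hq⟩ := hF.exists_common_neighbor hCO hGH hH hK (hM x (by simp))
    (hM y (by simp)) hxy hnxy hx hy
  have hq₁ : q ∉ L ++ A ++ [x] := fun h => (hcross q h y (by simp)).2 hyq.symm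
  have hq₂ : q ∉ y :: C ++ R := fun h => (hcross x (by simp) q h).2 hxq
  obtain ⟨c, C', hC₁, hC₂, hPC⟩ := hP'.right.right.exists_shortcut hq₂ hyq.symm
    fun v hv => hq v (Or.inr hv)
  have hrev : (L ++ A ++ [x]).reverse = x :: A.reverse ++ L.reverse := by simp
  obtain ⟨a, A', hA₁, hA₂, hPA⟩ := (hrev ▸ hP'.left.reverse).exists_shortcut
    (by rw [← hrev, List.mem_reverse]; exact hq₁) hxq.symm
    fun v hv => hq v (Or.inl (List.mem_reverse.1 hv))
  have hjoin := hPA.join hPC fun u hu v hv => by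
    refine hcross u ?_ v ?_
    · rw [← List.mem_reverse, hrev]
      rcases List.mem_append.1 hu with hu | hu
      · exact List.mem_append_left _ (hA₂ hu)
      · exact List.mem_append_right _ hu
    · rcases List.mem_append.1 hv with hv | hv
      · exact List.mem_append_left _ (hC₂ hv)
      · exact List.mem_append_right _ hv
  refine hends.false_of_window (L := L ++ A'.reverse) (T := [a, q, c]) (R := C' ++ R)
    (by simpa using hjoin) (by simp) (by simp [hL.1]) (by simp [hR0]) (by simp; omega) ?_
  rintro v (hv | hv)
  · rcases List.mem_append.1 hv with hv | hv
    · exact hlight v (Or.inl hv)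
    · exact not_le.1 (hA v (List.mem_reverse.1 (hA₁ (List.mem_reverse.1 hv))))
  · rcases List.mem_append.1 hv with hv | hv
    · exact not_le.1 (hC v (hC₁ hv))
    · exact hlight v (Or.inr hv)

lemma TwoConn.mono (hGH : G ≤ H) (h : TwoConn G) : TwoConn H :=
  ⟨h.1, fun v u w hu hw => (h.2 v u w hu hw).mono (fun _ _ h => ⟨hGH h.1, h.2⟩) _ _⟩

theorem hamL_of_heavyEnds [Finite V] (hG : TwoConn G) (hCO : CO G) (hends : HeavyEnds G) :
    HamL G := by
  by_contra hH
  obtain ⟨H, hstep, hGH, hCO', hH', hcl⟩ := exists_closure hG.1 hCO hH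
  have hD := closed_diamondFree hcl
  have hheavy : ∀ x y, x ≠ y → Nat.card V ≤ dg H x + dg H y → H.Adj x y :=
    fun x y hxy hsum => adj_of_heavy_pair hcl hxy hsum
  have hW : H.IsClique {v | Nat.card V ≤ 2 * dg H v} := by
    intro x hx y hy hxy
    have hx' : Nat.card V ≤ 2 * dg H x := hx
    have hy' : Nat.card V ≤ 2 * dg H y := hy
    exact hheavy x y hxy (by omega)
  obtain ⟨a, l, b, h1, h2, h3, h4⟩ := exists_iSeg_of_not_hamL (closed_clawFree hcl hCO') hD
    (hG.mono hGH) hH' hW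
  obtain ⟨c, d, L, R, hcd, hF⟩ := h1.exists_framed h4 hW (not_le.1 h2) (not_le.1 h3)
  have hK := fun x u v hu hv huv hxu hxv => hD.mem_of_adj_of_adj hcd rfl (x := x) (c := u)
    (d := v) hu hv huv hxu hxv
  obtain ⟨L', M', R', hF'⟩ := hF.of_step hstep hK
  exact hends.not_framed hCO hGH hheavy hK hF'

end Hamiltonicity

section Statement

variable {V : Type*} [Fintype V] {G : SimpleGraph V}

lemma dg_eq_degree [DecidableRel G.Adj] (v : V) : dg G v = G.degree v := by
  rw [← G.card_neighborSet_eq_degree v, ← Nat.card_eq_fintype_card]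
  rfl

lemma twoConn_of_twoConnected (h : TwoConnected G) : TwoConn G := by
  refine ⟨by simpa using h.1, fun v u w hu hw => ?_⟩
  have hr := (h.2 v).preconnected ⟨u, hu⟩ ⟨w, hw⟩
  rw [reachable_iff_reflTransGen] at hr
  exact hr.lift Subtype.val fun a b hab => ⟨hab, a.2, b.2⟩

lemma co_of_clawOHeavy [DecidableRel G.Adj] (h : ClawOHeavy G) : CO G := by
  intro a b₁ b₂ b₃ h1 h2 h3
  by_contra! hc
  simp only [hrel, not_or, not_le, dg_eq_degree, Nat.card_eq_fintype_card] at hc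
  obtain ⟨⟨p1, p2, p3⟩, ⟨q1, q2, q3⟩, r1, r2, r3⟩ := hc
  obtain ⟨u, v, hu, hv, huv, hadj, hd⟩ := h a b₁ b₂ b₃ p1 q1 r1 h1 h2 h3 p2 q2 r2
  simp only [Set.mem_insert_iff, Set.mem_singleton_iff] at hu hv
  rcases hu with rfl | rfl | rfl | rfl <;> rcases hv with rfl | rfl | rfl | rfl <;>
    first
      | exact huv rfl
      | exact hadj (by assumption)
      | exact hadj (SimpleGraph.Adj.symm (by assumption))
      | omega

lemma heavyEnds_of_isInducedP6 [DecidableRel G.Adj]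
    (h : ∀ v : Fin 6 → V, IsInducedP6 G v →
      Fintype.card V ≤ 2 * max (G.degree (v 0)) (G.degree (v 5))) : HeavyEnds G := by
  intro l hl j hj
  have hv := h (fun i => l[j + i.val]) ⟨fun a b hab => ?_, fun a b => ?_⟩
  · simp only [dg_eq_degree, Nat.card_eq_fintype_card]
    rcases le_total (G.degree l[j]) (G.degree l[j + 5]) with hle | hle
    · exact Or.inr (by simpa [hle] using hv)
    · exact Or.inl (by simpa [hle] using hv)
  · have := hl.nodup.getElem_inj_iff.1 hab
    omega
  · rw [hl.adj_getElem]
    omega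

lemma HamL.isHamiltonian [DecidableEq V] (h : HamL G) : G.IsHamiltonian := by
  obtain ⟨a, l, b, ⟨hc, ha, hb⟩, hba, hnd, hall, hlen⟩ := h
  have hne : l ≠ [] := by rintro rfl; simp at ha
  have hcard : l.length = Fintype.card V := by
    rw [← List.toFinset_card_of_nodup hnd, ← Finset.card_univ]
    congr 1
    ext v
    simp [hall v]
  obtain rfl : l.head hne = a := by simpa [List.head?_eq_some_head hne] using ha
  obtain rfl : l.getLast hne = b := by simpa [List.getLast?_eq_some_getLast hne] using hb
  have hsupp := Walk.support_ofSupport hne hc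
  have hlength := Walk.length_ofSupport hne hc
  generalize Walk.ofSupport l hne hc = p at hsupp hlength
  have hp : p.IsPath := Walk.IsPath.mk' (hsupp.symm ▸ hnd)
  refine fun _ => ⟨_, Walk.cons hba p, ?_⟩
  rw [Walk.isHamiltonianCycle_iff_isCycle_and_length_eq, Walk.cons_isCycle_iff]
  refine ⟨⟨hp, fun he => ?_⟩, by simp; omega⟩
  rw [Sym2.eq_swap] at he
  have := congrArg Walk.length (hp.eq_adj_toWalk_of_mem_edges he)
  simp at this
  omega

end Statement

end ClawHeavy

/-- If `G` is a 2-connected claw-o-heavy graph of order `n` such that for every induced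
path `v₁v₂v₃v₄v₅v₆` on 6 vertices we have `max{d(v₁), d(v₆)} ≥ n/2`, then `G` is
hamiltonian. -/
theorem stmt_1 {V : Type*} [Fintype V] [DecidableEq V] (G : SimpleGraph V) [DecidableRel G.Adj]
    (h2conn : TwoConnected G) (hclaw : ClawOHeavy G)
    (hP6 : ∀ v : Fin 6 → V, IsInducedP6 G v →
      Fintype.card V ≤ 2 * max (G.degree (v 0)) (G.degree (v 5))) :
    G.IsHamiltonian := by
  exact (ClawHeavy.hamL_of_heavyEnds (ClawHeavy.twoConn_of_twoConnected h2conn)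
    (ClawHeavy.co_of_clawOHeavy hclaw) (ClawHeavy.heavyEnds_of_isInducedP6 hP6)).isHamiltonian
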